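/- Let EP be a minimum-order non-4-colorable maximal planar graph, e = ab an edge with incident triangles abN and abS. Then the graph (EP − {e}) ∪ {NS}, obtained by deleting edge ab and adding edge NS inside the resulting quadrilateral face, is a 4-colorable maximal planar graph. -/

import Mathlib

open SimpleGraph

/-- A simple graph is planar if it admits a straight-line drawing in the plane
(by Fáry's theorem this is equivalent to topological planarity for simple graphs):
an injective placement of the vertices such that two distinct edges, drawn as
closed segments, meet only in common endpoints. -/
def IsPlanar {V : Type} (G : SimpleGraph V) : Prop :=
  ∃ pos : V → ℝ × ℝ, Function.Injective pos ∧
    ∀ u v x y : V, G.Adj u v → G.Adj x y → s(u, v) ≠ s(x, y) →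
      ∀ p : ℝ × ℝ, p ∈ segment ℝ (pos u) (pos v) → p ∈ segment ℝ (pos x) (pos y) →
        (p = pos u ∨ p = pos v) ∧ (p = pos x ∨ p = pos y)

/-- A maximal planar graph (planar triangulation): planar, and no edge between
two non-adjacent vertices can be added while preserving planarity. -/
def IsMaximalPlanar {V : Type} [Fintype V] (G : SimpleGraph V) : Prop :=
  IsPlanar G ∧ ∀ u v : V, u ≠ v → ¬ G.Adj u v →
    ¬ IsPlanar (G ⊔ SimpleGraph.fromEdgeSet {s(u, v)})

/-- A minimum-order counterexample to the Four Color Theorem: a maximal planar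
graph that is not 4-colorable, of minimum number of vertices among all such graphs. -/
def IsMinCounterexample {V : Type} [Fintype V] (G : SimpleGraph V) : Prop :=
  IsMaximalPlanar G ∧ ¬ G.Colorable 4 ∧
    ∀ (W : Type) [Fintype W] (H : SimpleGraph W),
      IsMaximalPlanar H → ¬ H.Colorable 4 → Fintype.card V ≤ Fintype.card W



open SimpleGraph

structure IsTri {V : Type} [Fintype V] (G : SimpleGraph V) (F : V → V → V → Prop) : Prop where
  rot : ∀ {u v w}, F u v w → F v w u
  adj : ∀ {u v w}, F u v w → G.Adj u v
  ex : ∀ {u v}, G.Adj u v → ∃ w, F u v w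
  uniq : ∀ {u v w w'}, F u v w → F u v w' → w = w'
  link : ∀ (v : V) (P : V → Prop), (∀ u w, F v u w → P u → P w) →
    ∀ u u', G.Adj v u → G.Adj v u' → P u → P u'
  conn : ∀ P : V → Prop, (∀ u v, G.Adj u v → P u → P v) → ∀ u v, P u → P v
  hom : ∀ γ : V → V → ZMod 2, (∀ u v, γ u v = γ v u) → (∀ u v, ¬ G.Adj u v → γ u v = 0) →
    (∀ u, ∑ v, γ u v = 0) → ∃ h : V → V → ZMod 2, (∀ u v w, F u v w → h u v = h v w) ∧
      ∀ u v, G.Adj u v → h u v + h v u = γ u v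

namespace IsTri
variable {V : Type} [Fintype V] {G : SimpleGraph V} {F : V → V → V → Prop}

theorem adj2 (T : IsTri G F) {u v w} (h : F u v w) : G.Adj v w := T.adj (T.rot h)
theorem adj3 (T : IsTri G F) {u v w} (h : F u v w) : G.Adj w u := T.adj (T.rot (T.rot h))

/-- predecessor in the rotation -/
theorem uniq' (T : IsTri G F) {u u' v w} (h : F u v w) (h' : F u' v w) : u = u' :=
  T.uniq (T.rot h) (T.rot h')

theorem dual (T : IsTri G F) (Q : V → V → V → Prop) (hr : ∀ u v w, F u v w → Q u v w → Q v w u)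
    (hc : ∀ u v w w', F u v w → F v u w' → Q u v w → Q v u w')
    {a b c} (h0 : F a b c) (hq : Q a b c) : ∀ u v w, F u v w → Q u v w := by
  have star : ∀ v u w, F v u w → Q v u w → ∀ u' w', F v u' w' → Q v u' w' := by
    intro v u w h hq u' w' h'
    have := T.link v (fun s => ∀ t, F v s t → Q v s t) (by
      intro s t hst hs r hr'
      have h1 := hs t hst
      have h2 := hr _ _ _ hst h1
      have h3 := hr _ _ _ (T.rot hst) h2
      exact hc _ _ _ _ (T.rot (T.rot hst)) hr' h3) u u' (T.adj h) (T.adj h')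
      (by intro t ht; rwa [T.uniq ht h])
    exact this w' h'
  have := T.conn (fun v => ∀ u w, F v u w → Q v u w) (by
    intro u v huv hu
    obtain ⟨w, hw⟩ := T.ex huv
    have h1 := hr _ _ _ hw (hu _ _ hw)
    exact star v _ _ (T.rot hw) h1) a
  intro u v w h
  exact this u (star a _ _ h0 hq) v w h

theorem conn2 (T : IsTri G F) {p q : V} (hpq : G.Adj p q) (P : V → Prop)
    (hP : ∀ u v, u ≠ p → u ≠ q → v ≠ p → v ≠ q → G.Adj u v → P u → P v) :
    ∀ u v, u ≠ p → u ≠ q → v ≠ p → v ≠ q → P u → P v := by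
  have hP' : ∀ u v, u ≠ p → u ≠ q → v ≠ p → v ≠ q → G.Adj u v → (P u ↔ P v) :=
    fun u v a b c d e => ⟨hP u v a b c d e, hP v u c d a b e.symm⟩
  obtain ⟨w, hw⟩ := T.ex hpq
  have hwp := (T.adj3 hw).ne
  have hwq := (T.adj2 hw).ne.symm
  have n1 : ∀ u, G.Adj p u → u = q ∨ (P u ↔ P w) := by
    intro u hu
    refine T.link p (fun u => u = q ∨ (P u ↔ P w)) ?_ q u hpq hu (Or.inl rfl)
    intro s t hst hs
    by_cases ht : t = q
    · exact Or.inl ht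
    · right
      rcases hs with rfl | hs
      · rw [T.uniq hst hw]
      · by_cases hsq : s = q
        · subst hsq; rw [T.uniq hst hw]
        · rw [← hs]; exact (hP' s t (T.adj hst).ne.symm hsq (T.adj3 hst).ne ht (T.adj2 hst)).symm
  have n2 : ∀ u, G.Adj q u → u = p ∨ (P u ↔ P w) := by
    intro u hu
    refine T.link q (fun u => u = p ∨ (P u ↔ P w)) ?_ w u (T.adj2 hw) hu (Or.inr Iff.rfl)
    intro s t hst hs
    by_cases ht : t = p
    · exact Or.inl ht
    · right
      by_cases hsp : s = p
      · subst hsp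
        have := n1 t (T.adj2 hst)
        rcases this with h | h
        · exact absurd h (T.adj3 hst).ne
        · exact h
      · rcases hs with hs | hs
        · exact absurd hs hsp
        · rw [← hs]; exact (hP' s t hsp (T.adj hst).ne.symm ht (T.adj3 hst).ne (T.adj2 hst)).symm
  have := T.conn (fun u => u = p ∨ u = q ∨ (P u ↔ P w)) (by
    intro u v huv hu
    by_cases h1 : v = p
    · exact Or.inl h1
    by_cases h2 : v = q
    · exact Or.inr (Or.inl h2)
    right; right
    by_cases h3 : u = p
    · subst h3; exact (n1 v huv).resolve_left h2
    by_cases h4 : u = q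
    · subst h4; exact (n2 v huv).resolve_left h1
    have h5 := (hu.resolve_left h3).resolve_left h4
    rw [← h5]; exact (hP' u v h3 h4 h1 h2 huv).symm) p
  intro u v h1 h2 h3 h4 hu
  have a := ((this u (Or.inl rfl)).resolve_left h1).resolve_left h2
  have b := ((this v (Or.inl rfl)).resolve_left h3).resolve_left h4
  exact b.2 (a.1 hu)

theorem opp_ne (T : IsTri G F) (hn : 4 ≤ Fintype.card V) {u v w w'} (h : F u v w) (h' : F v u w') :
    w ≠ w' := by
  rintro rfl
  have key : ∀ a b c, F a b c → F b a c → ∀ d, G.Adj a d → d = b ∨ d = c := by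
    intro a b c h h' d hd
    refine T.link a (fun d => d = b ∨ d = c) ?_ b d (T.adj h) hd (Or.inl rfl)
    rintro s t hst (rfl | rfl)
    · exact Or.inr (T.uniq hst h)
    · exact Or.inl (T.uniq hst (T.rot h'))
  have := T.conn (fun s => s = u ∨ s = v ∨ s = w) (by
    rintro s t hst (rfl | rfl | rfl)
    · have := key _ _ _ h h' t hst; tauto
    · have := key _ _ _ h' h t hst; tauto
    · have := key _ _ _ (T.rot (T.rot h)) (T.rot h') t hst; tauto) u
  classical
  have hc : (Finset.univ : Finset V) ⊆ {u, v, w} := by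
    intro s _
    have := this s (Or.inl rfl)
    simpa using this
  have := Finset.card_le_card hc
  have h3 : ({u, v, w} : Finset V).card ≤ 3 := Finset.card_le_three
  rw [Finset.card_univ] at this
  omega

open Classical in
theorem path_chain (R : V → V → Prop) {u v : V} (h : Relation.ReflTransGen R u v) :
    ∃ γ : V → V → ZMod 2, (∀ s t, γ s t = γ t s) ∧ (∀ s t, γ s t ≠ 0 → R s t ∨ R t s) ∧
      ∀ s, ∑ t, γ s t = (if s = u then 1 else 0) + (if s = v then 1 else 0) := by
  induction h with
  | refl =>
    refine ⟨fun _ _ => 0, fun _ _ => rfl, fun _ _ h => absurd rfl h, fun s => ?_⟩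
    split_ifs <;> simp; decide
  | @tail b c hab hbc ih =>
    obtain ⟨γ, h1, h2, h3⟩ := ih
    by_cases hne : b = c
    · subst hne; exact ⟨γ, h1, h2, h3⟩
    refine ⟨fun s t => γ s t + (if (s = b ∧ t = c) then 1 else 0) + (if (s = c ∧ t = b) then 1 else 0),
      ?_, ?_, ?_⟩
    · intro s t
      show γ s t + _ + _ = γ t s + _ + _
      rw [h1 s t]
      by_cases e1 : s = b <;> by_cases e2 : s = c <;> by_cases e3 : t = b <;>
        by_cases e4 : t = c <;> simp_all
    · intro s t hst
      by_cases hg : γ s t = 0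
      · by_cases e1 : s = b ∧ t = c
        · left; rw [e1.1, e1.2]; exact hbc
        · by_cases e2 : s = c ∧ t = b
          · right; rw [e2.1, e2.2]; exact hbc
          · simp [hg, e1, e2] at hst
      · exact h2 s t hg
    · intro s
      rw [Finset.sum_add_distrib, Finset.sum_add_distrib, h3 s]
      have e : ∀ x y : V, ∑ t, (if (s = x ∧ t = y) then (1 : ZMod 2) else 0) = if s = x then 1 else 0 := by
        intro x y
        by_cases hs : s = x <;> simp [hs]
      rw [e, e]
      have : ∀ x y z : ZMod 2, x + y + y + z = x + z := by decide
      exact this _ _ _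

/-- the separation property -/
theorem sep (T : IsTri G F) {u v w w' : V} (h : F u v w) (h' : F v u w') (A B : V → Prop)
    (hAB : ∀ s, A s → B s → False)
    (hA : Relation.ReflTransGen (fun s t => G.Adj s t ∧ A s ∧ A t) w w') (hw : A w)
    (hB : Relation.ReflTransGen (fun s t => G.Adj s t ∧ B s ∧ B t ∧ s(s, t) ≠ s(u, v)) u v) :
    False := by
  classical
  obtain ⟨γ, g1, g2, g3⟩ := path_chain _ hB
  have huv : G.Adj u v := T.adj h
  have hBu : B u := by
    rcases Relation.ReflTransGen.cases_head hB with e | ⟨c, hc, _⟩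
    · exact absurd e huv.ne
    · exact hc.2.1
  have hBv : B v := by
    rcases Relation.ReflTransGen.cases_tail hB with e | ⟨c, _, hc⟩
    · exact absurd e.symm huv.ne
    · exact hc.2.2.1
  have g0 : γ u v = 0 := by
    by_contra hne
    rcases g2 u v hne with hh | hh
    · exact hh.2.2.2 rfl
    · exact hh.2.2.2 (Sym2.eq_swap)
  obtain ⟨η, e1, e2, e3⟩ := path_chain (fun s t => s = u ∧ t = v) (Relation.ReflTransGen.single ⟨rfl, rfl⟩)
  have e0 : η u v = 1 := by
    have := e3 u
    rw [Finset.sum_eq_single v] at this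
    · simpa [huv.ne] using this
    · intro b _ hb
      by_contra hh
      rcases e2 u b hh with h | h
      · exact hb h.2
      · exact huv.ne h.2
    · simp
  obtain ⟨k, k1, k2⟩ := T.hom (fun s t => γ s t + η s t) (fun s t => by rw [g1, e1])
    (by
      intro s t hst
      have a : γ s t = 0 := by
        by_contra hne
        rcases g2 s t hne with hh | hh
        · exact hst hh.1
        · exact hst hh.1.symm
      have b : η s t = 0 := by
        by_contra hne
        rcases e2 s t hne with ⟨rfl, rfl⟩ | ⟨rfl, rfl⟩
        · exact hst huv
        · exact hst huv.symm
      rw [a, b]; rfl)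
    (by
      intro s
      rw [Finset.sum_add_distrib, g3, e3]
      have : ∀ x : ZMod 2, x + x = 0 := by decide
      exact this _)
  have z : ∀ s t, ¬ B s → γ s t + η s t = 0 := by
    intro s t hs
    have a : γ s t = 0 := by
      by_contra hne
      rcases g2 s t hne with hh | hh
      · exact hs hh.2.1
      · exact hs hh.2.2.1
    have b : η s t = 0 := by
      by_contra hne
      rcases e2 s t hne with ⟨rfl, rfl⟩ | ⟨rfl, rfl⟩
      · exact hs hBu
      · exact hs hBv
    rw [a, b]; rfl
  have eqz : ∀ x y : ZMod 2, x + y = 0 → x = y := by decide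
  have st : ∀ s, ¬ B s → ∀ t t', G.Adj s t → G.Adj s t' → k s t = k s t' := by
    intro s hs t t' ht ht'
    refine T.link s (fun r => k s t = k s r) ?_ t t' ht ht' rfl
    intro a b hab ha
    rw [ha, k1 _ _ _ hab, k1 _ _ _ (T.rot hab)]
    have := k2 b s (T.adj3 hab)
    rw [g1, e1, z s b hs] at this
    exact eqz _ _ this
  have pth : ∀ r, Relation.ReflTransGen (fun s t => G.Adj s t ∧ A s ∧ A t) w r →
      ∀ t t', G.Adj w t → G.Adj r t' → k w t = k r t' := by
    intro r hr
    induction hr with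
    | refl => exact st w (fun hb => hAB w hw hb)
    | @tail b c _ hbc ih =>
      intro t t' ht ht'
      have h1 := ih t c ht hbc.1
      have h2 := k2 b c hbc.1
      rw [z b c (fun hb => hAB b hbc.2.1 hb)] at h2
      rw [h1, eqz _ _ h2]
      exact st c (fun hb => hAB c hbc.2.2 hb) _ _ hbc.1.symm ht'
  have q := pth w' hA u v (T.adj3 h) (T.adj3 h')
  have q1 := k1 _ _ _ (T.rot (T.rot h))
  have q2 := k1 _ _ _ (T.rot (T.rot h'))
  have q3 := k2 u v huv
  rw [g0, e0] at q3
  rw [← q1, q, q2] at q3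
  have : ∀ x : ZMod 2, x + x ≠ 0 + 1 := by decide
  exact this _ q3

end IsTri


open SimpleGraph

def Rot {V : Type} (x y z p q r : V) : Prop :=
  (p = x ∧ q = y ∧ r = z) ∨ (p = y ∧ q = z ∧ r = x) ∨ (p = z ∧ q = x ∧ r = y)

def flipF {V : Type} (F : V → V → V → Prop) (a b N S p q r : V) : Prop :=
  (F p q r ∧ ¬ Rot a b N p q r ∧ ¬ Rot b a S p q r) ∨ Rot N a S p q r ∨ Rot S b N p q r

theorem flipF_swap {V : Type} {F : V → V → V → Prop} {a b N S p q r : V} :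
    flipF F a b N S p q r ↔ flipF F b a S N p q r := by
  unfold flipF; tauto

open Classical in
noncomputable def eg {V : Type} (x y s t : V) : ZMod 2 :=
  if (s = x ∧ t = y) ∨ (s = y ∧ t = x) then 1 else 0

open Classical in
theorem eg_sum {V : Type} [Fintype V] {x y : V} (h : x ≠ y) (s : V) :
    ∑ t, eg x y s t = (if s = x then 1 else 0) + (if s = y then 1 else 0) := by
  unfold eg
  by_cases h1 : s = x
  · subst h1
    simp [h]
  · by_cases h2 : s = y
    · subst h2; simp [h1]
    · simp [h1, h2]

theorem eg_symm {V : Type} (x y s t : V) : eg x y s t = eg x y t s := by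
  unfold eg; grind

theorem flip_aux {V : Type} (h : V → V → ZMod 2) (p k : ZMod 2) {N a S : V} (n1 : N ≠ a) (n2 : a ≠ S) (n3 : N ≠ S) :
    ∃ H : V → V → ZMod 2, H N a = p + k ∧ H a S = p + k ∧ H S N = p + k ∧ H N S = p ∧
      ∀ u v, ¬ (u = N ∧ v = a) → ¬ (u = a ∧ v = S) → ¬ (u = S ∧ v = N) → ¬ (u = N ∧ v = S) → H u v = h u v := by
  classical
  refine ⟨fun u v => if (u = N ∧ v = a) ∨ (u = a ∧ v = S) ∨ (u = S ∧ v = N) then p + k else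
      if (u = N ∧ v = S) then p else h u v, ?_, ?_, ?_, ?_, ?_⟩
  · simp
  · simp
  · simp
  · simp [n1, n2.symm, n3, n3.symm]
  · intro u v a b c d; simp [a, b, c, d]

namespace IsTri
variable {V : Type} [Fintype V] {G : SimpleGraph V} {F : V → V → V → Prop}

theorem flip_link_a (T : IsTri G F) {a b N S : V} (h1 : F a b N) (h2 : F b a S) (hne : N ≠ S)
    (P : V → Prop) (hP : ∀ u w, flipF F a b N S a u w → P u → P w) (u u' : V) (hub : u ≠ b) (hub' : u' ≠ b)
    (hu : G.Adj a u) (hu' : G.Adj a u') (h : P u) : P u' := by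
  have := T.link a (fun s => (s = b ∧ P S) ∨ (s ≠ b ∧ P s)) (by
    intro s t hst hs
    have n1 := (T.adj h1).ne
    have n2 := (T.adj2 h1).ne
    have n3 := (T.adj3 h1).ne
    have n4 := (T.adj2 h2).ne
    have n5 := (T.adj3 h2).ne
    by_cases e1 : s = b
    · subst e1
      have e2 := T.uniq hst h1
      subst e2
      right
      refine ⟨n2.symm, hP S t ?_ ?_⟩
      · unfold flipF Rot; grind
      · grind
    · by_cases e2 : t = b
      · subst e2
        have e3 : s = S := T.uniq (T.rot (T.rot hst)) h2
        subst e3; left; grind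
      · right
        refine ⟨e2, hP s t ?_ (by grind)⟩
        unfold flipF Rot; grind) u u' hu hu' (by grind)
  grind

theorem flip_link_N (T : IsTri G F) {a b N S : V} (h1 : F a b N) (h2 : F b a S) (hne : N ≠ S)
    (P : V → Prop) (hP : ∀ u w, flipF F a b N S N u w → P u → P w) (u u' : V)
    (hu : G.Adj N u ∨ u = S) (hu' : G.Adj N u' ∨ u' = S) (h : P u) : P u' := by
  have n1 := (T.adj h1).ne
  have n2 := (T.adj2 h1).ne
  have n3 := (T.adj3 h1).ne
  have n4 := (T.adj2 h2).ne
  have n5 := (T.adj3 h2).ne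
  have s1 : P a → P S := hP a S (by unfold flipF Rot; grind)
  have s2 : P S → P b := hP S b (by unfold flipF Rot; grind)
  have := T.link N P (by
    intro s t hst hs
    by_cases e1 : s = a
    · subst e1
      have := T.uniq hst (T.rot (T.rot h1))
      subst this
      exact s2 (s1 hs)
    · refine hP s t ?_ hs
      unfold flipF Rot; grind)
  have a1 := T.adj3 h1
  have a2 := (T.adj2 h1).symm
  rcases hu with hu | rfl
  · rcases hu' with hu' | rfl
    · exact this u u' hu hu' h
    · exact s1 (this u a hu a1 h)
  · rcases hu' with hu' | rfl
    · exact this b u' a2 hu' (s2 h)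
    · exact h

set_option maxHeartbeats 1000000 in
theorem flip (T : IsTri G F) {a b N S : V} (h1 : F a b N) (h2 : F b a S) (hne : N ≠ S)
    (hNS : ¬ G.Adj N S) (G' : SimpleGraph V)
    (hG' : ∀ u v, G'.Adj u v ↔ (G.Adj u v ∧ ¬ (u = a ∧ v = b) ∧ ¬ (u = b ∧ v = a)) ∨
      (u = N ∧ v = S) ∨ (u = S ∧ v = N)) : IsTri G' (flipF F a b N S) := by
  have n1 := (T.adj h1).ne
  have n2 := (T.adj2 h1).ne
  have n3 := (T.adj3 h1).ne
  have n4 := (T.adj2 h2).ne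
  have n5 := (T.adj3 h2).ne
  have r1 := T.rot h1
  have r2 := T.rot h2
  have r3 := T.rot r1
  have r4 := T.rot r2
  refine ⟨?_, ?_, ?_, ?_, ?_, ?_, ?_⟩
  · rintro u v w (⟨h, ha, hb⟩ | h | h)
    · left; refine ⟨T.rot h, ?_, ?_⟩ <;> unfold Rot at * <;> grind
    · right; left; unfold Rot at *; grind
    · right; right; unfold Rot at *; grind
  · rintro u v w (⟨h, ha, hb⟩ | h | h)
    · rw [hG']; left; refine ⟨T.adj h, ?_, ?_⟩
      · rintro ⟨rfl, rfl⟩; exact ha (Or.inl ⟨rfl, rfl, T.uniq h h1⟩)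
      · rintro ⟨rfl, rfl⟩; exact hb (Or.inl ⟨rfl, rfl, T.uniq h h2⟩)
    · have b1 := T.adj r3
      have b2 := T.adj r2
      rw [hG']; unfold Rot at h; grind
    · have b1 := T.adj r1
      have b2 := T.adj r4
      rw [hG']; unfold Rot at h; grind
  · intro u v h
    rw [hG'] at h
    rcases h with ⟨h, ha, hb⟩ | ⟨rfl, rfl⟩ | ⟨rfl, rfl⟩
    · obtain ⟨w, hw⟩ := T.ex h
      by_cases c1 : Rot a b N u v w
      · unfold flipF; unfold Rot at *
        rcases c1 with c | ⟨rfl, rfl, rfl⟩ | ⟨rfl, rfl, rfl⟩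
        · grind
        · exact ⟨S, by grind⟩
        · exact ⟨S, by grind⟩
      by_cases c2 : Rot b a S u v w
      · unfold flipF; unfold Rot at *
        rcases c2 with c | ⟨rfl, rfl, rfl⟩ | ⟨rfl, rfl, rfl⟩
        · grind
        · exact ⟨N, by grind⟩
        · exact ⟨N, by grind⟩
      exact ⟨w, Or.inl ⟨hw, c1, c2⟩⟩
    · exact ⟨b, by unfold flipF Rot; grind⟩
    · exact ⟨a, by unfold flipF Rot; grind⟩
  · have key : ∀ {u v w w'}, F u v w → ¬ Rot a b N u v w → ¬ Rot b a S u v w →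
        (Rot N a S u v w' ∨ Rot S b N u v w') → False := by
      intro u v w w' hw x1 x2 x3
      have := T.adj hw
      unfold Rot at x3
      rcases x3 with (⟨rfl, rfl, rfl⟩ | ⟨rfl, rfl, rfl⟩ | ⟨rfl, rfl, rfl⟩) |
        (⟨rfl, rfl, rfl⟩ | ⟨rfl, rfl, rfl⟩ | ⟨rfl, rfl, rfl⟩)
      · exact x1 (by rw [T.uniq hw r3]; unfold Rot; grind)
      · exact x2 (by rw [T.uniq hw r2]; unfold Rot; grind)
      · exact hNS this.symm
      · exact x2 (by rw [T.uniq hw r4]; unfold Rot; grind)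
      · exact x1 (by rw [T.uniq hw r1]; unfold Rot; grind)
      · exact hNS this
    rintro u v w w' (⟨h, ha, hb⟩ | h) (⟨h', ha', hb'⟩ | h')
    · exact T.uniq h h'
    · exact (key h ha hb h').elim
    · exact (key h' ha' hb' h).elim
    · unfold Rot at h h'; grind
  · intro v P hP u u' hu hu' hp
    rw [hG'] at hu hu'
    by_cases ea : v = a
    · subst ea
      exact T.flip_link_a h1 h2 hne P hP u u' (by grind) (by grind) (by grind) (by grind) hp
    by_cases eb : v = b
    · subst eb
      exact T.flip_link_a h2 h1 hne.symm P (fun u w h => hP u w (flipF_swap.2 h)) u u' (by grind) (by grind) (by grind) (by grind) hp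
    by_cases eN : v = N
    · subst eN
      exact T.flip_link_N h1 h2 hne P hP u u' (by grind) (by grind) hp
    by_cases eS : v = S
    · subst eS
      exact T.flip_link_N h2 h1 hne.symm P (fun u w h => hP u w (flipF_swap.2 h)) u u' (by grind) (by grind) hp
    refine T.link v P ?_ u u' (by grind) (by grind) hp
    intro s t hst hs
    refine hP s t ?_ hs
    unfold flipF Rot; grind
  · intro P hP
    refine T.conn P ?_
    intro u v huv hu
    have b1 := T.adj r3
    have b2 := (T.adj r1).symm
    by_cases c : (u = a ∧ v = b) ∨ (u = b ∧ v = a)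
    · rcases c with ⟨rfl, rfl⟩ | ⟨rfl, rfl⟩
      · exact hP N _ ((hG' _ _).2 (by grind)) (hP _ N ((hG' _ _).2 (by grind [SimpleGraph.Adj.symm])) hu)
      · exact hP N _ ((hG' _ _).2 (by grind)) (hP _ N ((hG' _ _).2 (by grind [SimpleGraph.Adj.symm])) hu)
    · exact hP u v ((hG' _ _).2 (by grind)) hu
  · intro γ g1 g2 g3
    set k := γ N S with hk
    have two : ∀ x : ZMod 2, x + x = 0 := by decide
    obtain ⟨h, x1, x2⟩ := T.hom (fun s t => γ s t + k * (eg N S s t + eg N a s t + eg a S s t))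
      (by intro s t; simp only [g1 s t, eg_symm _ _ s t])
      (by
        intro s t hst
        by_cases c : (s = N ∧ t = S) ∨ (s = S ∧ t = N)
        · have : γ s t = k := by rcases c with ⟨rfl, rfl⟩ | ⟨rfl, rfl⟩ <;> grind
          have e1 : eg N S s t = 1 := by unfold eg; grind
          have e2 : eg N a s t = 0 := by unfold eg; grind
          have e3 : eg a S s t = 0 := by unfold eg; grind
          simp only [this, e1, e2, e3, add_zero, mul_one]; exact two _
        · have q1 := T.adj r3
          have q2 := T.adj r2
          have e1 : eg N S s t = 0 := by unfold eg; grind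
          have e2 : eg N a s t = 0 := by unfold eg; grind [SimpleGraph.Adj.symm]
          have e3 : eg a S s t = 0 := by unfold eg; grind [SimpleGraph.Adj.symm]
          have : γ s t = 0 := g2 _ _ (by rw [hG']; grind)
          simp [this, e1, e2, e3])
      (by
        intro s
        rw [Finset.sum_add_distrib, g3, ← Finset.mul_sum, Finset.sum_add_distrib, Finset.sum_add_distrib,
          eg_sum hne, eg_sum n3, eg_sum n4]
        have : ∀ x y z k: ZMod 2, 0 + k * (x + y + (x + z) + (z + y)) = 0 := by decide
        exact this _ _ _ _)
    have eab : h a b = h b a := by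
      have := x2 a b (T.adj h1)
      have e1 : eg N S a b = 0 := by unfold eg; grind
      have e2 : eg N a a b = 0 := by unfold eg; grind
      have e3 : eg a S a b = 0 := by unfold eg; grind
      rw [g2 a b (by rw [hG']; grind), e1, e2, e3] at this
      have q : ∀ x y k : ZMod 2, x + y = 0 + k * (0 + 0 + 0) → x = y := by decide
      exact q _ _ _ this
    have y1 := x1 _ _ _ h1
    have y2 := x1 _ _ _ h2
    have y3 := x1 _ _ _ r1
    have y4 := x1 _ _ _ r2
    obtain ⟨H, p1, p2, p3, p4, p5⟩ := flip_aux h (h a b) k n3 n4 hne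
    refine ⟨H, ?_, ?_⟩
    · have q1 : H S b = h S b := p5 _ _ (by clear * - n1 n2 n3 n4 n5 hne; grind) (by clear * - n1 n2 n3 n4 n5 hne; grind)
        (by clear * - n1 n2 n3 n4 n5 hne; grind) (by clear * - n1 n2 n3 n4 n5 hne; grind)
      have q2 : H b N = h b N := p5 _ _ (by clear * - n1 n2 n3 n4 n5 hne; grind) (by clear * - n1 n2 n3 n4 n5 hne; grind)
        (by clear * - n1 n2 n3 n4 n5 hne; grind) (by clear * - n1 n2 n3 n4 n5 hne; grind)
      rintro u v w (⟨f, ha, hb⟩ | f | f)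
      · have z1 := T.adj f
        have z2 := T.adj2 f
        have c1 : ¬ (u = N ∧ v = a) := by rintro ⟨rfl, rfl⟩; exact ha (by rw [T.uniq f r3]; unfold Rot; grind)
        have c2 : ¬ (u = a ∧ v = S) := by rintro ⟨rfl, rfl⟩; exact hb (by rw [T.uniq f r2]; unfold Rot; grind)
        have c3 : ¬ (v = N ∧ w = a) := by rintro ⟨rfl, rfl⟩; exact ha (by rw [T.uniq' f r1]; unfold Rot; grind)
        have c4 : ¬ (v = a ∧ w = S) := by rintro ⟨rfl, rfl⟩; exact hb (by rw [T.uniq' f h2]; unfold Rot; grind)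
        have c5 : ∀ {u v}, G.Adj u v → ¬ (u = N ∧ v = S) := by rintro u v h ⟨rfl, rfl⟩; exact hNS h
        have c6 : ∀ {u v}, G.Adj u v → ¬ (u = S ∧ v = N) := by rintro u v h ⟨rfl, rfl⟩; exact hNS h.symm
        rw [p5 _ _ c1 c2 (c6 z1) (c5 z1), p5 _ _ c3 c4 (c6 z2) (c5 z2)]
        exact x1 _ _ _ f
      · rcases f with ⟨rfl, rfl, rfl⟩ | ⟨rfl, rfl, rfl⟩ | ⟨rfl, rfl, rfl⟩
        · rw [p1, p2]
        · rw [p2, p3]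
        · rw [p3, p1]
      · rcases f with ⟨rfl, rfl, rfl⟩ | ⟨rfl, rfl, rfl⟩ | ⟨rfl, rfl, rfl⟩
        · rw [q1, q2, ← y4, ← y2, ← eab, y1]
        · rw [q2, p4, y1]
        · rw [p4, q1, ← y4, ← y2, ← eab]
    · intro u v huv
      rw [hG'] at huv
      have f0 : ∀ {u v}, G.Adj u v → ¬(u = N ∧ v = S) ∧ ¬ (u = S ∧ v = N) := by
        rintro u v h; refine ⟨?_, ?_⟩ <;> rintro ⟨rfl, rfl⟩
        · exact hNS h
        · exact hNS h.symm
      have f1 : ∀ {u v}, G.Adj u v → eg N S u v = 0 := by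
        intro u v h; exact if_neg (by rintro (h' | h'); exacts [(f0 h).1 h', (f0 h).2 h'])
      have w1 : H N a + H a N = γ N a := by
        have := x2 N a (T.adj r3)
        rw [f1 (T.adj r3), show eg N a N a = 1 by simp [eg], show eg a S N a = 0 by simp [eg, n3, hne]] at this
        rw [p1, p5 _ _ (by clear * - n1 n2 n3 n4 n5 hne; grind) (by clear * - n1 n2 n3 n4 n5 hne; grind)
          (by clear * - n1 n2 n3 n4 n5 hne; grind) (by clear * - n1 n2 n3 n4 n5 hne; grind), y1, y3]
        have q : ∀ x k l m : ZMod 2, x + l = m + k * (0 + 1 + 0) → x + k + l = m := by decide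
        exact q _ _ _ _ this
      have w2 : H a S + H S a = γ a S := by
        have := x2 a S (T.adj r2)
        rw [f1 (T.adj r2), show eg N a a S = 0 by simp [eg, n3.symm, hne.symm], show eg a S a S = 1 by simp [eg]] at this
        rw [p2, p5 _ _ (by clear * - n1 n2 n3 n4 n5 hne; grind) (by clear * - n1 n2 n3 n4 n5 hne; grind)
          (by clear * - n1 n2 n3 n4 n5 hne; grind) (by clear * - n1 n2 n3 n4 n5 hne; grind), eab, y2]
        have q : ∀ x k l m : ZMod 2, x + l = m + k * (0 + 0 + 1) → x + k + l = m := by decide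
        exact q _ _ _ _ this
      have w3 : H S N + H N S = γ N S := by
        rw [p3, p4, ← hk]
        have : ∀ x k : ZMod 2, (x + k) + x = k := by decide
        exact this _ _
      by_cases c1 : u = N ∧ v = a
      · rw [c1.1, c1.2, w1]
      by_cases c2 : u = a ∧ v = N
      · rw [c2.1, c2.2, add_comm, w1, g1]
      by_cases c3 : u = a ∧ v = S
      · rw [c3.1, c3.2, w2]
      by_cases c4 : u = S ∧ v = a
      · rw [c4.1, c4.2, add_comm, w2, g1]
      rcases huv with ⟨f, ha, hb⟩ | ⟨rfl, rfl⟩ | ⟨rfl, rfl⟩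
      · have := x2 u v f
        obtain ⟨f2, f3⟩ := f0 f
        rw [f1 f, show eg N a u v = 0 from if_neg (by rintro (h | h); exacts [c1 h, c2 h]),
          show eg a S u v = 0 from if_neg (by rintro (h | h); exacts [c3 h, c4 h])] at this
        rw [p5 _ _ c1 c3 f3 f2, p5 _ _ (fun h => c2 h.symm) (fun h => c4 h.symm) (fun h => f2 h.symm) (fun h => f3 h.symm), this]
        simp
      · rw [add_comm, w3]
      · rw [w3, g1]

end IsTri


open SimpleGraph
namespace IsTri

theorem del3 {V : Type} [Fintype V] {G : SimpleGraph (Option V)} {F : Option V → Option V → Option V → Prop}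
    (T : IsTri G F) {x y z : V} (f1 : F none (some x) (some y)) (f2 : F none (some y) (some z))
    (f3 : F none (some z) (some x)) :
    IsTri (G.comap some) (fun p q r => F (some p) (some q) (some r) ∨ Rot x y z p q r) := by
  have nb : ∀ w, G.Adj none w → w = some x ∨ w = some y ∨ w = some z := by
    intro w hw
    refine T.link none (fun w => w = some x ∨ w = some y ∨ w = some z) ?_ (some x) w (T.adj f1) hw (Or.inl rfl)
    rintro s t hst (rfl | rfl | rfl)
    · right; left; exact T.uniq hst f1
    · right; right; exact T.uniq hst f2
    · left; exact T.uniq hst f3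
  have n1 : x ≠ y := fun h => (T.adj2 f1).ne (congrArg some h)
  have n2 : y ≠ z := fun h => (T.adj2 f2).ne (congrArg some h)
  have n3 : z ≠ x := fun h => (T.adj2 f3).ne (congrArg some h)
  have key : ∀ {u v w w' : V}, F (some u) (some v) (some w) → Rot x y z u v w' → False := by
    rintro u v w w' h (⟨rfl, rfl, rfl⟩ | ⟨rfl, rfl, rfl⟩ | ⟨rfl, rfl, rfl⟩)
    · exact absurd (T.uniq h (T.rot f1)) (by simp)
    · exact absurd (T.uniq h (T.rot f2)) (by simp)
    · exact absurd (T.uniq h (T.rot f3)) (by simp)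
  refine ⟨?_, ?_, ?_, ?_, ?_, ?_, ?_⟩
  · rintro u v w (h | h)
    · exact Or.inl (T.rot h)
    · right; unfold Rot at *; tauto
  · rintro u v w (h | h)
    · exact T.adj h
    · rcases h with ⟨rfl, rfl, rfl⟩ | ⟨rfl, rfl, rfl⟩ | ⟨rfl, rfl, rfl⟩
      · exact T.adj2 f1
      · exact T.adj2 f2
      · exact T.adj2 f3
  · intro u v h
    obtain ⟨w, hw⟩ := T.ex (show G.Adj (some u) (some v) from h)
    cases w with
    | some w => exact ⟨w, Or.inl hw⟩
    | none =>
      have hw' := T.rot (T.rot hw)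
      rcases nb _ (T.adj hw') with e | e | e
      · rw [e] at hw'; have := T.uniq hw' f1
        simp only [Option.some.injEq] at e this; subst e this
        exact ⟨z, Or.inr (by unfold Rot; tauto)⟩
      · rw [e] at hw'; have := T.uniq hw' f2
        simp only [Option.some.injEq] at e this; subst e this
        exact ⟨x, Or.inr (by unfold Rot; tauto)⟩
      · rw [e] at hw'; have := T.uniq hw' f3
        simp only [Option.some.injEq] at e this; subst e this
        exact ⟨y, Or.inr (by unfold Rot; tauto)⟩
  · rintro u v w w' (h | h) (h' | h')
    · exact Option.some.inj (T.uniq h h')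
    · exact (key h h').elim
    · exact (key h' h).elim
    · unfold Rot at h h'; grind
  · intro v P hP u u' hu hu' hp
    have gen : ∀ (c : V), (∀ s, F (some v) (some s) none → P s → P c) →
        (∀ s, F (some v) none (some s) → P c → P s) → P u' := by
      intro c hc1 hc2
      refine T.link (some v) (fun o => ∃ s, o.getD c = s ∧ P s) ?_ (some u) (some u') hu hu' ⟨u, rfl, hp⟩ |>.elim ?_
      · intro s t hst hs
        cases s with
        | none =>
          cases t with
          | none => exact hs
          | some t => simpa using hc2 _ hst (by simpa using hs)
        | some s =>
          cases t with
          | none => simpa using hc1 _ hst (by simpa using hs)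
          | some t => simpa using hP s t (Or.inl hst) (by simpa using hs)
      · rintro s ⟨h, h'⟩
        rw [← h] at h'; simpa using h'
    have aux : ∀ {x y z : V}, F none (some x) (some y) → F none (some z) (some x) → (P y → P z) → v = x → P u' := by
      rintro x y z f1 f3 hyz rfl
      refine gen y ?_ ?_
      · intro s hs h
        have := T.uniq (T.rot (T.rot hs)) f1
        -- F none (some v) (some s)
        exact (Option.some.inj this) ▸ h
      · intro s hs h
        have := T.uniq' (T.rot (T.rot (T.rot hs))) (T.rot (T.rot (T.rot hs)))
        have e : some s = some z := T.uniq hs (T.rot (T.rot f3))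
        rw [Option.some.inj e]; exact hyz h
    by_cases e1 : v = x
    · exact aux f1 f3 (by subst e1; exact hP y z (Or.inr (by unfold Rot; tauto))) e1
    by_cases e2 : v = y
    · exact aux f2 f1 (by subst e2; exact hP z x (Or.inr (by unfold Rot; tauto))) e2
    by_cases e3 : v = z
    · exact aux f3 f2 (by subst e3; exact hP x y (Or.inr (by unfold Rot; tauto))) e3
    refine gen v ?_ ?_
    · intro s hs _
      rcases nb _ (T.adj3 hs) with e | e | e <;> simp_all
    · intro s hs _
      rcases nb _ (T.adj hs).symm with e | e | e <;> simp_all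
  · intro P hP u v hu
    have := T.conn (fun o => P (o.getD x)) ?_ (some u) (some v) hu
    · exact this
    · have a1 := T.adj2 f1
      have a3 := T.adj2 f3
      intro s t hst hs
      cases s with
      | none =>
        rcases nb _ hst with rfl | rfl | rfl
        · exact hs
        · exact hP x y a1 hs
        · exact hP x z a3.symm hs
      | some s =>
        cases t with
        | none =>
          rcases nb _ hst.symm with e | e | e
          · rw [e] at hs; exact hs
          · rw [e] at hs; exact hP y x a1.symm hs
          · rw [e] at hs; exact hP z x a3 hs
        | some t => exact hP s t hst hs
  · intro γ g1 g2 g3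
    obtain ⟨h, x1, x2⟩ := T.hom (fun s t => s.elim 0 (fun s => t.elim 0 (fun t => γ s t)))
      (by rintro (_ | s) (_ | t) <;> simp; exact g1 _ _)
      (by rintro (_ | s) (_ | t) hst <;> simp; exact g2 _ _ hst)
      (by rintro (_ | s) <;> simp [Fintype.sum_option]; exact g3 _)
    refine ⟨fun s t => h (some s) (some t), ?_, fun u v huv => x2 _ _ huv⟩
    have two : ∀ x y : ZMod 2, x + y = 0 → x = y := by decide
    have c1 := two _ _ (x2 _ _ (T.adj f1))
    have c2 := two _ _ (x2 _ _ (T.adj f2))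
    have c3 := two _ _ (x2 _ _ (T.adj f3))
    have b1 := x1 _ _ _ f1
    have b2 := x1 _ _ _ f2
    have b3 := x1 _ _ _ f3
    have b1' := x1 _ _ _ (T.rot f1)
    have b2' := x1 _ _ _ (T.rot f2)
    have b3' := x1 _ _ _ (T.rot f3)
    rintro u v w (f | f)
    · exact x1 _ _ _ f
    · rcases f with ⟨rfl, rfl, rfl⟩ | ⟨rfl, rfl, rfl⟩ | ⟨rfl, rfl, rfl⟩
      · beta_reduce; rw [b1', ← c2, b2]
      · beta_reduce; rw [b2', ← c3, b3]
      · beta_reduce; rw [b3', ← c1, b1]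

theorem card_lt {V : Type} [Fintype V] {G G' : SimpleGraph V} {x y : V} (h : G.Adj x y) (h' : ¬ G'.Adj x y)
    (hs : ∀ z, G'.Adj x z → G.Adj x z) : (G'.neighborSet x).ncard < (G.neighborSet x).ncard := by
  apply Set.ncard_lt_ncard _ (Set.toFinite _)
  refine ⟨fun z hz => hs z hz, fun hh => h' (hh h)⟩

def flipG {V : Type} (G : SimpleGraph V) (a b N S : V) : SimpleGraph V :=
  G.deleteEdges {s(a, b)} ⊔ SimpleGraph.fromEdgeSet {s(N, S)}

theorem flipG_adj {V : Type} {G : SimpleGraph V} {a b N S : V} (hne : N ≠ S) (u v : V) :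
    (flipG G a b N S).Adj u v ↔ (G.Adj u v ∧ ¬ (u = a ∧ v = b) ∧ ¬ (u = b ∧ v = a)) ∨
      (u = N ∧ v = S) ∨ (u = S ∧ v = N) := by
  simp only [flipG, SimpleGraph.sup_adj, SimpleGraph.deleteEdges_adj, SimpleGraph.fromEdgeSet_adj,
    Set.mem_singleton_iff, Sym2.eq_iff]
  constructor
  · tauto
  · rintro (h | h | h)
    · tauto
    · right; exact ⟨Or.inl h, by rw [h.1, h.2]; exact hne⟩
    · right; exact ⟨Or.inr h, by rw [h.1, h.2]; exact hne.symm⟩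

theorem flip' {V : Type} [Fintype V] {G : SimpleGraph V} {F : V → V → V → Prop}
    (T : IsTri G F) {a b N S : V} (h1 : F a b N) (h2 : F b a S) (hne : N ≠ S)
    (hNS : ¬ G.Adj N S) : IsTri (flipG G a b N S) (flipF F a b N S) :=
  T.flip h1 h2 hne hNS _ (flipG_adj hne)

open Classical in
noncomputable def ec {V : Type} [Fintype V] (G : SimpleGraph V) : ℤ := ∑ u, ∑ v, if G.Adj u v then 1 else 0

open Classical in
theorem ec_pair {V : Type} [Fintype V] {x y : V} (h : x ≠ y) :
    ∑ s : V, ∑ t : V, (if (s = x ∧ t = y) ∨ (s = y ∧ t = x) then (1 : ℤ) else 0) = 2 := by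
  have : ∀ s t : V, (if (s = x ∧ t = y) ∨ (s = y ∧ t = x) then (1 : ℤ) else 0) =
      (if s = x then (if t = y then 1 else 0) else 0) + (if s = y then (if t = x then 1 else 0) else 0) := by
    intro s t
    by_cases a : s = x <;> by_cases b : s = y <;> by_cases c : t = x <;> by_cases d : t = y <;> simp_all
  simp only [this, Finset.sum_add_distrib]
  have e : ∀ x y : V, ∑ s : V, ∑ t : V, (if s = x then (if t = y then (1 : ℤ) else 0) else 0) = 1 := by
    intro x y
    rw [Finset.sum_eq_single x]
    · simp
    · intro b _ hb; simp [hb]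
    · simp
  rw [e, e]; norm_num

open Classical in
theorem ec_aux {V : Type} {G : SimpleGraph V} {a b N S : V} (hab : G.Adj a b) (hne : N ≠ S)
    (hNS : ¬ G.Adj N S) (u v : V) : ((if (flipG G a b N S).Adj u v then 1 else 0) +
      if (u = a ∧ v = b) ∨ (u = b ∧ v = a) then (1 : ℤ) else 0) =
      (if G.Adj u v then 1 else 0) + if (u = N ∧ v = S) ∨ (u = S ∧ v = N) then (1 : ℤ) else 0 := by
  have c1 : (u = a ∧ v = b) ∨ (u = b ∧ v = a) → G.Adj u v := by
    rintro (⟨rfl, rfl⟩ | ⟨rfl, rfl⟩)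
    · exact hab
    · exact hab.symm
  have c2 : (u = N ∧ v = S) ∨ (u = S ∧ v = N) → ¬ G.Adj u v := by
    rintro (⟨rfl, rfl⟩ | ⟨rfl, rfl⟩)
    · exact hNS
    · exact fun h => hNS h.symm
  have c3 : (flipG G a b N S).Adj u v ↔ (G.Adj u v ∧ ¬ ((u = a ∧ v = b) ∨ (u = b ∧ v = a))) ∨
      ((u = N ∧ v = S) ∨ (u = S ∧ v = N)) := by rw [flipG_adj hne u v, not_or]
  by_cases x1 : (u = a ∧ v = b) ∨ (u = b ∧ v = a)
  · have y1 := c1 x1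
    have y2 : ¬ ((u = N ∧ v = S) ∨ (u = S ∧ v = N)) := fun h => c2 h y1
    have y3 : ¬ (flipG G a b N S).Adj u v := fun h => (c3.1 h).elim (fun h => h.2 x1) y2
    rw [if_pos x1, if_pos y1, if_neg y2, if_neg y3]; rfl
  · by_cases x2 : (u = N ∧ v = S) ∨ (u = S ∧ v = N)
    · rw [if_neg x1, if_neg (c2 x2), if_pos x2, if_pos (c3.2 (Or.inr x2))]; rfl
    · rw [if_neg x1, if_neg x2]
      by_cases x3 : G.Adj u v
      · rw [if_pos x3, if_pos (c3.2 (Or.inl ⟨x3, x1⟩))]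
      · rw [if_neg x3, if_neg fun h => (c3.1 h).elim (fun h => x3 h.1) x2]

theorem ec_flip {V : Type} [Fintype V] {G : SimpleGraph V} {a b N S : V} (hab : G.Adj a b) (hne : N ≠ S)
    (hNS : ¬ G.Adj N S) : ec (flipG G a b N S) = ec G := by
  classical
  have h1 := ec_pair hab.ne
  have h2 := ec_pair hne
  have : ec (flipG G a b N S) + 2 = ec G + 2 := by
    nth_rw 1 [← h1]
    rw [← h2]
    unfold ec
    simp only [← Finset.sum_add_distrib]
    refine Finset.sum_congr rfl fun u _ => Finset.sum_congr rfl fun v _ => ?_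
    exact ec_aux hab hne hNS u v
  omega

theorem ec_del3 {V : Type} [Fintype V] {G : SimpleGraph (Option V)} {F : Option V → Option V → Option V → Prop}
    (T : IsTri G F) {x y z : V} (f1 : F none (some x) (some y)) (f2 : F none (some y) (some z))
    (f3 : F none (some z) (some x)) : ec G = ec (G.comap some) + 6 := by
  classical
  have nb : ∀ w, G.Adj none w → w = some x ∨ w = some y ∨ w = some z := by
    intro w hw
    refine T.link none (fun w => w = some x ∨ w = some y ∨ w = some z) ?_ (some x) w (T.adj f1) hw (Or.inl rfl)
    rintro s t hst (rfl | rfl | rfl)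
    · right; left; exact T.uniq hst f1
    · right; right; exact T.uniq hst f2
    · left; exact T.uniq hst f3
  have n1 : x ≠ y := fun h => (T.adj2 f1).ne (congrArg some h)
  have n2 : y ≠ z := fun h => (T.adj2 f2).ne (congrArg some h)
  have n3 : z ≠ x := fun h => (T.adj2 f3).ne (congrArg some h)
  have h1 : ∀ v : V, G.Adj none (some v) ↔ v ∈ ({x, y, z} : Finset V) := by
    intro v
    simp only [Finset.mem_insert, Finset.mem_singleton]
    constructor
    · intro h; simpa using nb _ h
    · rintro (rfl | rfl | rfl)
      · exact T.adj f1
      · exact T.adj f2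
      · exact T.adj f3
  have h2 : ∀ v : V, G.Adj (some v) none ↔ v ∈ ({x, y, z} : Finset V) := fun v => by
    rw [← h1, G.adj_comm]
  have h3 : ∑ v : V, (if v ∈ ({x, y, z} : Finset V) then (1 : ℤ) else 0) = 3 := by
    rw [Finset.sum_ite_mem, Finset.univ_inter]
    simp [Finset.card_eq_three.2 ⟨x, y, z, n1, n3.symm, n2, rfl⟩]
  unfold ec
  simp only [Fintype.sum_option, h1, h2, Finset.sum_add_distrib, h3, SimpleGraph.comap_adj]
  simp only [SimpleGraph.irrefl, if_false]
  ring

theorem del {V : Type} [Fintype V] (hV : 3 ≤ Fintype.card V) : ∀ (n : ℕ) {G : SimpleGraph (Option V)}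
    {F : Option V → Option V → Option V → Prop}, IsTri G F → (G.neighborSet none).ncard = n →
    ∃ (G' : SimpleGraph V) (F' : V → V → V → Prop), IsTri G' F' ∧
      (∀ p q, G.Adj (some p) (some q) → G'.Adj p q) ∧ ec G = ec G' + 6 := by
  intro n
  induction n using Nat.strong_induction_on with
  | _ n ih =>
  intro G F T hn
  have hcard : 4 ≤ Fintype.card (Option V) := by rw [Fintype.card_option]; omega
  -- a neighbour
  obtain ⟨v1, hv1⟩ : ∃ v, G.Adj none v := by
    by_contra hno
    push Not at hno
    have : Nonempty V := Fintype.card_pos_iff.1 (by omega)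
    obtain ⟨w⟩ := this
    have := T.conn (fun s => s = none) (by rintro u v h rfl; exact absurd h (hno _)) none (some w) rfl
    simp at this
  obtain ⟨v2, f1⟩ := T.ex hv1
  obtain ⟨v3, f2⟩ := T.ex (T.adj3 f1).symm
  obtain ⟨v4, f3⟩ := T.ex (T.adj3 f2).symm
  have n13 : v3 ≠ v1 := T.opp_ne hcard f2 (T.rot (T.rot f1))
  have n24 : v4 ≠ v2 := T.opp_ne hcard f3 (T.rot (T.rot f2))
  by_cases e : v4 = v1
  · subst e
    cases v4 with
    | none => exact absurd rfl hv1.ne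
    | some x =>
    cases v2 with
    | none => exact absurd rfl (T.adj f2).ne
    | some y =>
    cases v3 with
    | none => exact absurd rfl (T.adj f3).ne
    | some z =>
    exact ⟨_, _, T.del3 f1 f2 f3, fun p q h => h, T.ec_del3 f1 f2 f3⟩
  have step : ∀ {u v w}, F none u v → F none v w → w ≠ u → ¬ G.Adj w u → ∃ (G' : SimpleGraph V) (F' : V → V → V → Prop), IsTri G' F' ∧
      (∀ p q, G.Adj (some p) (some q) → G'.Adj p q) ∧ ec G = ec G' + 6 := by
    intro u v w h1 h2 hwu hna
    have hadj := @flipG_adj _ G none v w u hwu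
    have w0 := (T.adj3 h2).ne
    have u0 := (T.adj h1).ne
    have v0 := (T.adj h2)
    obtain ⟨G', F', T', h', hec⟩ := ih _ (by
      rw [← hn]
      refine card_lt (y := v) v0 (by rw [hadj]; have := (T.adj2 h1).ne; have := (T.adj2 h2).ne; tauto) ?_
      intro z hz; rw [hadj] at hz
      rcases hz with hz | hz | hz
      · exact hz.1
      · exact absurd hz.1.symm w0
      · exact absurd hz.1 u0)
      (T.flip' h2 (T.rot (T.rot h1)) hwu hna) rfl
    refine ⟨G', F', T', fun p q hpq => h' p q ?_, by rw [← hec, ec_flip v0 hwu hna]⟩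
    rw [hadj]; left; exact ⟨hpq, by simp, by simp⟩
  by_cases c1 : G.Adj v3 v1
  swap
  · exact step f1 f2 n13 c1
  by_cases c2 : G.Adj v4 v2
  swap
  · exact step f2 f3 n24 c2
  exfalso
  have m1 := (T.adj f1).ne
  have m2 := (T.adj f2).ne
  have m3 := (T.adj f3).ne
  have m4 := (T.adj3 f3).symm
  have m5 := (T.adj2 f1).ne
  have m6 := (T.adj2 f2).ne
  have m7 := (T.adj2 f3).ne
  have m8 := m4.ne
  refine T.sep f2 (T.rot (T.rot f1)) (fun s => s = v1 ∨ s = v3) (fun s => s = none ∨ s = v4 ∨ s = v2) ?_ 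
    (Relation.ReflTransGen.single ⟨c1, Or.inr rfl, Or.inl rfl⟩) (Or.inr rfl)
    ((Relation.ReflTransGen.single ⟨m4, Or.inl rfl, Or.inr (Or.inl rfl), ?_⟩).tail
      ⟨c2, Or.inr (Or.inl rfl), Or.inr (Or.inr rfl), ?_⟩)
  · rintro s (rfl | rfl) (h | h | h)
    · exact m1 h.symm
    · exact e h.symm
    · exact m5 h
    · exact m3 h.symm
    · exact m7 h
    · exact m6 h.symm
  · intro h; rcases Sym2.eq_iff.1 h with h | h
    · exact m8 h.1.symm
    · exact n24 h.1
  · intro h; rcases Sym2.eq_iff.1 h with h | h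
    · exact n24 h.2
    · exact m2 h.1

theorem contract {V : Type} [Fintype V] (hV : 4 ≤ Fintype.card V) {a b S : V} : ∀ (n : ℕ) {N : V} {G : SimpleGraph V}
    {F : V → V → V → Prop}, IsTri G F → F a b N → F b a S → (∀ w, G.Adj a w → G.Adj b w → w = N ∨ w = S) →
    (G.neighborSet a).ncard = n →
    ∃ (G' : SimpleGraph V) (F' : V → V → V → Prop), IsTri G' F' ∧
      (∀ p q, p ≠ a → q ≠ a → G.Adj p q → G'.Adj p q) ∧ ∀ q, q ≠ b → G.Adj a q → G'.Adj b q := by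
  intro n
  induction n using Nat.strong_induction_on with
  | _ n ih =>
  intro N G F T h1 h2 hc hn
  obtain ⟨v, h3⟩ := T.ex (T.adj3 h1).symm
  have nvb : v ≠ b := T.opp_ne hV h3 (T.rot (T.rot h1))
  have m1 := (T.adj2 h3).ne
  have m2 := (T.adj3 h3)
  have m3 := (T.adj h1)
  by_cases e : v = S
  · subst e
    refine ⟨G, F, T, fun p q _ _ h => h, fun q hq haq => ?_⟩
    have := T.link a (fun w => w = b ∨ w = N ∨ w = v) (by
      rintro s t hst (rfl | rfl | rfl)
      · right; left; exact T.uniq hst h1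
      · right; right; exact T.uniq hst h3
      · left; exact T.uniq hst (T.rot h2)) b q m3 haq (Or.inl rfl)
    rcases this with h | rfl | rfl
    · exact absurd h hq
    · exact T.adj2 h1
    · exact (T.adj3 h2).symm
  have hna : ¬ G.Adj v b := fun h => by
    rcases hc v m2.symm h.symm with h | h
    · exact m1 h.symm
    · exact e h
  have hadj := @flipG_adj _ G a N v b nvb
  have mab := m3.ne
  have mav := m2.ne
  have maN := (T.adj3 h1).ne
  have mbN := (T.adj2 h1).ne
  obtain ⟨G', F', T', k1, k2⟩ := ih _ (by
      rw [← hn]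
      refine card_lt (y := N) (T.adj3 h1).symm (by rw [hadj]; tauto) ?_
      intro z hz; rw [hadj] at hz
      rcases hz with hz | hz | hz
      · exact hz.1
      · exact absurd hz.1.symm mav
      · exact absurd hz.1 mab)
    (T.flip' h3 (T.rot (T.rot h1)) nvb hna) (N := v) (Or.inr (Or.inl (by unfold Rot; tauto)))
    (Or.inl ⟨h2, by
      rintro (h | h | h)
      · exact mab h.1.symm
      · exact mbN h.1
      · exact nvb h.1.symm, by
      rintro (h | h | h)
      · exact mbN h.1
      · exact mab h.1.symm
      · exact maN h.2.1.symm⟩) (by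
        intro w haw hbw
        rw [hadj] at haw hbw
        rcases haw with haw | haw | haw
        · rcases hbw with hbw | hbw | hbw
          · rcases hc w haw.1 hbw.1 with h | h
            · exact absurd ⟨rfl, h⟩ haw.2.1
            · exact Or.inr h
          · exact absurd hbw.1.symm nvb
          · exact Or.inl hbw.2
        · exact absurd haw.1.symm mav
        · exact absurd haw.1 mab) rfl
  · refine ⟨G', F', T', fun p q hp hq hpq => k1 p q hp hq ?_, fun q hq haq => ?_⟩
    · rw [hadj]; left; exact ⟨hpq, fun h => hp h.1, fun h => hq h.2⟩
    · by_cases eN : q = N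
      · subst eN
        exact k1 b q mab.symm maN (by rw [hadj]; left; exact ⟨T.adj2 h1, fun h => mab h.1.symm, fun h => mbN h.1⟩)
      · exact k2 q hq (by rw [hadj]; left; exact ⟨haq, fun h => eN h.2, fun h => maN h.1.symm⟩)

theorem map {V W : Type} [Fintype V] [Fintype W] (e : W ≃ V) {G : SimpleGraph V} {F : V → V → V → Prop}
    (T : IsTri G F) : IsTri (G.comap e) (fun p q r => F (e p) (e q) (e r)) := by
  refine ⟨fun h => T.rot h, fun h => T.adj h, ?_, fun h h' => e.injective (T.uniq h h'), ?_, ?_, ?_⟩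
  · intro u v h
    obtain ⟨w, hw⟩ := T.ex (show G.Adj (e u) (e v) from h)
    exact ⟨e.symm w, by simpa using hw⟩
  · intro v P hP u u' hu hu' h
    have := T.link (e v) (fun s => P (e.symm s)) (fun s t hst hs => hP _ _ (by simpa using hst) hs) (e u) (e u') hu hu' (by simpa using h)
    simpa using this
  · intro P hP u v h
    have := T.conn (fun s => P (e.symm s)) (fun s t hst hs => hP _ _ (by simpa using hst) hs) (e u) (e v) (by simpa using h)
    simpa using this
  · intro γ g1 g2 g3
    obtain ⟨h, x1, x2⟩ := T.hom (fun s t => γ (e.symm s) (e.symm t)) (fun s t => g1 _ _)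
      (fun s t hst => g2 _ _ (by simpa using hst)) (fun s => by
        rw [← g3 (e.symm s)]; exact Equiv.sum_comp e.symm (fun t => γ (e.symm s) t))
    exact ⟨fun s t => h (e s) (e t), fun u v w huv => x1 _ _ _ huv, fun u v huv => by simpa using x2 _ _ huv⟩

theorem ec_map {V W : Type} [Fintype V] [Fintype W] (e : W ≃ V) (G : SimpleGraph V) : ec (G.comap e) = ec G := by
  classical
  unfold ec
  rw [← Equiv.sum_comp e]
  refine Finset.sum_congr rfl fun u _ => ?_
  rw [← Equiv.sum_comp e]
  simp only [SimpleGraph.comap_adj]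

theorem ec_eq : ∀ (n : ℕ) {V : Type} [Fintype V] {G : SimpleGraph V} {F : V → V → V → Prop}, IsTri G F →
    Fintype.card V = n + 3 → ec G = 6 * n + 6 := by
  intro n
  induction n with
  | zero =>
    intro V _ G F T hc
    classical
    have : 1 < Fintype.card V := by omega
    obtain ⟨u, v, huv⟩ := Fintype.exists_pair_of_one_lt_card this
    obtain ⟨w, hw⟩ : ∃ w, G.Adj u w := by
      by_contra hno
      push Not at hno
      have := T.conn (fun s => s = u) (by rintro a b h rfl; exact absurd h (hno _)) u v rfl
      exact huv this.symm
    obtain ⟨z, hz⟩ := T.ex hw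
    have a1 := T.adj hz
    have a2 := T.adj2 hz
    have a3 := T.adj3 hz
    have hu : ({u, w, z} : Finset V) = Finset.univ := by
      apply Finset.eq_univ_of_card
      rw [hc, Finset.card_eq_three.2 ⟨u, w, z, a1.ne, a3.ne.symm, a2.ne, rfl⟩]
    unfold ec
    rw [← hu]
    simp only [Finset.sum_insert (show u ∉ ({w, z} : Finset V) by simp [a1.ne, a3.ne.symm]),
      Finset.sum_insert (show w ∉ ({z} : Finset V) by simp [a2.ne]), Finset.sum_singleton]
    simp [a1, a2, a3, a1.symm, a2.symm, a3.symm]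
  | succ n ih =>
    intro V _ G F T hc
    have e : Option (Fin (n + 3)) ≃ V := Fintype.equivOfCardEq (by simp; omega)
    obtain ⟨G', F', T', _, h⟩ := del (by simp) _ (T.map e) rfl
    rw [ec_map, ih T' (by simp)] at h
    rw [h]; push_cast; ring

theorem eq_of_le {V : Type} [Fintype V] (hV : 3 ≤ Fintype.card V) {G G' : SimpleGraph V} {F F' : V → V → V → Prop}
    (T : IsTri G F) (T' : IsTri G' F') (h : G ≤ G') : G = G' := by
  classical
  obtain ⟨n, hn⟩ := Nat.exists_eq_add_of_le' hV
  have h1 := ec_eq n T hn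
  have h2 := ec_eq n T' hn
  have hm : ∀ u v, (if G.Adj u v then (1 : ℤ) else 0) ≤ if G'.Adj u v then 1 else 0 := by
    intro u v
    by_cases a : G.Adj u v
    · simp [a, h a]
    · simp only [a, if_false]; split_ifs <;> norm_num
  refine le_antisymm h fun u v huv => ?_
  by_contra hno
  have : ec G < ec G' := by
    unfold ec
    refine Finset.sum_lt_sum (fun i _ => Finset.sum_le_sum fun j _ => hm i j) ⟨u, Finset.mem_univ _, ?_⟩
    exact Finset.sum_lt_sum (fun j _ => hm u j) ⟨v, Finset.mem_univ _, by simp [huv, hno]⟩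
  omega

end IsTri


open SimpleGraph

def Dt (p q r : ℝ × ℝ) : ℝ := (q.1 - p.1) * (r.2 - p.2) - (q.2 - p.2) * (r.1 - p.1)

theorem Dt_rot (p q r : ℝ × ℝ) : Dt q r p = Dt p q r := by unfold Dt; ring
theorem Dt_swap (p q r : ℝ × ℝ) : Dt q p r = - Dt p q r := by unfold Dt; ring

open Classical in
noncomputable def Jn (a b C : ℝ) : ℤ := if a < 0 ∧ 0 < b ∧ 0 < C then 1 else if b < 0 ∧ 0 < a ∧ C < 0 then -1 else 0

theorem Jn_swap (a b C : ℝ) : Jn b a (-C) = - Jn a b C := by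
  unfold Jn
  by_cases h1 : a < 0 ∧ 0 < b ∧ 0 < C
  · rw [if_pos h1, if_neg (by intro h; linarith [h.1, h1.2.1]), if_pos ⟨h1.1, h1.2.1, by linarith [h1.2.2]⟩]
  · rw [if_neg h1]
    by_cases h2 : b < 0 ∧ 0 < a ∧ C < 0
    · rw [if_pos h2, if_pos ⟨h2.1, h2.2.1, by linarith [h2.2.2]⟩]; rfl
    · rw [if_neg h2, if_neg (fun h => h2 ⟨h.1, h.2.1, by linarith [h.2.2]⟩), if_neg (fun h => h1 ⟨h.1, h.2.1, by linarith [h.2.2]⟩)]; rfl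

open Classical in
theorem Jn_sum (a b c A B C : ℝ) (ha : a ≠ 0) (hb : b ≠ 0) (hc : c ≠ 0) (hA : A ≠ 0) (hB : B ≠ 0) (hC : C ≠ 0)
    (h : A * a + B * b + C * c = 0) (hp : 0 < A + B + C) :
    Jn a b C + Jn b c A + Jn c a B = if 0 < A ∧ 0 < B ∧ 0 < C then 1 else 0 := by
  unfold Jn
  rcases lt_or_gt_of_ne ha with ha | ha <;> rcases lt_or_gt_of_ne hb with hb | hb <;>
  rcases lt_or_gt_of_ne hc with hc | hc <;> rcases lt_or_gt_of_ne hA with hA | hA <;>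
  rcases lt_or_gt_of_ne hB with hB | hB <;> rcases lt_or_gt_of_ne hC with hC | hC <;>
  simp only [ha, hb, hc, hA, hB, hC, not_lt_of_gt ha, not_lt_of_gt hb, not_lt_of_gt hc, not_lt_of_gt hA,
    not_lt_of_gt hB, not_lt_of_gt hC, and_true, and_false, true_and, false_and, if_true, if_false] <;>
  first
  | rfl
  | (exfalso; linarith)
  | (exfalso; nlinarith [mul_pos_of_neg_of_neg ‹a < 0› ‹A < 0›, mul_pos_of_neg_of_neg ‹b < 0› ‹B < 0›, mul_pos_of_neg_of_neg ‹c < 0› ‹C < 0›])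
  | (exfalso; nlinarith)

open Filter Topology

theorem ev_lin {α β : ℝ} (h : 0 < α) : ∀ᶠ e in 𝓝[>] (0:ℝ), 0 < α + e * β := by
  have : Tendsto (fun e : ℝ => α + e * β) (𝓝[>] 0) (𝓝 α) := by
    have : ContinuousAt (fun e : ℝ => α + e * β) 0 := by fun_prop
    have := this.tendsto
    simp only [zero_mul, add_zero] at this
    exact this.mono_left nhdsWithin_le_nhds
  exact this.eventually (lt_mem_nhds h)

theorem ev_quad_pos {α β γ : ℝ} (h : 0 < α) : ∀ᶠ e in 𝓝[>] (0:ℝ), 0 < α + e * β + e ^ 2 * γ := by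
  have : Tendsto (fun e : ℝ => α + e * β + e ^ 2 * γ) (𝓝[>] 0) (𝓝 α) := by
    have : ContinuousAt (fun e : ℝ => α + e * β + e ^ 2 * γ) 0 := by fun_prop
    have := this.tendsto
    simp only [zero_mul, add_zero, ne_eq, OfNat.ofNat_ne_zero, not_false_eq_true, zero_pow] at this
    exact this.mono_left nhdsWithin_le_nhds
  exact this.eventually (lt_mem_nhds h)

theorem ev_quad {α β γ : ℝ} (h : α ≠ 0 ∨ β ≠ 0 ∨ γ ≠ 0) :
    ∀ᶠ e in 𝓝[>] (0:ℝ), α + e * β + e ^ 2 * γ ≠ 0 := by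
  by_cases h1 : α = 0
  · subst h1
    have key : ∀ᶠ e in 𝓝[>] (0:ℝ), β + e * γ ≠ 0 := by
      by_cases h2 : β = 0
      · subst h2
        have h3 : γ ≠ 0 := by simpa using h
        filter_upwards [self_mem_nhdsWithin] with e he
        have : (0:ℝ) < e := he
        simp [this.ne', h3]
      · rcases lt_or_gt_of_ne h2 with h2 | h2
        · filter_upwards [ev_lin (α := -β) (β := -γ) (by linarith)] with e he
          intro h; linarith
        · filter_upwards [ev_lin (α := β) (β := γ) h2] with e he
          exact he.ne'
    filter_upwards [key, self_mem_nhdsWithin] with e he he'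
    have : (0:ℝ) < e := he'
    rw [show 0 + e * β + e ^ 2 * γ = e * (β + e * γ) by ring]
    exact mul_ne_zero this.ne' he
  · rcases lt_or_gt_of_ne h1 with h2 | h2
    · filter_upwards [ev_quad_pos (α := -α) (β := -β) (γ := -γ) (by linarith)] with e he
      intro h; linarith
    · filter_upwards [ev_quad_pos (α := α) (β := β) (γ := γ) h2] with e he
      exact he.ne'

def pert (q : ℝ × ℝ) (e : ℝ) : ℝ × ℝ := (q.1 + e, q.2 + e ^ 2)

theorem Dt_pert (u v q : ℝ × ℝ) (e : ℝ) : Dt u v (pert q e) =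
    Dt u v q + e * (-(v.2 - u.2)) + e ^ 2 * (v.1 - u.1) := by
  unfold Dt pert; ring

def Ins (u v w q : ℝ × ℝ) : Prop := 0 < Dt v w q ∧ 0 < Dt w u q ∧ 0 < Dt u v q

theorem Ins.rot {u v w q : ℝ × ℝ} (h : Ins u v w q) : Ins v w u q := ⟨h.2.1, h.2.2, h.1⟩

theorem ev_ins {u v w q : ℝ × ℝ} (h : Ins u v w q) : ∀ᶠ e in 𝓝[>] (0:ℝ), Ins u v w (pert q e) := by
  obtain ⟨a, b, c⟩ := h
  filter_upwards [ev_quad_pos (β := (-(w.2 - v.2))) (γ := w.1 - v.1) a, ev_quad_pos (β := (-(u.2 - w.2))) (γ := u.1 - w.1) b,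
    ev_quad_pos (β := (-(v.2 - u.2))) (γ := v.1 - u.1) c] with e h1 h2 h3
  exact ⟨by rw [Dt_pert]; exact h1, by rw [Dt_pert]; exact h2, by rw [Dt_pert]; exact h3⟩

structure Dr {V : Type} (F : V → V → V → Prop) (x y z : V) (pos : V → ℝ × ℝ) : Prop where
  inj : Function.Injective pos
  outer : 0 < Dt (pos x) (pos z) (pos y)
  inner : ∀ u v w, F u v w → ¬ Rot x y z u v w → 0 < Dt (pos u) (pos v) (pos w)

theorem Rot.rot {V : Type} {x y z u v w : V} (h : Rot x y z u v w) : Rot x y z v w u := by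
  unfold Rot at *; tauto
theorem Rot.rot' {V : Type} {x y z u v w : V} (h : Rot x y z v w u) : Rot x y z u v w := h.rot.rot

namespace IsTri
variable {V : Type} [Fintype V] {G : SimpleGraph V} {F : V → V → V → Prop}

open Classical in
theorem count (T : IsTri G F) {x y z : V} {pos : V → ℝ × ℝ} (h0 : F x y z) (hd : Dr F x y z pos) (q : ℝ × ℝ)
    (hq1 : ∀ v, (pos v).1 - q.1 ≠ 0) (hq2 : ∀ u v, u ≠ v → Dt (pos u) (pos v) q ≠ 0) :
    (∑ u, ∑ v, ∑ w, if F u v w ∧ ¬ Rot x y z u v w ∧ Ins (pos u) (pos v) (pos w) q then (1 : ℤ) else 0)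
     = 3 * if Ins (pos x) (pos z) (pos y) q then 1 else 0 := by
  set J : V → V → ℤ := fun u v => Jn ((pos u).1 - q.1) ((pos v).1 - q.1) (Dt (pos u) (pos v) q) with hJ
  have Jsw : ∀ u v, J v u = - J u v := by
    intro u v; simp only [hJ]; rw [Dt_swap, Jn_swap]
  have tri : ∀ u v w, u ≠ v → v ≠ w → w ≠ u → 0 < Dt (pos u) (pos v) (pos w) →
      J u v + J v w + J w u = if Ins (pos u) (pos v) (pos w) q then 1 else 0 := by
    intro u v w h1 h2 h3 hp
    simp only [hJ]
    rw [Jn_sum _ _ _ _ _ _ (hq1 u) (hq1 v) (hq1 w) (hq2 v w h2) (hq2 w u h3) (hq2 u v h1)]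
    · unfold Ins; congr
    · unfold Dt; ring
    · have : Dt (pos v) (pos w) q + Dt (pos w) (pos u) q + Dt (pos u) (pos v) q = Dt (pos u) (pos v) (pos w) := by
        unfold Dt; ring
      rw [this]; exact hp
  have pt : ∀ u v w, (if F u v w ∧ ¬ Rot x y z u v w ∧ Ins (pos u) (pos v) (pos w) q then (1 : ℤ) else 0) =
      (if F u v w then (J u v + J v w + J w u) else 0) +
      (if Rot x y z u v w then (if Ins (pos x) (pos z) (pos y) q then 1 else 0) else 0) := by
    intro u v w
    by_cases hR : Rot x y z u v w
    · have hF : F u v w := by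
        rcases hR with ⟨rfl, rfl, rfl⟩ | ⟨rfl, rfl, rfl⟩ | ⟨rfl, rfl, rfl⟩
        · exact h0
        · exact T.rot h0
        · exact T.rot (T.rot h0)
      have e := tri x z y (T.adj3 h0).ne.symm (T.adj2 h0).ne.symm (T.adj h0).ne.symm hd.outer
      rw [if_neg (by tauto), if_pos hF, if_pos hR, ← e]
      have e1 := Jsw x z
      have e2 := Jsw z y
      have e3 := Jsw y x
      rcases hR with ⟨rfl, rfl, rfl⟩ | ⟨rfl, rfl, rfl⟩ | ⟨rfl, rfl, rfl⟩ <;> linarith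
    · by_cases hF : F u v w
      · rw [if_pos hF, if_neg hR, tri u v w (T.adj hF).ne (T.adj2 hF).ne (T.adj3 hF).ne (hd.inner _ _ _ hF hR)]
        simp [hF, hR]
      · simp [hF, hR]
  simp only [pt, Finset.sum_add_distrib]
  have s1 : ∑ u, ∑ v, ∑ w, (if F u v w then J u v else 0) = 0 := by
    have e1 : ∀ u v, ∑ w, (if F u v w then J u v else 0) = if G.Adj u v then J u v else 0 := by
      intro u v
      by_cases h : G.Adj u v
      · obtain ⟨w, hw⟩ := T.ex h
        rw [if_pos h, Finset.sum_eq_single w]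
        · simp [hw]
        · intro b _ hb; rw [if_neg]; exact fun h' => hb (T.uniq h' hw)
        · simp
      · rw [if_neg h]; refine Finset.sum_eq_zero fun w _ => if_neg fun h' => h (T.adj h')
    simp only [e1]
    have e2 : ∑ u, ∑ v, (if G.Adj u v then J u v else 0) = - ∑ u, ∑ v, (if G.Adj u v then J u v else 0) := by
      rw [← Finset.sum_neg_distrib]
      simp only [← Finset.sum_neg_distrib]
      nth_rw 1 [Finset.sum_comm]
      refine Finset.sum_congr rfl fun u _ => Finset.sum_congr rfl fun v _ => ?_
      by_cases h : G.Adj u v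
      · rw [if_pos h, if_pos h.symm, Jsw]
      · rw [if_neg h, if_neg (fun h' => h h'.symm)]; rfl
    linarith
  have s2 : ∑ u, ∑ v, ∑ w, (if F u v w then J v w else 0) = 0 := by
    rw [Finset.sum_comm]; refine Eq.trans ?_ s1
    refine Finset.sum_congr rfl fun v _ => ?_
    rw [Finset.sum_comm]
    refine Finset.sum_congr rfl fun w _ => Finset.sum_congr rfl fun u _ => ?_
    have : F u v w ↔ F v w u := ⟨T.rot, fun h => T.rot (T.rot h)⟩
    exact if_congr this rfl rfl
  have s3 : ∑ u, ∑ v, ∑ w, (if F u v w then J w u else 0) = 0 := by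
    rw [show (∑ u, ∑ v, ∑ w, if F u v w then J w u else 0) = ∑ u, ∑ w, ∑ v, if F u v w then J w u else 0 from
      Finset.sum_congr rfl fun u _ => Finset.sum_comm]
    rw [Finset.sum_comm]; refine Eq.trans ?_ s1
    refine Finset.sum_congr rfl fun w _ => Finset.sum_congr rfl fun u _ => Finset.sum_congr rfl fun v _ => ?_
    have : F u v w ↔ F w u v := ⟨fun h => T.rot (T.rot h), T.rot⟩
    exact if_congr this rfl rfl
  have s4 : (∑ u, ∑ v, ∑ w, if F u v w then (J u v + J v w + J w u) else 0) = 0 := by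
    have : ∀ u v w, (if F u v w then (J u v + J v w + J w u) else 0) = (if F u v w then J u v else 0) +
      (if F u v w then J v w else 0) + (if F u v w then J w u else 0) := by
      intro u v w; split_ifs <;> simp
    simp only [this, Finset.sum_add_distrib, s1, s2, s3, add_zero]
  rw [s4, zero_add]
  generalize (if Ins (pos x) (pos z) (pos y) q then (1 : ℤ) else 0) = k
  have n1 := (T.adj h0).ne
  have n2 := (T.adj2 h0).ne
  have n3 := (T.adj3 h0).ne
  have : ∀ u v w, (if Rot x y z u v w then k else 0) = (if u = x then if v = y then if w = z then k else 0 else 0 else 0)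
      + (if u = y then if v = z then if w = x then k else 0 else 0 else 0)
      + (if u = z then if v = x then if w = y then k else 0 else 0 else 0) := by
    intro u v w
    by_cases a : u = x
    · subst a; simp [Rot, n1, n3.symm, ite_and]
    by_cases b : u = y
    · subst b; simp [Rot, a, n2, ite_and]
    by_cases c : u = z
    · subst c; simp [Rot, a, b, ite_and]
    · simp [Rot, a, b, c]
  simp only [this, Finset.sum_add_distrib]
  simp; ring

end IsTri


open SimpleGraph
open Filter Topology

theorem Dt_seg (x y u v : ℝ × ℝ) {a b : ℝ} (h : a + b = 1) :
    Dt x y (a • u + b • v) = a * Dt x y u + b * Dt x y v := by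
  have : b = 1 - a := by linarith
  subst this
  simp [Dt]; ring

theorem Dt_self (x y : ℝ × ℝ) : Dt x y x = 0 := by unfold Dt; ring
theorem Dt_self' (x y : ℝ × ℝ) : Dt x y y = 0 := by unfold Dt; ring

namespace IsTri
variable {V : Type} [Fintype V] {G : SimpleGraph V} {F : V → V → V → Prop}

theorem generic {pos : V → ℝ × ℝ} (hinj : Function.Injective pos) (q : ℝ × ℝ) :
    ∀ᶠ e in 𝓝[>] (0:ℝ), (∀ v, (pos v).1 - (pert q e).1 ≠ 0) ∧
      ∀ u v, u ≠ v → Dt (pos u) (pos v) (pert q e) ≠ 0 := by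
  refine Eventually.and (eventually_all.2 fun v => ?_) (eventually_all.2 fun u => eventually_all.2 fun v => ?_)
  · filter_upwards [ev_quad (α := (pos v).1 - q.1) (β := -1) (γ := 0) (by simp)] with e he
    intro h; apply he; unfold pert at h; simp only at h; linarith
  · by_cases h : u = v
    · exact Eventually.of_forall fun e he => absurd h he
    · have : (pos v).1 - (pos u).1 ≠ 0 ∨ (pos v).2 - (pos u).2 ≠ 0 := by
        by_contra hc
        push Not at hc
        exact h (hinj (Prod.ext (by linarith [hc.1]) (by linarith [hc.2])))
      filter_upwards [ev_quad (α := Dt (pos u) (pos v) q) (β := -((pos v).2 - (pos u).2)) (γ := (pos v).1 - (pos u).1)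
        (by rcases this with h | h
            · exact Or.inr (Or.inr h)
            · exact Or.inr (Or.inl (neg_ne_zero.2 h)))] with e he _
      rw [Dt_pert]; exact he

theorem rot_of (T : IsTri G F) {x y z u v w : V} (h0 : F x y z) (h : Rot x y z u v w) : F u v w := by
  rcases h with ⟨rfl, rfl, rfl⟩ | ⟨rfl, rfl, rfl⟩ | ⟨rfl, rfl, rfl⟩
  · exact h0
  · exact T.rot h0
  · exact T.rot (T.rot h0)

open Classical in
theorem two_gen (T : IsTri G F) {x y z : V} {pos : V → ℝ × ℝ} (h0 : F x y z) (hd : Dr F x y z pos) (q : ℝ × ℝ)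
    (hq1 : ∀ v, (pos v).1 - q.1 ≠ 0) (hq2 : ∀ u v, u ≠ v → Dt (pos u) (pos v) q ≠ 0)
    {u v w} (h : F u v w) (hR : ¬ Rot x y z u v w) (hI : Ins (pos u) (pos v) (pos w) q) :
    Ins (pos x) (pos z) (pos y) q ∧ ∀ r s t, F r s t → ¬ Rot x y z r s t → Ins (pos r) (pos s) (pos t) q →
      Rot u v w r s t := by
  have hc := T.count h0 hd q hq1 hq2
  set K : Finset (V × V × V) := Finset.univ.filter fun t => F t.1 t.2.1 t.2.2 ∧ ¬ Rot x y z t.1 t.2.1 t.2.2 ∧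
    Ins (pos t.1) (pos t.2.1) (pos t.2.2) q with hK
  have hcK : (K.card : ℤ) = 3 * if Ins (pos x) (pos z) (pos y) q then 1 else 0 := by
    rw [← hc, hK, Finset.card_filter]
    push_cast
    rw [Fintype.sum_prod_type]
    refine Finset.sum_congr rfl fun a _ => ?_
    rw [Fintype.sum_prod_type]
  have memK : ∀ a b c, (a, b, c) ∈ K ↔ F a b c ∧ ¬ Rot x y z a b c ∧ Ins (pos a) (pos b) (pos c) q := by
    intro a b c; simp [hK]
  have rotK : ∀ a b c, (a, b, c) ∈ K → (b, c, a) ∈ K := by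
    intro a b c habc
    rw [memK] at *
    exact ⟨T.rot habc.1, fun h => habc.2.1 h.rot', habc.2.2.rot⟩
  have m1 : (u, v, w) ∈ K := (memK _ _ _).2 ⟨h, hR, hI⟩
  constructor
  · by_contra hn
    rw [if_neg hn] at hcK
    have : K.card = 0 := by exact_mod_cast hcK
    rw [Finset.card_eq_zero] at this
    rw [this] at m1; simp at m1
  · intro r s t h' hR' hI'
    by_contra hn
    have m2 : (r, s, t) ∈ K := (memK _ _ _).2 ⟨h', hR', hI'⟩
    have sub : ({(u, v, w), (v, w, u), (w, u, v), (r, s, t)} : Finset (V × V × V)) ⊆ K := by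
      intro a ha
      simp only [Finset.mem_insert, Finset.mem_singleton] at ha
      rcases ha with rfl | rfl | rfl | rfl
      · exact m1
      · exact rotK _ _ _ m1
      · exact rotK _ _ _ (rotK _ _ _ m1)
      · exact m2
    have n1 := (T.adj h).ne
    have n2 := (T.adj2 h).ne
    have n3 := (T.adj3 h).ne
    have c4 : ({(u, v, w), (v, w, u), (w, u, v), (r, s, t)} : Finset (V × V × V)).card = 4 := by
      rw [Finset.card_insert_of_notMem, Finset.card_insert_of_notMem, Finset.card_insert_of_notMem, Finset.card_singleton]
      · simp only [Finset.mem_singleton, Prod.mk.injEq]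
        rintro ⟨rfl, rfl, rfl⟩; exact hn (Or.inr (Or.inr ⟨rfl, rfl, rfl⟩))
      · simp only [Finset.mem_insert, Finset.mem_singleton, Prod.mk.injEq]
        rintro (⟨rfl, _, _⟩ | ⟨rfl, rfl, rfl⟩)
        · exact n2 rfl
        · exact hn (Or.inr (Or.inl ⟨rfl, rfl, rfl⟩))
      · simp only [Finset.mem_insert, Finset.mem_singleton, Prod.mk.injEq]
        rintro (⟨rfl, _, _⟩ | ⟨rfl, _, _⟩ | ⟨rfl, rfl, rfl⟩)
        · exact n1 rfl
        · exact n3 rfl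
        · exact hn (Or.inl ⟨rfl, rfl, rfl⟩)
    have := Finset.card_le_card sub
    rw [c4] at this
    have h3 : (K.card : ℤ) ≤ 3 := by rw [hcK]; split_ifs <;> simp
    omega

theorem meet (T : IsTri G F) {x y z : V} {pos : V → ℝ × ℝ} (h0 : F x y z) (hd : Dr F x y z pos) (q : ℝ × ℝ)
    {u v w} (h : F u v w) (hR : ¬ Rot x y z u v w) (hI : Ins (pos u) (pos v) (pos w) q)
    {r s t} (h' : F r s t) (hR' : ¬ Rot x y z r s t) (hI' : Ins (pos r) (pos s) (pos t) q) : Rot u v w r s t := by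
  obtain ⟨e, ⟨h1, h2⟩, h3, h4⟩ := ((generic hd.inj q).and ((ev_ins hI).and (ev_ins hI'))).exists
  exact (T.two_gen h0 hd _ h1 h2 h hR h3).2 _ _ _ h' hR' h4

theorem lim_nonneg {u v q : ℝ × ℝ} (h : ∀ᶠ e in 𝓝[>] (0:ℝ), 0 < Dt u v (pert q e)) : 0 ≤ Dt u v q := by
  by_contra hn
  push Not at hn
  obtain ⟨e, h1, h2⟩ := (h.and (ev_quad_pos (α := -Dt u v q) (β := ((v.2 - u.2))) (γ := -(v.1 - u.1)) (by linarith))).exists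
  rw [Dt_pert] at h1
  linarith

theorem in_outer (T : IsTri G F) {x y z : V} {pos : V → ℝ × ℝ} (h0 : F x y z) (hd : Dr F x y z pos) (q : ℝ × ℝ)
    {u v w} (h : F u v w) (hR : ¬ Rot x y z u v w) (hI : Ins (pos u) (pos v) (pos w) q)
    {r s t} (hr : Rot x y z r s t) : Dt (pos r) (pos s) q ≤ 0 := by
  have key : ∀ᶠ e in 𝓝[>] (0:ℝ), Ins (pos x) (pos z) (pos y) (pert q e) := by
    filter_upwards [generic hd.inj q, ev_ins hI] with e h1 h3
    exact (T.two_gen h0 hd _ h1.1 h1.2 h hR h3).1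
  have k1 := lim_nonneg (key.mono fun e h => h.1)
  have k2 := lim_nonneg (key.mono fun e h => h.2.1)
  have k3 := lim_nonneg (key.mono fun e h => h.2.2)
  rcases hr with ⟨rfl, rfl, rfl⟩ | ⟨rfl, rfl, rfl⟩ | ⟨rfl, rfl, rfl⟩
  · have := Dt_swap (pos r) (pos s) q; linarith
  · have := Dt_swap (pos r) (pos s) q; linarith
  · have := Dt_swap (pos r) (pos s) q; linarith

theorem cen_ins {u v w : ℝ × ℝ} (h : 0 < Dt u v w) : Ins u v w ((u.1+v.1+w.1)/3, (u.2+v.2+w.2)/3) := by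
  unfold Ins Dt at *
  refine ⟨?_, ?_, ?_⟩ <;> (simp only; linarith)

theorem on_edge (T : IsTri G F) {x y z : V} {pos : V → ℝ × ℝ} (h0 : F x y z) (hd : Dr F x y z pos)
    {u v : V} (huv : G.Adj u v) {r s t : V} (h : F r s t) (hR : ¬ Rot x y z r s t) {a b : ℝ} (ha : 0 < a) (hb : 0 < b)
    (hab : a + b = 1)
    (h1 : 0 ≤ Dt (pos s) (pos t) (a • pos u + b • pos v))
    (h2 : 0 ≤ Dt (pos t) (pos r) (a • pos u + b • pos v))
    (h3 : 0 ≤ Dt (pos r) (pos s) (a • pos u + b • pos v)) :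
    ∃ w, Rot u v w r s t ∨ Rot v u w r s t := by
  obtain ⟨e, ⟨-, hc1⟩, hc2⟩ := ((generic hd.inj ((((pos r).1+(pos s).1+(pos t).1)/3,
    ((pos r).2+(pos s).2+(pos t).2)/3))).and (ev_ins (cen_ins (hd.inner _ _ _ h hR)))).exists
  set c := pert ((((pos r).1+(pos s).1+(pos t).1)/3, ((pos r).2+(pos s).2+(pos t).2)/3)) e
  have key : ∀ {u v : V} (huv : G.Adj u v) {a b : ℝ} (ha : 0 < a) (hb : 0 < b) (hab : a + b = 1)
    (h1 : 0 ≤ Dt (pos s) (pos t) (a • pos u + b • pos v))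
    (h2 : 0 ≤ Dt (pos t) (pos r) (a • pos u + b • pos v))
    (h3 : 0 ≤ Dt (pos r) (pos s) (a • pos u + b • pos v)), 0 < Dt (pos u) (pos v) c → ∃ w, Rot u v w r s t := by
    intro u v huv a b ha hb hab h1 h2 h3 hpos
    obtain ⟨w, hw⟩ := T.ex huv
    refine ⟨w, ?_⟩
    have hin : ¬ Rot x y z u v w := fun hr => by
      have := T.in_outer h0 hd c h hR hc2 hr; linarith
    have hD := hd.inner _ _ _ hw hin
    set p := a • pos u + b • pos v with hp
    have k1 : 0 < Dt (pos v) (pos w) p := by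
      rw [hp, Dt_seg _ _ _ _ hab, Dt_self, mul_zero, add_zero, Dt_rot]; exact mul_pos ha hD
    have k2 : 0 < Dt (pos w) (pos u) p := by
      rw [hp, Dt_seg _ _ _ _ hab, Dt_self', mul_zero, zero_add, ← Dt_rot]; exact mul_pos hb hD
    have k3 : Dt (pos u) (pos v) p = 0 := by
      rw [hp, Dt_seg _ _ _ _ hab, Dt_self', Dt_self]; ring
    obtain ⟨ε, e1, e2, e3, e4⟩ := ((ev_lin (β := Dt (pos v) (pos w) c - Dt (pos v) (pos w) p) k1).and
      ((ev_lin (β := Dt (pos w) (pos u) c - Dt (pos w) (pos u) p) k2).and ((ev_lin (β := -1) (zero_lt_one)).and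
      self_mem_nhdsWithin))).exists
    have e5 : (0:ℝ) < ε := e4
    have e6 : (1 - ε) + ε = 1 := by ring
    have e7 : 0 ≤ 1 - ε := by linarith
    have := T.meet h0 hd ((1 - ε) • p + ε • c) hw hin ⟨by rw [Dt_seg _ _ _ _ e6]; linarith,
      by rw [Dt_seg _ _ _ _ e6]; linarith, by rw [Dt_seg _ _ _ _ e6, k3]; simp only [mul_zero, zero_add]; positivity⟩ h hR
      ⟨by rw [Dt_seg _ _ _ _ e6]; have := mul_pos e5 hc2.1; have := mul_nonneg e7 h1; linarith,
       by rw [Dt_seg _ _ _ _ e6]; have := mul_pos e5 hc2.2.1; have := mul_nonneg e7 h2; linarith,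
       by rw [Dt_seg _ _ _ _ e6]; have := mul_pos e5 hc2.2.2; have := mul_nonneg e7 h3; linarith⟩
    exact this
  rcases lt_or_gt_of_ne (hc1 u v huv.ne) with hlt | hgt
  · obtain ⟨w, hw⟩ := key huv.symm hb ha (by linarith) (by rwa [add_comm]) (by rwa [add_comm]) (by rwa [add_comm])
      (by rw [Dt_swap]; linarith)
    exact ⟨w, Or.inr hw⟩
  · obtain ⟨w, hw⟩ := key huv ha hb hab h1 h2 h3 hgt
    exact ⟨w, Or.inl hw⟩

theorem inface (T : IsTri G F) {x y z : V} (h0 : F x y z) {u v : V} (huv : G.Adj u v) :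
    ∃ w, (F u v w ∧ ¬ Rot x y z u v w) ∨ (F v u w ∧ ¬ Rot x y z v u w) := by
  obtain ⟨w, hw⟩ := T.ex huv
  obtain ⟨w', hw'⟩ := T.ex huv.symm
  by_cases h : Rot x y z u v w
  · refine ⟨w', Or.inr ⟨hw', fun h' => ?_⟩⟩
    have n1 := (T.adj h0).ne
    have n2 := (T.adj2 h0).ne
    have n3 := (T.adj3 h0).ne
    rcases h with ⟨rfl, rfl, rfl⟩ | ⟨rfl, rfl, rfl⟩ | ⟨rfl, rfl, rfl⟩ <;>
    rcases h' with ⟨h1, h2, h3⟩ | ⟨h1, h2, h3⟩ | ⟨h1, h2, h3⟩ <;> subst_vars <;> contradiction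
  · exact ⟨w, Or.inl ⟨hw, h⟩⟩

theorem nocross (T : IsTri G F) {x y z : V} {pos : V → ℝ × ℝ} (h0 : F x y z) (hd : Dr F x y z pos)
    {u v r s : V} (huv : G.Adj u v) (hrs : G.Adj r s) (hne : s(u, v) ≠ s(r, s)) {p : ℝ × ℝ}
    (hp : p ∈ segment ℝ (pos u) (pos v)) (hp' : p ∈ segment ℝ (pos r) (pos s)) : p = pos u ∨ p = pos v := by
  obtain ⟨a, b, ha, hb, hab, rfl⟩ := hp
  rcases ha.eq_or_lt with rfl | ha
  · right; have : b = 1 := by linarith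
    subst this; simp
  rcases hb.eq_or_lt with rfl | hb
  · left; have : a = 1 := by linarith
    subst this; simp
  exfalso
  have key : ∀ r s t, G.Adj r s → s(u, v) ≠ s(r, s) → (a • pos u + b • pos v) ∈ segment ℝ (pos r) (pos s) →
      F r s t → ¬ Rot x y z r s t → False := by
    intro r s t hrs hne hp' h hR
    have hD := hd.inner _ _ _ h hR
    obtain ⟨a', b', ha', hb', hab', he⟩ := hp'
    have z0 : Dt (pos r) (pos s) (a • pos u + b • pos v) = 0 := by
      rw [← he, Dt_seg _ _ _ _ hab', Dt_self', Dt_self]; ring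
    obtain ⟨w, hw⟩ := T.on_edge h0 hd huv h hR ha hb hab (by
      rw [← he, Dt_seg _ _ _ _ hab', Dt_self, mul_zero, add_zero, Dt_rot]; exact mul_nonneg ha' hD.le) (by
      rw [← he, Dt_seg _ _ _ _ hab', Dt_self', mul_zero, zero_add, ← Dt_rot]; exact mul_nonneg hb' hD.le) (by
      rw [z0])
    rw [Dt_seg _ _ _ _ hab] at z0
    have p1 := mul_pos ha hD
    have p2 := mul_pos hb hD
    rcases hw with (⟨rfl, rfl, rfl⟩ | ⟨rfl, rfl, rfl⟩ | ⟨rfl, rfl, rfl⟩) | (⟨rfl, rfl, rfl⟩ | ⟨rfl, rfl, rfl⟩ | ⟨rfl, rfl, rfl⟩) <;>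
    first
    | exact hne rfl
    | exact hne Sym2.eq_swap
    | (rw [Dt_self] at z0; linarith)
    | (rw [Dt_self'] at z0; linarith)
  obtain ⟨t, ⟨h, hR⟩ | ⟨h, hR⟩⟩ := T.inface h0 hrs
  · exact key r s t hrs hne hp' h hR
  · exact key s r t hrs.symm (by rwa [Sym2.eq_swap (a := s)]) (by rwa [segment_symm]) h hR

theorem planar_of_dr (T : IsTri G F) {x y z : V} {pos : V → ℝ × ℝ} (h0 : F x y z) (hd : Dr F x y z pos) : IsPlanar G :=
  ⟨pos, hd.inj, fun _ _ _ _ h1 h2 hne _ hp hp' => ⟨T.nocross h0 hd h1 h2 hne hp hp', T.nocross h0 hd h2 h1 hne.symm hp' hp⟩⟩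

theorem novert (T : IsTri G F) {x y z : V} {pos : V → ℝ × ℝ} (h0 : F x y z) (hd : Dr F x y z pos)
    {u v w q : V} (h : F u v w) (hR : ¬ Rot x y z u v w) (hq : ∃ t, G.Adj q t) : ¬ Ins (pos u) (pos v) (pos w) (pos q) := by
  intro hI
  obtain ⟨t, ht⟩ := hq
  have key : ∀ r s t, F r s t → ¬ Rot x y z r s t → (q = r ∨ q = s) → False := by
    intro r s t h' hR' hq
    have hc := cen_ins (hd.inner _ _ _ h' hR')
    set c : ℝ × ℝ := (((pos r).1+(pos s).1+(pos t).1)/3, ((pos r).2+(pos s).2+(pos t).2)/3)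
    have hD := hd.inner _ _ _ h' hR'
    obtain ⟨ε, e1, e2, e3, e4, e5⟩ := ((ev_lin (β := Dt (pos v) (pos w) c - Dt (pos v) (pos w) (pos q)) hI.1).and
      ((ev_lin (β := Dt (pos w) (pos u) c - Dt (pos w) (pos u) (pos q)) hI.2.1).and
      ((ev_lin (β := Dt (pos u) (pos v) c - Dt (pos u) (pos v) (pos q)) hI.2.2).and ((ev_lin (β := -1) (zero_lt_one)).and
      self_mem_nhdsWithin)))).exists
    have e5 : (0:ℝ) < ε := e5
    have e6 : (1 - ε) + ε = 1 := by ring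
    have e7 : 0 ≤ 1 - ε := by linarith
    have hn : 0 ≤ Dt (pos s) (pos t) (pos q) ∧ 0 ≤ Dt (pos t) (pos r) (pos q) ∧ 0 ≤ Dt (pos r) (pos s) (pos q) := by
      rcases hq with rfl | rfl
      · rw [Dt_self, Dt_self', Dt_rot]; exact ⟨hD.le, le_rfl, le_rfl⟩
      · rw [Dt_self, Dt_self', ← Dt_rot]; exact ⟨le_rfl, hD.le, le_rfl⟩
    have := T.meet h0 hd ((1 - ε) • pos q + ε • c) h hR ⟨by rw [Dt_seg _ _ _ _ e6]; linarith,
      by rw [Dt_seg _ _ _ _ e6]; linarith, by rw [Dt_seg _ _ _ _ e6]; linarith⟩ h' hR'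
      ⟨by rw [Dt_seg _ _ _ _ e6]; have := mul_pos e5 hc.1; have := mul_nonneg e7 hn.1; linarith,
       by rw [Dt_seg _ _ _ _ e6]; have := mul_pos e5 hc.2.1; have := mul_nonneg e7 hn.2.1; linarith,
       by rw [Dt_seg _ _ _ _ e6]; have := mul_pos e5 hc.2.2; have := mul_nonneg e7 hn.2.2; linarith⟩
    have hq' : q = u ∨ q = v ∨ q = w := by
      rcases this with ⟨rfl, rfl, rfl⟩ | ⟨rfl, rfl, rfl⟩ | ⟨rfl, rfl, rfl⟩ <;> rcases hq with rfl | rfl <;> simp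
    obtain ⟨i1, i2, i3⟩ := hI
    rcases hq' with rfl | rfl | rfl
    · rw [Dt_self] at i3; exact lt_irrefl _ i3
    · rw [Dt_self] at i1; exact lt_irrefl _ i1
    · rw [Dt_self] at i2; exact lt_irrefl _ i2
  obtain ⟨s, ⟨h, hR⟩ | ⟨h, hR⟩⟩ := T.inface h0 ht
  · exact key _ _ _ h hR (Or.inl rfl)
  · exact key _ _ _ h hR (Or.inr rfl)

end IsTri


open SimpleGraph
open Filter Topology
namespace IsTri

theorem exnb {V : Type} [Fintype V] {G : SimpleGraph V} {F : V → V → V → Prop} (T : IsTri G F)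
    (hc : 2 ≤ Fintype.card V) (u : V) : ∃ w, G.Adj u w := by
  by_contra hno
  push Not at hno
  obtain ⟨v, hv⟩ := Fintype.exists_ne_of_one_lt_card (show 1 < Fintype.card V by omega) u
  exact hv (T.conn (fun s => s = u) (by rintro a b h rfl; exact absurd h (hno _)) u v rfl)

theorem ctr_edge {V : Type} [Fintype V] {G : SimpleGraph V} {F : V → V → V → Prop} (T : IsTri G F)
    (hc : 4 ≤ Fintype.card V) (a : V) : ∃ b N S, F a b N ∧ F b a S ∧ ∀ w, G.Adj a w → G.Adj b w → w = N ∨ w = S := by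
  classical
  have hs : ∀ u, ∃ w, G.Adj a u → F a u w := fun u => by
    by_cases h : G.Adj a u
    · obtain ⟨w, hw⟩ := T.ex h; exact ⟨w, fun _ => hw⟩
    · exact ⟨u, fun h' => absurd h' h⟩
  choose f hf using hs
  obtain ⟨u0, hu0⟩ := T.exnb (by omega) a
  set v : ℕ → V := fun i => f^[i] u0 with hv
  have v1 : ∀ i, v (i+1) = f (v i) := fun i => Function.iterate_succ_apply' f i u0
  have va : ∀ i, G.Adj a (v i) := by
    intro i
    induction i with
    | zero => exact hu0
    | succ i ih => rw [v1]; exact (T.adj3 (hf _ ih)).symm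
  have vF : ∀ i, F a (v i) (v (i+1)) := fun i => by rw [v1]; exact hf _ (va i)
  have vadj : ∀ i, G.Adj (v i) (v (i+1)) := fun i => T.adj2 (vF i)
  have ex : ∃ L, 2 ≤ L ∧ ∃ i, v i = v (i + L) ∨ G.Adj (v i) (v (i + L)) := by
    obtain ⟨i, j, hij, he⟩ := Finite.exists_ne_map_eq_of_infinite v
    have : ∀ i j, i < j → v i = v j → ∃ L, 2 ≤ L ∧ ∃ i, v i = v (i + L) ∨ G.Adj (v i) (v (i + L)) := by
      intro i j hij he
      refine ⟨j - i, ?_, i, Or.inl (by rw [Nat.add_sub_cancel' hij.le]; exact he)⟩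
      by_contra h
      have : j = i + 1 := by omega
      subst this
      exact (vadj i).ne he
    rcases lt_or_gt_of_ne hij with h | h
    · exact this _ _ h he
    · exact this _ _ h he.symm
  obtain ⟨h2, i, hi⟩ := Nat.find_spec ex
  have hmin : ∀ k l, k + 2 ≤ l → l < k + Nat.find ex → v k ≠ v l ∧ ¬ G.Adj (v k) (v l) := by
    intro k l h1 h3
    have := Nat.find_min ex (m := l - k) (by omega)
    rw [← not_or]
    intro h
    exact this ⟨by omega, k, by rw [show k + (l - k) = l by omega]; exact h⟩
  generalize Nat.find ex = L at h2 hi hmin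
  clear ex
  have hS : F (v (i+1)) a (v i) := T.rot (T.rot (vF i))
  refine ⟨v (i+1), v (i+2), v i, vF (i+1), hS, fun w haw hbw => ?_⟩
  by_contra hw
  push Not at hw
  by_cases hl : ∃ l, i ≤ l ∧ l ≤ i + L ∧ w = v l
  · obtain ⟨l, l1, l2, rfl⟩ := hl
    have e1 : l ≠ i := fun h => hw.2 (by rw [h])
    have e2 : l ≠ i + 1 := fun h => hbw.ne (by rw [h])
    have e3 : l ≠ i + 2 := fun h => hw.1 (by rw [h])
    exact (hmin (i+1) l (by omega) (by omega)).2 hbw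
  · set A : V → Prop := fun s => ∃ l, i ≤ l ∧ l ≤ i + L ∧ l ≠ i + 1 ∧ s = v l
    refine T.sep (vF (i+1)) hS A (fun s => s = a ∨ s = w ∨ s = v (i+1)) ?_ ?_ ⟨i+2, by omega, by omega, by omega, rfl⟩ ?_
    · rintro s ⟨l, l1, l2, l3, rfl⟩ (h | h | h)
      · exact (va l).ne h.symm
      · exact hl ⟨l, l1, l2, h.symm⟩
      · by_cases e1 : l = i
        · subst e1; exact (vadj l).ne h
        · by_cases e2 : l = i + 2
          · subst e2; exact (vadj (i+1)).ne h.symm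
          · exact (hmin (i+1) l (by omega) (by omega)).1 h.symm
    · have step : ∀ k, k + 2 ≤ L → Relation.ReflTransGen (fun s t => G.Adj s t ∧ A s ∧ A t) (v (i+2)) (v (i+2+k)) := by
        intro k hk
        induction k with
        | zero => exact .refl
        | succ k ih => 
          exact (ih (by omega)).tail ⟨vadj _, ⟨i+2+k, by omega, by omega, by omega, rfl⟩, ⟨i+2+(k+1), by omega, by omega, by omega, rfl⟩⟩
      have := step (L - 2) (by omega)
      rw [show i + 2 + (L - 2) = i + L by omega] at this
      rcases hi with h | h
      · rw [h]; exact this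
      · exact this.tail ⟨h.symm, ⟨i+L, by omega, by omega, by omega, rfl⟩, ⟨i, by omega, by omega, by omega, rfl⟩⟩
    · have n1 := haw.ne
      have n2 := hbw.ne
      have n3 := (va (i+1)).ne
      refine (Relation.ReflTransGen.single (b := w) ⟨haw, Or.inl rfl, Or.inr (Or.inl rfl), ?_⟩).tail ⟨hbw.symm, Or.inr (Or.inl rfl), Or.inr (Or.inr rfl), ?_⟩
      · intro h; rw [Sym2.eq_iff] at h; rcases h with h | h
        · exact n1 h.1.symm
        · exact n2 h.1.symm
      · intro h; rw [Sym2.eq_iff] at h; rcases h with h | h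
        · exact n2 h.2.symm
        · exact n3 h.1

theorem contract2 {V : Type} [Fintype V] (hV : 4 ≤ Fintype.card V) {a b S : V} : ∀ (n : ℕ) {N : V} {G : SimpleGraph V}
    {F : V → V → V → Prop}, IsTri G F → F a b N → F b a S → (∀ w, G.Adj a w → G.Adj b w → w = N ∨ w = S) →
    (G.neighborSet a).ncard = n →
    ∃ (G' : SimpleGraph V) (F' : V → V → V → Prop) (N' : V), IsTri G' F' ∧ F' a b N' ∧ F' a N' S ∧ F' a S b ∧
      (∀ p q, p ≠ a → q ≠ a → G.Adj p q → G'.Adj p q) ∧ (∀ p q r, p ≠ a → q ≠ a → r ≠ a → F p q r → F' p q r) ∧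
      ∀ s t, s ≠ b → t ≠ b → F a s t → F' b s t ∨ (s = N' ∧ t = S) := by
  intro n
  induction n using Nat.strong_induction_on with
  | _ n ih =>
  intro N G F T h1 h2 hc hn
  obtain ⟨v, h3⟩ := T.ex (T.adj3 h1).symm
  have nvb : v ≠ b := T.opp_ne hV h3 (T.rot (T.rot h1))
  have m1 := (T.adj2 h3).ne
  have m2 := (T.adj3 h3)
  have m3 := (T.adj h1)
  by_cases e : v = S
  · subst e
    refine ⟨G, F, N, T, h1, h3, T.rot h2, fun p q _ _ h => h, fun p q r _ _ _ h => h, fun s t hs ht hst => ?_⟩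
    have := T.link a (fun w => w = b ∨ w = N ∨ w = v) (by
      rintro s t hst (rfl | rfl | rfl)
      · right; left; exact T.uniq hst h1
      · right; right; exact T.uniq hst h3
      · left; exact T.uniq hst (T.rot h2)) b s m3 (T.adj hst) (Or.inl rfl)
    rcases this with h | rfl | rfl
    · exact absurd h hs
    · exact Or.inr ⟨rfl, T.uniq hst h3⟩
    · exact absurd (T.uniq hst (T.rot h2)) ht
  have hna : ¬ G.Adj v b := fun h => by
    rcases hc v m2.symm h.symm with h | h
    · exact m1 h.symm
    · exact e h
  have hadj := @flipG_adj _ G a N v b nvb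
  have mab := m3.ne
  have mav := m2.ne
  have maN := (T.adj3 h1).ne
  have mbN := (T.adj2 h1).ne
  obtain ⟨G', F', N', T', f1, f2, f3, k1, k2, k3⟩ := ih _ (by
      rw [← hn]
      refine card_lt (y := N) (T.adj3 h1).symm (by rw [hadj]; tauto) ?_
      intro z hz; rw [hadj] at hz
      rcases hz with hz | hz | hz
      · exact hz.1
      · exact absurd hz.1.symm mav
      · exact absurd hz.1 mab)
    (T.flip' h3 (T.rot (T.rot h1)) nvb hna) (N := v) (Or.inr (Or.inl (by unfold Rot; tauto)))
    (Or.inl ⟨h2, by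
      rintro (h | h | h)
      · exact mab h.1.symm
      · exact mbN h.1
      · exact nvb h.1.symm, by
      rintro (h | h | h)
      · exact mbN h.1
      · exact mab h.1.symm
      · exact maN h.2.1.symm⟩) (by
        intro w haw hbw
        rw [hadj] at haw hbw
        rcases haw with haw | haw | haw
        · rcases hbw with hbw | hbw | hbw
          · rcases hc w haw.1 hbw.1 with h | h
            · exact absurd ⟨rfl, h⟩ haw.2.1
            · exact Or.inr h
          · exact absurd hbw.1.symm nvb
          · exact Or.inl hbw.2
        · exact absurd haw.1.symm mav
        · exact absurd haw.1 mab) rfl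
  · refine ⟨G', F', N', T', f1, f2, f3, fun p q hp hq hpq => k1 p q hp hq ?_, fun p q r hp hq hr h => k2 p q r hp hq hr (Or.inl ⟨h, ?_, ?_⟩), fun s t hs ht hst => ?_⟩
    · rw [hadj]; left; exact ⟨hpq, fun h => hp h.1, fun h => hq h.2⟩
    · rintro (h | h | h)
      · exact hp h.1
      · exact hr h.2.2
      · exact hq h.2.1
    · rintro (h | h | h)
      · exact hq h.2.1
      · exact hp h.1
      · exact hr h.2.2
    · by_cases eN : s = N
      · subst eN
        have := T.uniq hst h3
        subst this
        left
        exact k2 b s t mab.symm maN mav (Or.inr (Or.inr (Or.inl ⟨rfl, rfl, rfl⟩)))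
      · refine k3 s t hs ht (Or.inl ⟨hst, ?_, ?_⟩)
        · rintro (h | h | h)
          · exact eN h.2.1
          · exact maN h.1.symm
          · exact mav h.1.symm
        · rintro (h | h | h)
          · exact maN h.1.symm
          · exact hs h.2.1
          · exact mab h.1

theorem exdir (n m : ℝ × ℝ) (h : n.1 * m.2 - n.2 * m.1 ≠ 0 ∨ n.1 * m.1 + n.2 * m.2 < 0) :
    ∃ d : ℝ × ℝ, 0 < n.1 * d.2 - n.2 * d.1 ∧ 0 < d.1 * m.2 - d.2 * m.1 := by
  rcases lt_trichotomy (n.1 * m.2 - n.2 * m.1) 0 with h1 | h1 | h1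
  · exact ⟨(-(n.1+m.1), -(n.2+m.2)), by simp only; nlinarith, by simp only; nlinarith⟩
  · have h2 : n.1 * m.1 + n.2 * m.2 < 0 := by
      rcases h with h | h
      · exact absurd h1 h
      · exact h
    refine ⟨(-n.2, n.1), ?_, by simp only; nlinarith⟩
    simp only
    by_contra hc
    have e1 : n.1 = 0 := by nlinarith [sq_nonneg n.1, sq_nonneg n.2]
    have e2 : n.2 = 0 := by nlinarith [sq_nonneg n.1, sq_nonneg n.2]
    rw [e1, e2] at h2; simp at h2
  · exact ⟨(n.1+m.1, n.2+m.2), by simp only; nlinarith, by simp only; nlinarith⟩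

theorem par {b N S : ℝ × ℝ} (h1 : N ≠ b) (h2 : S ≠ b)
    (h3 : (N.1-b.1)*(S.2-b.2) - (N.2-b.2)*(S.1-b.1) = 0) (h4 : 0 ≤ (N.1-b.1)*(S.1-b.1) + (N.2-b.2)*(S.2-b.2)) :
    S ∈ segment ℝ b N ∨ N ∈ segment ℝ b S := by
  have key : ∀ {N S : ℝ × ℝ}, N ≠ b → (N.1-b.1)*(S.2-b.2) - (N.2-b.2)*(S.1-b.1) = 0 →
      0 ≤ (N.1-b.1)*(S.1-b.1) + (N.2-b.2)*(S.2-b.2) → (S.1-b.1)^2+(S.2-b.2)^2 ≤ (N.1-b.1)^2+(N.2-b.2)^2 → S ∈ segment ℝ b N := by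
    intro N S h1 h3 h4 hle
    obtain ⟨b1, b2⟩ := b
    obtain ⟨N1, N2⟩ := N
    obtain ⟨S1, S2⟩ := S
    simp only at *
    have hN : 0 < (N1-b1)^2+(N2-b2)^2 := by
      by_contra hc
      have e1 : N1 - b1 = 0 := by nlinarith [sq_nonneg (N1-b1), sq_nonneg (N2-b2)]
      have e2 : N2 - b2 = 0 := by nlinarith [sq_nonneg (N1-b1), sq_nonneg (N2-b2)]
      exact h1 (Prod.ext (by simp; linarith) (by simp; linarith))
    set t := ((N1-b1)*(S1-b1) + (N2-b2)*(S2-b2)) / ((N1-b1)^2+(N2-b2)^2) with ht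
    have t0 : 0 ≤ t := div_nonneg h4 hN.le
    have t1 : t ≤ 1 := by rw [ht, div_le_one hN]; nlinarith [sq_nonneg (N1-S1), sq_nonneg (N2-S2)]
    have e1 : t * (N1 - b1) = S1 - b1 := by
      rw [ht]; field_simp
      linear_combination (N2 - b2) * h3
    have e2 : t * (N2 - b2) = S2 - b2 := by
      rw [ht]; field_simp
      linear_combination (-(N1 - b1)) * h3
    refine ⟨1 - t, t, by linarith, t0, by ring, ?_⟩
    ext
    · simp; linarith
    · simp; linarith
  rcases le_total ((S.1-b.1)^2+(S.2-b.2)^2) ((N.1-b.1)^2+(N.2-b.2)^2) with h | h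
  · exact Or.inl (key h1 h3 h4 h)
  · exact Or.inr (key h2 (by linarith) (by linarith) h)

theorem draw3 {V : Type} [Fintype V] {G : SimpleGraph V} {F : V → V → V → Prop} (T : IsTri G F)
    (hc : Fintype.card V = 3) {x y z : V} (h0 : F x y z) : ∃ pos, Dr F x y z pos := by
  classical
  have n1 := (T.adj h0).ne
  have n2 := (T.adj2 h0).ne
  have n3 := (T.adj3 h0).ne
  have hu : ∀ v : V, v = x ∨ v = y ∨ v = z := by
    intro v
    have hu : ({x, y, z} : Finset V) = Finset.univ := by
      apply Finset.eq_univ_of_card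
      rw [hc, Finset.card_eq_three.2 ⟨x, y, z, n1, n3.symm, n2, rfl⟩]
    have : v ∈ ({x, y, z} : Finset V) := by rw [hu]; simp
    simpa using this
  set pos : V → ℝ × ℝ := fun v => if v = x then (0, 0) else if v = z then (1, 0) else (0, 1) with hp
  have px : pos x = (0, 0) := by simp [hp]
  have pz : pos z = (1, 0) := by simp [hp, n3]
  have py : pos y = (0, 1) := by simp [hp, n1.symm, n2]
  refine ⟨pos, ?_, by rw [px, pz, py]; norm_num [Dt], ?_⟩
  · intro u v h
    rcases hu u with rfl | rfl | rfl <;> rcases hu v with rfl | rfl | rfl <;> simp_all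
  · intro u v w hF hR
    have m1 := (T.adj hF).ne
    have m2 := (T.adj2 hF).ne
    have m3 := (T.adj3 hF).ne
    rcases hu u with h1 | h1 | h1 <;> rcases hu v with h2 | h2 | h2 <;> rcases hu w with h3 | h3 | h3 <;>
    rw [h1] at m1 m3 hR ⊢ <;> rw [h2] at m1 m2 hR ⊢ <;> rw [h3] at m2 m3 hR ⊢ <;>
    first
    | exact absurd rfl m1
    | exact absurd rfl m2
    | exact absurd rfl m3
    | (exfalso; apply hR; unfold Rot; tauto)
    | (rw [px, py, pz]; norm_num [Dt])

theorem draw_step {V : Type} [Fintype V] (hV : 3 ≤ Fintype.card V) {G : SimpleGraph (Option V)}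
    {F : Option V → Option V → Option V → Prop} (T : IsTri G F) {x y z : V} (h0 : F (some x) (some y) (some z))
    (ih : ∀ {G' : SimpleGraph V} {F' : V → V → V → Prop}, IsTri G' F' → F' x y z → ∃ pos, Dr F' x y z pos) :
    ∃ pos, Dr F (some x) (some y) (some z) pos := by
  obtain ⟨b, N, S, h1, h2, hc⟩ := T.ctr_edge (by simp; omega) none
  obtain ⟨G', F', N', T', f1, f2, f3, k1, k2, k3⟩ := contract2 (by simp; omega) _ T h1 h2 hc rfl
  have NS := T.opp_ne (by simp; omega) h1 h2
  have j1 := T.adj h1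
  have j2 := T.adj3 h1
  have j3 := T.adj2 h2
  have j4 := T'.adj3 f1
  cases b with
  | none => exact absurd rfl j1.ne
  | some b =>
  cases N with
  | none => exact absurd rfl j2.ne
  | some N =>
  cases S with
  | none => exact absurd rfl j3.ne
  | some S =>
  cases N' with
  | none => exact absurd rfl j4.ne
  | some N' =>
  have T2 := del3 T' f1 f2 f3
  obtain ⟨pos, hd⟩ := ih T2 (Or.inl (k2 _ _ _ (by simp) (by simp) (by simp) h0))
  set F2 : V → V → V → Prop := fun p q r => F' (some p) (some q) (some r) ∨ Rot b N' S p q r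
  have o0 : F2 x y z := (Or.inl (k2 _ _ _ (by simp) (by simp) (by simp) h0))
  have a1 : (G'.comap some).Adj b N := k1 (some b) (some N) (by simp) (by simp) (T.adj2 h1)
  have a2 : (G'.comap some).Adj b S := k1 (some b) (some S) (by simp) (by simp) (T.adj3 h2).symm
  have nS : N ≠ S := fun h => NS (by rw [h])
  have nNb : pos N ≠ pos b := fun h => a1.ne (hd.inj h.symm)
  have nSb : pos S ≠ pos b := fun h => a2.ne (hd.inj h.symm)
  have ne1 : s(b, N) ≠ s(b, S) := by
    intro h; rw [Sym2.eq_iff] at h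
    rcases h with h | h
    · exact nS h.2
    · exact a1.ne h.2.symm
  obtain ⟨d, d1, d2⟩ := exdir ((pos N).1 - (pos b).1, (pos N).2 - (pos b).2) ((pos S).1 - (pos b).1, (pos S).2 - (pos b).2) (by
    by_contra hcon
    push Not at hcon
    rcases par nNb nSb hcon.1 hcon.2 with h | h
    · rcases T2.nocross o0 hd a1 a2 ne1 h (right_mem_segment _ _ _) with h | h
      · exact nSb h
      · exact nS (hd.inj h).symm
    · rcases T2.nocross o0 hd a2 a1 ne1.symm h (right_mem_segment _ _ _) with h | h
      · exact nNb h
      · exact nS (hd.inj h))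
  simp only at d1 d2
  have dne : d.1 ≠ 0 ∨ d.2 ≠ 0 := by
    by_contra hcon
    push Not at hcon
    rw [hcon.1, hcon.2] at d1; simp at d1
  set P : ℝ → ℝ × ℝ := fun e => ((pos b).1 + e * d.1, (pos b).2 + e * d.2) with hP
  have ev1 : ∀ᶠ e in 𝓝[>] (0:ℝ), ∀ v, P e ≠ pos v := by
    refine eventually_all.2 fun v => ?_
    rcases dne with h | h
    · filter_upwards [ev_quad (α := (pos b).1 - (pos v).1) (β := d.1) (γ := 0) (by simp [h])] with e he hh
      apply he; rw [← hh]; simp [hP]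
    · filter_upwards [ev_quad (α := (pos b).2 - (pos v).2) (β := d.2) (γ := 0) (by simp [h])] with e he hh
      apply he; rw [← hh]; simp [hP]
  have ev2 : ∀ᶠ e in 𝓝[>] (0:ℝ), ∀ s t, 0 < Dt (pos b) (pos s) (pos t) → 0 < Dt (P e) (pos s) (pos t) := by
    refine eventually_all.2 fun s => eventually_all.2 fun t => ?_
    by_cases h : 0 < Dt (pos b) (pos s) (pos t)
    · filter_upwards [ev_lin (β := -d.1 * ((pos t).2 - (pos s).2) + d.2 * ((pos t).1 - (pos s).1)) h] with e he _
      refine lt_of_lt_of_eq he ?_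
      simp only [Dt, hP]; ring
    · exact Eventually.of_forall fun e he => absurd he h
  obtain ⟨e, e1, e2, e3⟩ := (ev1.and (ev2.and self_mem_nhdsWithin)).exists
  have e3 : (0:ℝ) < e := e3
  have rs : ∀ {p q r : V}, Rot (some x) (some y) (some z) (some p) (some q) (some r) ↔ Rot x y z p q r := by
    intro p q r; unfold Rot; simp
  set po : Option V → ℝ × ℝ := fun o => o.elim (P e) pos with hpo
  have key : ∀ s t, F none s t → 0 < Dt (P e) (po s) (po t) := by
    intro s t hst
    cases s with
    | none => exact absurd rfl (T.adj hst).ne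
    | some s =>
    cases t with
    | none => exact absurd rfl (T.adj3 hst).ne
    | some t =>
    show 0 < Dt (P e) (pos s) (pos t)
    by_cases es : s = b
    · subst es
      have := T.uniq hst h1
      simp only [Option.some.injEq] at this; subst this
      have : Dt (P e) (pos s) (pos t) = e * (((pos t).1 - (pos s).1) * d.2 - ((pos t).2 - (pos s).2) * d.1) := by
        simp only [Dt, hP]; ring
      rw [this]; exact mul_pos e3 d1
    by_cases et : t = b
    · subst et
      have := T.uniq (T.rot (T.rot hst)) h2
      simp only [Option.some.injEq] at this; subst this
      have : Dt (P e) (pos s) (pos t) = e * (d.1 * ((pos s).2 - (pos t).2) - d.2 * ((pos s).1 - (pos t).1)) := by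
        simp only [Dt, hP]; ring
      rw [this]; exact mul_pos e3 d2
    apply e2
    apply hd.inner
    · rcases k3 (some s) (some t) (by simpa using es) (by simpa using et) hst with h | ⟨h, h'⟩
      · exact Or.inl h
      · simp only [Option.some.injEq] at h h'; subst h h'
        right; unfold Rot; tauto
    · intro hr
      have := T.uniq' (T.rot_of h0 (rs.2 hr)) hst
      simp at this
  refine ⟨po, ?_, hd.outer, ?_⟩
  · intro u v h
    cases u with
    | none =>
      cases v with
      | none => rfl
      | some v => exact absurd h (e1 v)
    | some u =>
      cases v with
      | none => exact absurd h.symm (e1 u)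
      | some v => rw [hd.inj h]
  · intro u v w hF hR
    cases u with
    | none => exact key _ _ hF
    | some u =>
    cases v with
    | none => rw [← Dt_rot]; exact key _ _ (T.rot hF)
    | some v =>
    cases w with
    | none => rw [Dt_rot (po none) ]; exact key _ _ (T.rot (T.rot hF))
    | some w =>
      exact hd.inner u v w (Or.inl (k2 _ _ _ (by simp) (by simp) (by simp) hF)) (fun h => hR (rs.2 h))

theorem draw : ∀ (n : ℕ) {V : Type} [Fintype V] {G : SimpleGraph V} {F : V → V → V → Prop}, IsTri G F →
    Fintype.card V = n + 3 → ∀ {x y z : V}, F x y z → ∃ pos, Dr F x y z pos := by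
  intro n
  induction n with
  | zero => intro V _ G F T hc x y z h0; exact T.draw3 (by omega) h0
  | succ n ih =>
    intro V _ G F T hc x y z h0
    classical
    obtain ⟨a, ha⟩ : ∃ a, a ∉ ({x, y, z} : Finset V) := by
      by_contra hcon
      push Not at hcon
      have : Finset.univ ⊆ ({x, y, z} : Finset V) := fun a _ => hcon a
      have := Finset.card_le_card this
      rw [Finset.card_univ] at this
      have := Finset.card_le_three (a := x) (b := y) (c := z)
      omega
    simp only [Finset.mem_insert, Finset.mem_singleton, not_or] at ha
    have hcard : Fintype.card {v // v ≠ a} = n + 3 := by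
      rw [Fintype.card_subtype_compl]; simp [hc]
    set e := Equiv.optionSubtypeNe a
    obtain ⟨pos, hd⟩ := draw_step (by omega) (T.map e) (x := ⟨x, fun h => ha.1 h.symm⟩) (y := ⟨y, fun h => ha.2.1 h.symm⟩)
      (z := ⟨z, fun h => ha.2.2 h.symm⟩) h0 (fun T' h => ih T' hcard h)
    have ex : e.symm x = some ⟨x, fun h => ha.1 h.symm⟩ := Equiv.optionSubtypeNe_symm_of_ne _
    have ey : e.symm y = some ⟨y, fun h => ha.2.1 h.symm⟩ := Equiv.optionSubtypeNe_symm_of_ne _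
    have ez : e.symm z = some ⟨z, fun h => ha.2.2 h.symm⟩ := Equiv.optionSubtypeNe_symm_of_ne _
    refine ⟨pos ∘ e.symm, hd.inj.comp e.symm.injective, ?_, ?_⟩
    · simp only [Function.comp]; rw [ex, ey, ez]; exact hd.outer
    · intro u v w hF hR
      apply hd.inner
      · simpa using hF
      · rw [← ex, ← ey, ← ez]
        unfold Rot
        simpa [Rot] using hR

theorem planar {V : Type} [Fintype V] {G : SimpleGraph V} {F : V → V → V → Prop} (T : IsTri G F)
    (hV : 3 ≤ Fintype.card V) : IsPlanar G := by
  obtain ⟨n, hn⟩ := Nat.exists_eq_add_of_le' hV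
  have : Nonempty V := Fintype.card_pos_iff.1 (by omega)
  obtain ⟨u⟩ := this
  obtain ⟨v, hv⟩ := T.exnb (by omega) u
  obtain ⟨w, hw⟩ := T.ex hv
  obtain ⟨pos, hd⟩ := draw n T hn hw
  exact T.planar_of_dr hw hd

end IsTri


open SimpleGraph
open Filter Topology

def insF {V : Type} (F : V → V → V → Prop) (x y z : V) : Option V → Option V → Option V → Prop
  | some p, some q, some r => F p q r ∧ ¬ Rot x y z p q r
  | none, some p, some q => ∃ r, Rot x y z p q r
  | some p, some q, none => ∃ r, Rot x y z p q r
  | some q, none, some p => ∃ r, Rot x y z p q r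
  | _, _, _ => False

def insG {V : Type} (G : SimpleGraph V) (x y z : V) : SimpleGraph (Option V) where
  Adj u v := match u, v with
    | some p, some q => G.Adj p q
    | none, some p => p = x ∨ p = y ∨ p = z
    | some p, none => p = x ∨ p = y ∨ p = z
    | none, none => False
  symm := ⟨fun u v h => by
    cases u <;> cases v <;> first | exact h | exact SimpleGraph.Adj.symm h⟩
  loopless := ⟨fun u h => by cases u <;> first | exact h | exact SimpleGraph.irrefl _ h⟩

namespace IsTri

theorem ins3 {V : Type} [Fintype V] {G : SimpleGraph V} {F : V → V → V → Prop} (T : IsTri G F) {x y z : V}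
    (h0 : F x y z) : IsTri (insG G x y z) (insF F x y z) := by
  classical
  have n1 := (T.adj h0).ne
  have n2 := (T.adj2 h0).ne
  have n3 := (T.adj3 h0).ne
  have mem : ∀ {p q r}, Rot x y z p q r → (p = x ∨ p = y ∨ p = z) ∧ (q = x ∨ q = y ∨ q = z) := by
    rintro p q r (⟨rfl, rfl, rfl⟩ | ⟨rfl, rfl, rfl⟩ | ⟨rfl, rfl, rfl⟩) <;> simp
  have nxt : ∀ {p}, (p = x ∨ p = y ∨ p = z) → ∃ q r, Rot x y z p q r := by
    rintro p (rfl | rfl | rfl)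
    · exact ⟨y, z, by unfold Rot; simp⟩
    · exact ⟨z, x, by unfold Rot; simp⟩
    · exact ⟨x, y, by unfold Rot; simp⟩
  refine ⟨?_, ?_, ?_, ?_, ?_, ?_, ?_⟩
  · intro u v w h
    cases u <;> cases v <;> cases w <;> try exact h
    exact ⟨T.rot h.1, fun h' => h.2 h'.rot'⟩
  · intro u v w h
    cases u with
    | none =>
      cases v with
      | none => exact h
      | some v => cases w with
        | none => exact h.elim
        | some w => obtain ⟨r, h⟩ := h; exact (mem h).1
    | some u =>
      cases v with
      | none => cases w with
        | none => exact h.elim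
        | some w => obtain ⟨r, h⟩ := h; exact (mem h).2
      | some v => cases w with
        | none => obtain ⟨r, h⟩ := h; exact T.adj (T.rot_of h0 h)
        | some w => exact T.adj h.1
  · intro u v h
    cases u with
    | none => cases v with
      | none => exact h.elim
      | some v => obtain ⟨q, r, h⟩ := nxt h; exact ⟨some q, r, h⟩
    | some u => cases v with
      | none => obtain ⟨q, r, h⟩ := nxt h; exact ⟨some r, q, h.rot.rot⟩
      | some v =>
        obtain ⟨w, hw⟩ := T.ex h
        by_cases hR : Rot x y z u v w
        · exact ⟨none, w, hR⟩
        · exact ⟨some w, hw, hR⟩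
  · intro u v w w' h h'
    cases u with
    | none => cases v with
      | none => exact h.elim
      | some v => cases w with
        | none => exact h.elim
        | some w => cases w' with
          | none => exact h'.elim
          | some w' =>
            obtain ⟨r, h⟩ := h; obtain ⟨r', h'⟩ := h'
            congr 1
            rcases h with ⟨rfl, rfl, rfl⟩ | ⟨rfl, rfl, rfl⟩ | ⟨rfl, rfl, rfl⟩ <;>
            rcases h' with ⟨h1, h2, h3⟩ | ⟨h1, h2, h3⟩ | ⟨h1, h2, h3⟩ <;> simp_all
    | some u => cases v with
      | none => cases w with
        | none => exact h.elim
        | some w => cases w' with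
          | none => exact h'.elim
          | some w' =>
            obtain ⟨r, h⟩ := h; obtain ⟨r', h'⟩ := h'
            congr 1
            rcases h with ⟨rfl, rfl, rfl⟩ | ⟨rfl, rfl, rfl⟩ | ⟨rfl, rfl, rfl⟩ <;>
            rcases h' with ⟨h1, h2, h3⟩ | ⟨h1, h2, h3⟩ | ⟨h1, h2, h3⟩ <;> simp_all
      | some v => cases w with
        | none => cases w' with
          | none => rfl
          | some w' =>
            obtain ⟨r, h⟩ := h
            have := T.uniq (T.rot_of h0 h) h'.1
            exact absurd (this ▸ h) h'.2
        | some w => cases w' with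
          | none =>
            obtain ⟨r, h'⟩ := h'
            have := T.uniq (T.rot_of h0 h') h.1
            exact absurd (this ▸ h') h.2
          | some w' => rw [T.uniq h.1 h'.1]
  · intro v P hP u u' hu hu' hp
    cases v with
    | none =>
      have p1 : P (some x) → P (some y) := hP (some x) (some y) ⟨z, by unfold Rot; simp⟩
      have p2 : P (some y) → P (some z) := hP (some y) (some z) ⟨x, by unfold Rot; simp⟩
      have p3 : P (some z) → P (some x) := hP (some z) (some x) ⟨y, by unfold Rot; simp⟩
      cases u with
      | none => exact hu.elim
      | some u => cases u' with
        | none => exact hu'.elim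
        | some u' =>
          clear hP
          rcases hu with rfl | rfl | rfl <;> rcases hu' with rfl | rfl | rfl <;> simp_all
    | some v =>
      have L : ∀ s t, G.Adj v s → G.Adj v t → P (some s) → P (some t) := by
        intro s t hs ht hps
        refine T.link v (fun s => P (some s)) ?_ s t hs ht hps
        intro s t hst hs
        by_cases hR : Rot x y z v s t
        · exact hP none (some t) ⟨s, hR.rot.rot⟩ (hP (some s) none ⟨t, hR⟩ hs)
        · exact hP (some s) (some t) ⟨hst, hR⟩ hs
      have L2 : ∀ s, G.Adj v s → P (some s) → P u' := by
        intro s hs hps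
        cases u' with
        | some t => exact L s t hs hu' hps
        | none =>
          obtain ⟨q, r, hR⟩ := nxt hu'
          exact hP (some q) none ⟨r, hR⟩ (L s q hs (T.adj (T.rot_of h0 hR)) hps)
      cases u with
      | some s => exact L2 s hu hp
      | none =>
        obtain ⟨q, r, hR⟩ := nxt hu
        exact L2 r (T.adj3 (T.rot_of h0 hR)).symm (hP none (some r) ⟨q, hR.rot.rot⟩ hp)
  · intro P hP u v hu
    have k1 : P none → P (some x) := hP none (some x) (Or.inl rfl)
    have k2 : P (some x) → P none := hP (some x) none (Or.inl rfl)
    have L : ∀ s t, P (some s) → P (some t) := T.conn (fun s => P (some s)) (fun s t h => hP (some s) (some t) h)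
    cases u with
    | none => cases v with
      | none => exact hu
      | some v => exact L x v (k1 hu)
    | some u => cases v with
      | none => exact k2 (L u x hu)
      | some v => exact L u v hu
  · intro γ g1 g2 g3
    have two : ∀ a : ZMod 2, a + a = 0 := by decide
    set k := γ none (some y) with hk
    set l := γ none (some x) with hl
    have e0 : l + k + γ none (some z) = 0 := by
      have := g3 none
      rw [Fintype.sum_option, g2 none none (fun h => h), zero_add] at this
      rw [← this]
      have hs : ∑ i, γ none (some i) = ∑ i ∈ ({x, y, z} : Finset V), γ none (some i) := by
        symm
        apply Finset.sum_subset (Finset.subset_univ _)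
        intro i _ hi
        apply g2; intro h
        apply hi; simpa using (show i = x ∨ i = y ∨ i = z from h)
      rw [hs, Finset.sum_insert (by simp [n1, n3.symm]), Finset.sum_insert (by simp [n2]), Finset.sum_singleton]
      ring
    obtain ⟨h, x1, x2⟩ := T.hom (fun s t => γ (some s) (some t) + k * eg y z s t + l * eg z x s t) (by
      intro s t; beta_reduce; rw [g1, eg_symm y z, eg_symm z x]) (by
      intro s t hst
      have e1 : eg y z s t = 0 := by
        unfold eg; rw [if_neg]
        rintro (⟨rfl, rfl⟩ | ⟨rfl, rfl⟩)
        · exact hst (T.adj2 h0)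
        · exact hst (T.adj2 h0).symm
      have e2 : eg z x s t = 0 := by
        unfold eg; rw [if_neg]
        rintro (⟨rfl, rfl⟩ | ⟨rfl, rfl⟩)
        · exact hst (T.adj3 h0)
        · exact hst (T.adj3 h0).symm
      beta_reduce
      rw [e1, e2, g2 (some s) (some t) hst]; simp) (by
      intro s
      simp only [Finset.sum_add_distrib, ← Finset.mul_sum, eg_sum n2, eg_sum n3]
      have := g3 (some s)
      rw [Fintype.sum_option] at this
      by_cases hx : s = x
      · subst hx
        rw [g1] at this
        simp only [n1, n3.symm, if_false, if_true]
        linear_combination this + hl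
      by_cases hy : s = y
      · subst hy
        rw [g1] at this
        simp only [n1.symm, n2, if_false, if_true]
        linear_combination this + hk
      by_cases hz : s = z
      · subst hz
        rw [g1] at this
        simp only [n3, n2.symm, if_false, if_true]
        linear_combination this + e0 - two (γ none (some s))
      · rw [g2 (some s) none (by rintro (h | h | h) <;> contradiction)] at this
        simp only [hx, hy, hz, if_false]
        linear_combination this)
    set c := h x y
    have c1 : h y z = c := (x1 _ _ _ h0).symm
    have c2 : h z x = c := (x1 _ _ _ (T.rot h0)).symm.trans c1
    set H : Option V → Option V → ZMod 2 := fun s t => match s, t with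
      | some p, some q => h p q + (if p = y ∧ q = z then k else 0) + (if p = z ∧ q = x then l else 0)
      | none, some p => c + (if p = y then k else if p = z then l else 0)
      | some p, none => c + (if p = z then k else if p = x then l else 0)
      | none, none => 0 with hH
    have H1 : ∀ p q, H (some p) (some q) = h p q + (if p = y ∧ q = z then k else 0) + (if p = z ∧ q = x then l else 0) := fun p q => rfl
    have H2 : ∀ p, H none (some p) = c + (if p = y then k else if p = z then l else 0) := fun p => rfl
    have H3 : ∀ p, H (some p) none = c + (if p = z then k else if p = x then l else 0) := fun p => rfl
    clear_value H
    refine ⟨H, ?_, ?_⟩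
    · have K : ∀ p q r, Rot x y z p q r → H none (some p) = H (some p) (some q) ∧ H (some p) (some q) = H (some q) none ∧
          H (some q) none = H none (some p) := by
        intro p q r hR
        rw [H1, H2, H3]
        rcases hR with ⟨rfl, rfl, rfl⟩ | ⟨rfl, rfl, rfl⟩ | ⟨rfl, rfl, rfl⟩
        · simp [n1, n1.symm, n2, n2.symm, n3, n3.symm, c]
        · simp [n1, n1.symm, n2, n2.symm, n3, n3.symm, c1]
        · simp [n1, n1.symm, n2, n2.symm, n3, n3.symm, c2]
      intro u v w hF
      cases u with
      | none => cases v with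
        | none => exact hF.elim
        | some v => cases w with
          | none => exact hF.elim
          | some w => obtain ⟨r, hR⟩ := hF; exact (K _ _ _ hR).1
      | some u => cases v with
        | none => cases w with
          | none => exact hF.elim
          | some w => obtain ⟨r, hR⟩ := hF; exact (K _ _ _ hR).2.2
        | some v => cases w with
          | none => obtain ⟨r, hR⟩ := hF; exact (K _ _ _ hR).2.1
          | some w =>
            obtain ⟨hF, hR⟩ := hF
            have D : ∀ p q r, F p q r → ¬ Rot x y z p q r → H (some p) (some q) = h p q := by
              intro p q r hF hR
              rw [H1, if_neg, if_neg, add_zero, add_zero]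
              · rintro ⟨rfl, rfl⟩
                apply hR; rw [T.uniq hF (T.rot (T.rot h0))]; unfold Rot; simp
              · rintro ⟨rfl, rfl⟩
                apply hR; rw [T.uniq hF (T.rot h0)]; unfold Rot; simp
            rw [D _ _ _ hF hR, D _ _ _ (T.rot hF) (fun h => hR h.rot')]
            exact x1 _ _ _ hF
    · intro u v huv
      have B : ∀ p, (p = x ∨ p = y ∨ p = z) → H none (some p) + H (some p) none = γ none (some p) := by
        rintro p (rfl | rfl | rfl)
        · rw [H2, H3]; simp only [n1, n1.symm, n2, n2.symm, n3, n3.symm, if_true, if_false]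
          linear_combination two c + hl
        · rw [H2, H3]; simp only [n1, n1.symm, n2, n2.symm, n3, n3.symm, if_true, if_false]
          linear_combination two c + hk
        · rw [H2, H3]; simp only [n1, n1.symm, n2, n2.symm, n3, n3.symm, if_true, if_false]
          linear_combination two c + e0 - two (γ none (some p))
      cases u with
      | none => cases v with
        | none => exact huv.elim
        | some v => exact B v huv
      | some u => cases v with
        | none => rw [add_comm, g1]; exact B u huv
        | some v =>
          have := x2 u v huv
          rw [H1, H1]
          have E1 : eg y z u v = (if u = y ∧ v = z then 1 else 0) + (if v = y ∧ u = z then 1 else 0) := by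
            unfold eg
            by_cases a : u = y ∧ v = z
            · rw [if_pos a, if_pos (Or.inl a), if_neg (by rintro ⟨h1, h2⟩; exact n2 (a.1.symm.trans h2)), add_zero]
            · by_cases b : v = y ∧ u = z
              · rw [if_neg a, if_pos (Or.inr ⟨b.2, b.1⟩), if_pos b, zero_add]
              · rw [if_neg a, if_neg b, if_neg (by rintro (h | h); exact a h; exact b ⟨h.2, h.1⟩), zero_add]
          have E2 : eg z x u v = (if u = z ∧ v = x then 1 else 0) + (if v = z ∧ u = x then 1 else 0) := by
            unfold eg
            by_cases a : u = z ∧ v = x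
            · rw [if_pos a, if_pos (Or.inl a), if_neg (by rintro ⟨h1, h2⟩; exact n3 (a.1.symm.trans h2)), add_zero]
            · by_cases b : v = z ∧ u = x
              · rw [if_neg a, if_pos (Or.inr ⟨b.2, b.1⟩), if_pos b, zero_add]
              · rw [if_neg a, if_neg b, if_neg (by rintro (h | h); exact a h; exact b ⟨h.2, h.1⟩), zero_add]
          have m : ∀ (P : Prop) [Decidable P] (a : ZMod 2), (if P then a else 0) = a * (if P then 1 else 0) := by
            intro P _ a; simp
          rw [m _ k, m _ l, m (v = y ∧ u = z) k, m (v = z ∧ u = x) l]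
          rw [E1, E2] at this
          generalize (if u = y ∧ v = z then (1 : ZMod 2) else 0) = A at *
          generalize (if v = y ∧ u = z then (1 : ZMod 2) else 0) = B' at *
          generalize (if u = z ∧ v = x then (1 : ZMod 2) else 0) = C at *
          generalize (if v = z ∧ u = x then (1 : ZMod 2) else 0) = D at *
          linear_combination this + two (k * (A + B')) + two (l * (C + D))

end IsTri


open SimpleGraph
open Filter Topology

theorem Rot.symm {V : Type} {x y z p q r : V} (h : Rot x y z p q r) : Rot p q r x y z := by
  rcases h with ⟨rfl, rfl, rfl⟩ | ⟨rfl, rfl, rfl⟩ | ⟨rfl, rfl, rfl⟩ <;> simp [Rot]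

def Gen {V : Type} (pos : V → ℝ × ℝ) : Prop :=
  (∀ u v, u ≠ v → (pos u).1 ≠ (pos v).1) ∧
    ∀ u v w, u ≠ v → v ≠ w → w ≠ u → Dt (pos u) (pos v) (pos w) ≠ 0

namespace IsTri

theorem k3 {V : Type} [Fintype V] {x y z : V} (hxy : x ≠ y) (hyz : y ≠ z) (hzx : z ≠ x)
    (hc : ∀ v, v = x ∨ v = y ∨ v = z) :
    IsTri (⊤ : SimpleGraph V) (fun u v w => u ≠ v ∧ v ≠ w ∧ w ≠ u) := by
  classical
  have third : ∀ u v : V, u ≠ v → ∃ w, v ≠ w ∧ w ≠ u := by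
    intro u v h
    rcases hc u with rfl | rfl | rfl <;> rcases hc v with rfl | rfl | rfl
    all_goals first | exact (h rfl).elim | skip
    · exact ⟨z, hyz, hzx⟩
    · exact ⟨y, hyz.symm, hxy.symm⟩
    · exact ⟨z, hzx.symm, hyz.symm⟩
    · exact ⟨x, hzx, hxy⟩
    · exact ⟨y, hxy, hyz⟩
    · exact ⟨x, hxy.symm, hzx.symm⟩
  have un : ∀ u v w w' : V, u ≠ v → v ≠ w → w ≠ u → v ≠ w' → w' ≠ u → w = w' := by
    intro u v w w' h1 h2 h3 h4 h5
    rcases hc u with rfl | rfl | rfl <;> rcases hc v with rfl | rfl | rfl <;>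
      rcases hc w with rfl | rfl | rfl <;> rcases hc w' with rfl | rfl | rfl <;> first | rfl | contradiction
  refine ⟨?_, ?_, ?_, ?_, ?_, ?_, ?_⟩
  · rintro u v w ⟨h1, h2, h3⟩; exact ⟨h2, h3, h1⟩
  · rintro u v w ⟨h1, h2, h3⟩; exact h1
  · intro u v h
    obtain ⟨w, h1, h2⟩ := third u v h
    exact ⟨w, h, h1, h2⟩
  · rintro u v w w' ⟨h1, h2, h3⟩ ⟨h4, h5, h6⟩; exact un u v w w' h1 h2 h3 h5 h6
  · intro v P hP u u' hu hu' h
    by_cases e : u = u'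
    · rwa [← e]
    · exact hP u u' ⟨hu, e, hu'.symm⟩ h
  · intro P hP u v h
    by_cases e : u = v
    · rwa [← e]
    · exact hP u v e h
  · intro γ g1 g2 g3
    have gd : ∀ u, γ u u = 0 := fun u => g2 u u (by simp)
    have two : ∀ a : ZMod 2, a + a = 0 := fun a => CharTwo.add_self_eq_zero a
    have hs : ∀ f : V → ZMod 2, ∑ v, f v = f x + f y + f z := by
      intro f
      have : (Finset.univ : Finset V) = {x, y, z} := by
        ext v; simpa using hc v
      rw [this, Finset.sum_insert (by simp [hxy, hzx.symm]), Finset.sum_insert (by simp [hyz]), Finset.sum_singleton]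
      ring
    have ex := g3 x
    have ey := g3 y
    rw [hs, gd] at ex ey
    rw [g1 y x] at ey
    have e1 : γ x z = γ x y := by linear_combination ex - two (γ x y)
    have e2 : γ y z = γ x y := by linear_combination ey - two (γ x y)
    have nR : ¬ Rot x y z y x z := by
      rintro (⟨h, _⟩ | ⟨_, h, _⟩ | ⟨h, _⟩)
      · exact hxy h.symm
      · exact hzx h.symm
      · exact hyz h
    refine ⟨fun u v => if (∃ w, Rot x y z u v w) then γ x y else 0, ?_, ?_⟩
    · rintro u v w ⟨h1, h2, h3⟩
      have : (∃ t, Rot x y z u v t) ↔ (∃ t, Rot x y z v w t) := by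
        constructor
        · rintro ⟨t, ht⟩
          refine ⟨u, ?_⟩
          rcases ht with ⟨rfl, rfl, rfl⟩ | ⟨rfl, rfl, rfl⟩ | ⟨rfl, rfl, rfl⟩ <;>
            rcases hc w with rfl | rfl | rfl <;> first | contradiction | simp [Rot]
        · rintro ⟨t, ht⟩
          refine ⟨w, ?_⟩
          rcases ht with ⟨rfl, rfl, rfl⟩ | ⟨rfl, rfl, rfl⟩ | ⟨rfl, rfl, rfl⟩ <;>
            rcases hc u with rfl | rfl | rfl <;> first | contradiction | simp [Rot]
      beta_reduce
      simp only [this]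
    · intro u v h
      have h : u ≠ v := h
      have e3 : γ z x = γ x y := by rw [g1, e1]
      have e4 : γ z y = γ x y := by rw [g1, e2]
      have e5 : γ y x = γ x y := g1 _ _
      rcases hc u with rfl | rfl | rfl <;> rcases hc v with rfl | rfl | rfl
      all_goals first | exact (h rfl).elim | skip
      all_goals simp [Rot, hxy, hyz, hzx, hxy.symm, hyz.symm, hzx.symm, e1, e2, e3, e4, e5]

theorem start_step {V : Type} [Fintype V] {G : SimpleGraph V} {F : V → V → V → Prop} (T : IsTri G F)
    {x y z : V} {pos : Option V → ℝ × ℝ} (hg : Gen pos) (h0 : F x y z) (hd : Dr F x y z (fun v => pos (some v)))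
    (hI : Ins (pos (some x)) (pos (some z)) (pos (some y)) (pos none)) :
    ∃ (G' : SimpleGraph (Option V)) (F' : Option V → Option V → Option V → Prop), IsTri G' F' ∧
      F' (some x) (some y) (some z) ∧ Dr F' (some x) (some y) (some z) pos := by
  classical
  have hc := T.count h0 hd (pos none) (fun v => sub_ne_zero.2 (hg.1 _ _ (by simp)))
    (fun u v h => hg.2 _ _ _ (by simpa using h) (by simp) (by simp))
  rw [if_pos hI] at hc
  obtain ⟨u, v, w, h1, h2, h3⟩ : ∃ u v w, F u v w ∧ ¬ Rot x y z u v w ∧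
      Ins (pos (some u)) (pos (some v)) (pos (some w)) (pos none) := by
    by_contra hcon
    push Not at hcon
    rw [Finset.sum_eq_zero] at hc
    · omega
    · intro u _
      refine Finset.sum_eq_zero fun v _ => Finset.sum_eq_zero fun w _ => ?_
      rw [if_neg]
      rintro ⟨a, b, c⟩
      exact hcon u v w a b c
  refine ⟨_, _, T.ins3 h1, ⟨h0, fun h => h2 h.symm⟩, ?_, ?_, ?_⟩
  · intro a b h
    by_contra hne
    exact hg.1 a b hne (by rw [h])
  · exact hd.outer
  · have key : ∀ p q r, Rot u v w p q r → 0 < Dt (pos (some p)) (pos (some q)) (pos none) := by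
      rintro p q r (⟨rfl, rfl, rfl⟩ | ⟨rfl, rfl, rfl⟩ | ⟨rfl, rfl, rfl⟩)
      · exact h3.2.2
      · exact h3.1
      · exact h3.2.1
    intro p q r h hR
    cases p with
    | none => cases q with
      | none => exact h.elim
      | some q => cases r with
        | none => exact h.elim
        | some r => obtain ⟨t, ht⟩ := h; rw [← Dt_rot]; exact key _ _ _ ht
    | some p => cases q with
      | none => cases r with
        | none => exact h.elim
        | some r => obtain ⟨t, ht⟩ := h; rw [← Dt_rot, ← Dt_rot]; exact key _ _ _ ht
      | some q => cases r with
        | none => obtain ⟨t, ht⟩ := h; exact key _ _ _ ht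
        | some r => exact hd.inner _ _ _ h.1 (by simpa [Rot] using hR)

theorem start : ∀ (n : ℕ) {V : Type} [Fintype V], Fintype.card V = n + 3 → ∀ {x y z : V} {pos : V → ℝ × ℝ},
    Gen pos → x ≠ y → y ≠ z → z ≠ x → 0 < Dt (pos x) (pos z) (pos y) →
    (∀ v, v ≠ x → v ≠ y → v ≠ z → Ins (pos x) (pos z) (pos y) (pos v)) →
    ∃ (G : SimpleGraph V) (F : V → V → V → Prop), IsTri G F ∧ F x y z ∧ Dr F x y z pos := by
  intro n
  induction n with
  | zero =>
    intro V _ hc x y z pos hg hxy hyz hzx ho hI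
    classical
    have hcov : ∀ v, v = x ∨ v = y ∨ v = z := by
      have h3 : ({x, y, z} : Finset V).card = 3 := Finset.card_eq_three.2 ⟨x, y, z, hxy, hzx.symm, hyz, rfl⟩
      have := (Finset.card_eq_iff_eq_univ _).1 (h3.trans hc.symm)
      intro v
      have := this ▸ Finset.mem_univ v
      simpa using this
    refine ⟨_, _, k3 hxy hyz hzx hcov, ⟨hxy, hyz, hzx⟩, ?_, ho, ?_⟩
    · intro a b h
      by_contra hne
      exact hg.1 a b hne (by rw [h])
    · rintro u v w ⟨h1, h2, h3⟩ hR
      have : Rot x z y u v w := by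
        rcases hcov u with rfl | rfl | rfl <;> rcases hcov v with rfl | rfl | rfl <;>
          rcases hcov w with rfl | rfl | rfl <;> first | contradiction | (simp [Rot]; done) | (exact (hR (by simp [Rot])).elim)
      rcases this with ⟨rfl, rfl, rfl⟩ | ⟨rfl, rfl, rfl⟩ | ⟨rfl, rfl, rfl⟩
      · exact ho
      · rw [Dt_rot]; exact ho
      · rw [Dt_rot, Dt_rot]; exact ho
  | succ n ih =>
    intro V _ hc x y z pos hg hxy hyz hzx ho hI
    classical
    obtain ⟨a, ha⟩ : ∃ a, a ∉ ({x, y, z} : Finset V) := by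
      by_contra hcon
      push Not at hcon
      have : Finset.univ ⊆ ({x, y, z} : Finset V) := fun a _ => hcon a
      have := Finset.card_le_card this
      rw [Finset.card_univ] at this
      have := Finset.card_le_three (a := x) (b := y) (c := z)
      omega
    simp only [Finset.mem_insert, Finset.mem_singleton, not_or] at ha
    have hcard : Fintype.card {v // v ≠ a} = n + 3 := by
      rw [Fintype.card_subtype_compl]; simp [hc]
    set e := Equiv.optionSubtypeNe a
    have hx : x ≠ a := fun h => ha.1 h.symm
    have hy : y ≠ a := fun h => ha.2.1 h.symm
    have hz : z ≠ a := fun h => ha.2.2 h.symm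
    have es : ∀ v : {v // v ≠ a}, e (some v) = v.1 := fun v => rfl
    have en : e none = a := rfl
    have hg1 : Gen (fun v : {v // v ≠ a} => pos v.1) :=
      ⟨fun u v h => hg.1 _ _ (fun h' => h (Subtype.ext h')),
        fun u v w h1 h2 h3 => hg.2 _ _ _ (fun h' => h1 (Subtype.ext h')) (fun h' => h2 (Subtype.ext h')) (fun h' => h3 (Subtype.ext h'))⟩
    obtain ⟨G1, F1, T1, h1, d1⟩ := ih hcard (x := ⟨x, hx⟩) (y := ⟨y, hy⟩) (z := ⟨z, hz⟩) hg1
      (fun h => hxy (congrArg Subtype.val h)) (fun h => hyz (congrArg Subtype.val h))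
      (fun h => hzx (congrArg Subtype.val h)) ho
      (fun v h1 h2 h3 => hI v.1 (fun h => h1 (Subtype.ext h)) (fun h => h2 (Subtype.ext h)) (fun h => h3 (Subtype.ext h)))
    have hg2 : Gen (fun o => pos (e o)) :=
      ⟨fun u v h => hg.1 _ _ (fun h' => h (e.injective h')),
        fun u v w h1 h2 h3 => hg.2 _ _ _ (fun h' => h1 (e.injective h')) (fun h' => h2 (e.injective h')) (fun h' => h3 (e.injective h'))⟩
    obtain ⟨G2, F2, T2, h2, d2⟩ := start_step T1 (pos := fun o => pos (e o)) hg2 h1 d1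
      (hI a ha.1 ha.2.1 ha.2.2)
    have ex : e.symm x = some ⟨x, hx⟩ := Equiv.optionSubtypeNe_symm_of_ne _
    have ey : e.symm y = some ⟨y, hy⟩ := Equiv.optionSubtypeNe_symm_of_ne _
    have ez : e.symm z = some ⟨z, hz⟩ := Equiv.optionSubtypeNe_symm_of_ne _
    refine ⟨_, _, T2.map e.symm, ?_, ?_, ho, ?_⟩
    · beta_reduce; rw [ex, ey, ez]; exact h2
    · intro a b h
      by_contra hne
      exact hg.1 a b hne (by rw [h])
    · intro u v w hF hR
      have := d2.inner _ _ _ hF (by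
        rw [← ex, ← ey, ← ez]
        unfold Rot
        simpa [Rot] using hR)
      simpa using this

end IsTri


open SimpleGraph
open Filter Topology

def Cr (a b c d : ℝ × ℝ) : Prop := Dt a b c * Dt a b d < 0 ∧ Dt c d a * Dt c d b < 0

theorem Cr.symm {a b c d : ℝ × ℝ} (h : Cr a b c d) : Cr c d a b := ⟨h.2, h.1⟩
theorem Cr.swap {a b c d : ℝ × ℝ} (h : Cr a b c d) : Cr b a c d := by
  refine ⟨?_, ?_⟩
  · rw [Dt_swap, Dt_swap (p := a) (q := b) (r := d)]; linarith [h.1]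
  · linarith [h.2]
theorem Cr.swap' {a b c d : ℝ × ℝ} (h : Cr a b c d) : Cr a b d c := h.symm.swap.symm

theorem Cr.par {a b c d : ℝ × ℝ} (h : Cr a b c d) : ∃ s t : ℝ, 0 < s ∧ s < 1 ∧ 0 < t ∧ t < 1 ∧
    a.1 + s * (b.1 - a.1) = c.1 + t * (d.1 - c.1) ∧ a.2 + s * (b.2 - a.2) = c.2 + t * (d.2 - c.2) := by
  obtain ⟨h1, h2⟩ := h
  have frac : ∀ A B : ℝ, A * B < 0 → A - B ≠ 0 ∧ 0 < A / (A - B) ∧ A / (A - B) < 1 := by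
    intro A B h
    rcases mul_neg_iff.1 h with ⟨ha, hb⟩ | ⟨ha, hb⟩
    · have : 0 < A - B := by linarith
      exact ⟨this.ne', div_pos ha this, by rw [div_lt_one this]; linarith⟩
    · have : A - B < 0 := by linarith
      exact ⟨this.ne, div_pos_of_neg_of_neg ha this, by rw [div_lt_one_of_neg this]; linarith⟩
  obtain ⟨n1, p1, l1⟩ := frac _ _ h1
  obtain ⟨n2, p2, l2⟩ := frac _ _ h2
  refine ⟨_, _, p2, l2, p1, l1, ?_, ?_⟩
  · unfold Dt at *; field_simp; ring
  · unfold Dt at *; field_simp; ring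

theorem exit0 {v1 v2 u1 u2 w1 w2 f t : ℝ} (hv2 : 0 < v2) (hv1 : 0 ≤ v1) (hv : v1 + v2 ≤ 1)
    (f0 : 0 < f) (f1 : f < 1) (t0 : 0 < t) (t1 : t < 1)
    (e1 : 1 + f * (v1 - 1) = u1 + t * (w1 - u1)) (e2 : f * v2 = u2 + t * (w2 - u2))
    (hu : 0 < (v1 - 1) * u2 - v2 * (u1 - 1)) (hn : ¬ (0 < u2 ∧ 0 ≤ u1 ∧ u1 + u2 ≤ 1)) (hu0 : u2 ≠ 0)
    (hk : w2 * u1 - w1 * u2 ≠ 0)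
    (hps : ¬ (u1 * w1 < 0 ∧ (w2 * u1 - w1 * u2) * (w1 - u1 + w2 * u1 - w1 * u2) < 0)) :
    u2 * w2 < 0 ∧ (w2 * u1 - w1 * u2) * (w2 * u1 - w1 * u2 - w2 + u2) < 0 := by
  set m1 := u1 + t * (w1 - u1) with hm1
  set m2 := u2 + t * (w2 - u2) with hm2
  have M2 : 0 < m2 := by rw [← e2]; positivity
  have M2' : m2 < 1 := by rw [← e2]; nlinarith
  have M1 : 0 ≤ m1 := by rw [← e1]; nlinarith
  have M1' : 0 < m1 := by rw [← e1]; nlinarith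
  have M : m1 + m2 ≤ 1 := by rw [← e1, ← e2]; nlinarith
  have k1 : m2 * u1 - m1 * u2 = t * (w2 * u1 - w1 * u2) := by rw [hm1, hm2]; ring
  have k2 : m1 - u1 + m2 * u1 - m1 * u2 = t * (w1 - u1 + w2 * u1 - w1 * u2) := by rw [hm1, hm2]; ring
  have k3 : m2 * u1 - m1 * u2 - m2 + u2 = t * (w2 * u1 - w1 * u2 - w2 + u2) := by rw [hm1, hm2]; ring
  have k4 : m2 * u1 - m1 * u2 - m2 + u2 = - f * ((v1 - 1) * u2 - v2 * (u1 - 1)) := by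
    rw [← e1, ← e2]; ring
  have tw1 : t * w1 = m1 - (1 - t) * u1 := by rw [hm1]; ring
  have tw2 : t * w2 = m2 - (1 - t) * u2 := by rw [hm2]; ring
  clear_value m1 m2
  have psn : u1 < 0 → m2 * u1 - m1 * u2 < 0 → 0 < m1 - u1 + m2 * u1 - m1 * u2 → False := by
    intro a b c
    apply hps
    have w1p : 0 < w1 := by
      have : 0 < t * w1 := by rw [tw1]; nlinarith
      exact pos_of_mul_pos_right this t0.le
    refine ⟨mul_neg_of_neg_of_pos a w1p, mul_neg_of_neg_of_pos ?_ ?_⟩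
    · rw [k1] at b; exact neg_of_mul_neg_right b t0.le
    · rw [k2] at c; exact pos_of_mul_pos_right c t0.le
  rcases lt_or_gt_of_ne hu0 with hneg | hpos
  · have w2p : 0 < w2 := by
      have : 0 < t * w2 := by rw [tw2]; nlinarith
      exact pos_of_mul_pos_right this t0.le
    refine ⟨mul_neg_of_neg_of_pos hneg w2p, ?_⟩
    have c3 : w2 * u1 - w1 * u2 - w2 + u2 < 0 := by
      have : t * (w2 * u1 - w1 * u2 - w2 + u2) < 0 := by rw [← k3, k4]; nlinarith
      exact neg_of_mul_neg_right this t0.le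
    rcases lt_or_gt_of_ne hk with kn | kp
    · exfalso
      have kn' : m2 * u1 - m1 * u2 < 0 := by rw [k1]; exact mul_neg_of_pos_of_neg t0 kn
      have hu1 : u1 < 0 := by
        have : m2 * u1 < 0 := by nlinarith
        exact neg_of_mul_neg_right this M2.le
      exact psn hu1 kn' (by nlinarith)
    · exact mul_neg_of_pos_of_neg kp c3
  · exfalso
    have s1 : u1 + u2 < 1 := by
      by_contra hc
      push Not at hc
      nlinarith
    have hu1 : u1 < 0 := by
      by_contra hc
      push Not at hc
      exact hn ⟨hpos, hc, s1.le⟩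
    refine psn hu1 (by nlinarith) ?_
    nlinarith

theorem exit1 {p q s v u w : ℝ × ℝ} (hv2 : 0 < Dt p q v * Dt p q s) (hv1 : 0 ≤ Dt p v s * Dt p q s)
    (hv : 0 ≤ Dt v q s * Dt p q s) (hc : Cr q v u w) (hu : 0 < Dt q v u * Dt p q s)
    (hn : ¬ (0 < Dt p q u * Dt p q s ∧ 0 ≤ Dt p u s * Dt p q s ∧ 0 ≤ Dt u q s * Dt p q s))
    (hu0 : Dt p q u ≠ 0) (hk : Dt u w p ≠ 0) (hps : ¬ Cr p s u w) : Cr p q u w := by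
  obtain ⟨f, t, f0, f1, t0, t1, e1, e2⟩ := hc.par
  have hD : Dt p q s ≠ 0 := by intro h; rw [h] at hu; simp at hu
  set D := Dt p q s with hDd
  have D2 : 0 < D * D := mul_self_pos.2 hD
  have tr : ∀ a : ℝ, a * D = (a / D) * (D * D) := by intro a; field_simp
  have three : ∀ a, Dt p a s + Dt p q a + Dt a q s = D := by intro a; rw [hDd]; unfold Dt; ring
  have I : ∀ a b c, Dt a b c = D * ((Dt p b s / D - Dt p a s / D) * (Dt p q c / D - Dt p q a / D)
      - (Dt p q b / D - Dt p q a / D) * (Dt p c s / D - Dt p a s / D)) := by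
    intro a b c
    have : D * Dt a b c = (Dt p b s - Dt p a s) * (Dt p q c - Dt p q a) - (Dt p q b - Dt p q a) * (Dt p c s - Dt p a s) := by
      rw [hDd]; unfold Dt; ring
    field_simp
    linarith
  have th : ∀ a, Dt a q s = D * (1 - Dt p a s / D - Dt p q a / D) := by
    intro a; field_simp; linarith [three a]
  have q1 : Dt p q s / D = 1 := div_self hD
  have q2 : Dt p q q / D = 0 := by rw [Dt_self']; simp
  have q3 : Dt p s s / D = 0 := by rw [Dt_self']; simp
  have q4 : Dt p p s / D = 0 := by unfold Dt; simp
  have q5 : Dt p q p / D = 0 := by rw [Dt_self]; simp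
  have key := exit0 (v1 := Dt p v s / D) (v2 := Dt p q v / D) (u1 := Dt p u s / D) (u2 := Dt p q u / D)
    (w1 := Dt p w s / D) (w2 := Dt p q w / D) (f := f) (t := t) ?_ ?_ ?_ f0 f1 t0 t1 ?_ ?_ ?_ ?_ ?_ ?_ ?_
  · refine ⟨?_, ?_⟩
    · have := key.1
      have e : Dt p q u * Dt p q w = (Dt p q u / D * (Dt p q w / D)) * (D * D) := by field_simp
      rw [e]; exact mul_neg_of_neg_of_pos this D2
    · have := key.2
      rw [I u w p, I u w q, q1, q2, q4, q5]
      nlinarith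
  · rw [tr] at hv2; exact pos_of_mul_pos_left hv2 D2.le
  · rw [tr] at hv1; exact nonneg_of_mul_nonneg_left hv1 D2
  · rw [th] at hv
    have : 0 ≤ (1 - Dt p v s / D - Dt p q v / D) * (D * D) := by linarith
    have := nonneg_of_mul_nonneg_left this D2
    linarith
  · rw [← q1]; 
    have : Dt p q s + f * (Dt p v s - Dt p q s) = Dt p u s + t * (Dt p w s - Dt p u s) := by
      unfold Dt; linear_combination (s.2 - p.2) * e1 - (s.1 - p.1) * e2
    field_simp
    linarith
  · have : f * Dt p q v = Dt p q u + t * (Dt p q w - Dt p q u) := by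
      unfold Dt; linear_combination (q.1 - p.1) * e2 - (q.2 - p.2) * e1
    field_simp
    linarith
  · rw [I q v u, q1, q2] at hu
    have : 0 < ((Dt p v s / D - 1) * (Dt p q u / D) - Dt p q v / D * (Dt p u s / D - 1)) * (D * D) := by linarith
    exact pos_of_mul_pos_left this D2.le
  · rintro ⟨a, b, c⟩
    refine hn ⟨?_, ?_, ?_⟩
    · rw [tr]; positivity
    · rw [tr]; positivity
    · rw [th]
      have : 0 ≤ (1 - Dt p u s / D - Dt p q u / D) * (D * D) := mul_nonneg (by linarith) D2.le
      linarith
  · exact div_ne_zero hu0 hD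
  · intro h
    apply hk
    rw [I u w p, q4, q5]
    linear_combination D * h
  · rintro ⟨a, b⟩
    apply hps
    refine ⟨?_, ?_⟩
    · rw [I p s u, I p s w, q3, q4, q5, q1]
      nlinarith
    · rw [I u w p, I u w s, q1, q3, q4, q5]
      nlinarith

structure St {V : Type} [Fintype V] (G : SimpleGraph V) (F : V → V → V → Prop) (x y z : V) (pos : V → ℝ × ℝ) : Prop where
  tri : IsTri G F
  h0 : F x y z
  dr : Dr F x y z pos
  gen : Gen pos
  ins : ∀ v, v ≠ x → v ≠ y → v ≠ z → Ins (pos x) (pos z) (pos y) (pos v)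

namespace St
variable {V : Type} [Fintype V] {G : SimpleGraph V} {F : V → V → V → Prop} {x y z : V} {pos : V → ℝ × ℝ}

theorem hc (S : St G F x y z pos) : 2 ≤ Fintype.card V := by
  have := (S.tri.adj S.h0).ne
  exact Fintype.one_lt_card_iff.2 ⟨_, _, this⟩

theorem nc (S : St G F x y z pos) {u v r s : V} (h1 : G.Adj u v) (h2 : G.Adj r s) :
    ¬ Cr (pos u) (pos v) (pos r) (pos s) := by
  intro hc
  have hc' := hc
  obtain ⟨a, b, a0, a1, b0, b1, e1, e2⟩ := hc.par
  obtain ⟨c1, c2⟩ := hc'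
  have hne : s(u, v) ≠ s(r, s) := by
    intro h
    rcases Sym2.eq_iff.1 h with ⟨rfl, rfl⟩ | ⟨rfl, rfl⟩
    · rw [Dt_self] at c1; simp at c1
    · rw [Dt_self'] at c1; simp at c1
  have hp : (pos u + a • (pos v - pos u)) = (1 - a) • pos u + a • pos v := by module
  have hp' : (pos u + a • (pos v - pos u)) = (1 - b) • pos r + b • pos s := by
    ext
    · simp; linarith
    · simp; linarith
  have m1 : (pos u + a • (pos v - pos u)) ∈ segment ℝ (pos u) (pos v) :=
    ⟨1 - a, a, by linarith, a0.le, by ring, hp.symm⟩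
  have m2 : (pos u + a • (pos v - pos u)) ∈ segment ℝ (pos r) (pos s) :=
    ⟨1 - b, b, by linarith, b0.le, by ring, hp'.symm⟩
  have d0 : Dt (pos r) (pos s) (pos u + a • (pos v - pos u)) = 0 := by
    rw [hp', Dt_seg _ _ _ _ (by ring), Dt_self, Dt_self']; ring
  rcases S.tri.nocross S.h0 S.dr h1 h2 hne m1 m2 with h | h
  · rw [h] at d0; rw [d0] at c2; simp at c2
  · rw [h] at d0; rw [d0] at c2; simp at c2

theorem nosector (S : St G F x y z pos) {p r s w : V} (h : F p r s) (hR : ¬ Rot x y z p r s) (hw : G.Adj p w)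
    (h1 : 0 < Dt (pos p) (pos r) (pos w)) (h2 : 0 < Dt (pos p) (pos w) (pos s)) : False := by
  have n1 : w ≠ r := by rintro rfl; rw [Dt_self'] at h1; exact lt_irrefl _ h1
  have n2 : w ≠ s := by rintro rfl; rw [Dt_self'] at h2; exact lt_irrefl _ h2
  have h3 := S.gen.2 r s w (S.tri.adj2 h).ne n2.symm n1
  rcases lt_or_gt_of_ne h3 with h3 | h3
  · refine S.nc hw (S.tri.adj2 h) ⟨?_, ?_⟩
    · have : Dt (pos p) (pos w) (pos r) = - Dt (pos p) (pos r) (pos w) := by unfold Dt; ring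
      rw [this]; nlinarith
    · have := S.dr.inner _ _ _ h hR
      rw [Dt_rot]; nlinarith
  · refine S.tri.novert S.h0 S.dr h hR ⟨p, hw.symm⟩ ⟨h3, ?_, h1⟩
    rw [← Dt_rot]; exact h2

theorem toward (S : St G F x y z pos) {p q : V} (hpq : p ≠ q) (hna : ¬ G.Adj p q) :
    ∃ r s, F p r s ∧ ¬ Rot x y z p r s ∧ 0 < Dt (pos p) (pos r) (pos q) ∧ 0 < Dt (pos p) (pos q) (pos s) := by
  by_contra hno
  push Not at hno
  have gz : ∀ t, G.Adj p t → Dt (pos p) (pos t) (pos q) ≠ 0 := fun t ht =>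
    S.gen.2 _ _ _ ht.ne (by rintro rfl; exact hna ht) hpq.symm
  have sw : ∀ t, Dt (pos p) (pos q) (pos t) = - Dt (pos p) (pos t) (pos q) := by intro t; unfold Dt; ring
  have cl : ∀ r s, F p r s → ¬ Rot x y z p r s → 0 < Dt (pos p) (pos r) (pos q) → 0 < Dt (pos p) (pos s) (pos q) := by
    intro r s h hR hr
    have := hno r s h hR hr
    rw [sw] at this
    exact lt_of_le_of_ne (by linarith) (gz s (S.tri.adj3 h).symm).symm
  by_cases ho : ∃ b c, Rot x y z p b c
  · obtain ⟨b, c, hb⟩ := ho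
    have hF := S.tri.rot_of S.h0 hb
    have hF0 := S.h0
    have a1 := S.tri.adj hF0
    have a2 := S.tri.adj2 hF0
    have a3 := S.tri.adj3 hF0
    have hq : q ≠ x ∧ q ≠ y ∧ q ≠ z := by
      rcases hb with ⟨rfl, rfl, rfl⟩ | ⟨rfl, rfl, rfl⟩ | ⟨rfl, rfl, rfl⟩
      · exact ⟨hpq.symm, by rintro rfl; exact hna a1, by rintro rfl; exact hna a3.symm⟩
      · exact ⟨by rintro rfl; exact hna a1.symm, hpq.symm, by rintro rfl; exact hna a2⟩
      · exact ⟨by rintro rfl; exact hna a3, by rintro rfl; exact hna a2.symm, hpq.symm⟩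
    obtain ⟨i1, i2, i3⟩ := S.ins q hq.1 hq.2.1 hq.2.2
    have key : 0 < Dt (pos p) (pos c) (pos q) ∧ Dt (pos p) (pos b) (pos q) < 0 := by
      rcases hb with ⟨rfl, rfl, rfl⟩ | ⟨rfl, rfl, rfl⟩ | ⟨rfl, rfl, rfl⟩
      · exact ⟨i3, by rw [Dt_swap]; linarith⟩
      · exact ⟨i2, by rw [Dt_swap]; linarith⟩
      · exact ⟨i1, by rw [Dt_swap]; linarith⟩
    have := S.tri.link p (fun t => 0 < Dt (pos p) (pos t) (pos q)) (by
      intro r s h hr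
      by_cases hR : Rot x y z p r s
      · have : r = b := by
          have n1 := a1.ne
          have n2 := a2.ne
          have n3 := a3.ne
          rcases hb with ⟨rfl, rfl, rfl⟩ | ⟨rfl, rfl, rfl⟩ | ⟨rfl, rfl, rfl⟩ <;>
            rcases hR with ⟨h1, h2, h3⟩ | ⟨h1, h2, h3⟩ | ⟨h1, h2, h3⟩ <;>
            first | exact h2 | exact absurd h1 n1 | exact absurd h1 n2 | exact absurd h1 n3 | exact absurd h1.symm n1 | exact absurd h1.symm n2 | exact absurd h1.symm n3
        subst this
        linarith [key.2]
      · exact cl r s h hR hr) c b (S.tri.adj3 hF).symm (S.tri.adj hF) key.1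
    linarith [key.2]
  · have hin : ∀ r s, ¬ Rot x y z p r s := fun r s h => ho ⟨r, s, h⟩
    have same : ∀ r s, G.Adj p r → G.Adj p s → 0 < Dt (pos p) (pos r) (pos q) → 0 < Dt (pos p) (pos s) (pos q) :=
      fun r s hr hs h => S.tri.link p (fun t => 0 < Dt (pos p) (pos t) (pos q))
        (fun r s h h' => cl r s h (hin r s) h') r s hr hs h
    have pp : ∀ r s, G.Adj p r → G.Adj p s → 0 < Dt (pos p) (pos r) (pos q) * Dt (pos p) (pos s) (pos q) := by
      intro r s hr hs
      rcases lt_or_gt_of_ne (gz r hr) with h | h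
      · rcases lt_or_gt_of_ne (gz s hs) with h' | h'
        · exact mul_pos_of_neg_of_neg h h'
        · linarith [same s r hs hr h']
      · exact mul_pos h (same r s hr hs h)
    classical
    obtain ⟨r, hr, hmax⟩ := Finset.exists_max_image (Finset.univ.filter fun t => G.Adj p t)
      (fun t => (((pos t).1 - (pos p).1) * ((pos q).1 - (pos p).1) + ((pos t).2 - (pos p).2) * ((pos q).2 - (pos p).2)) / Dt (pos p) (pos t) (pos q))
      (by obtain ⟨w, hw⟩ := S.tri.exnb S.hc p; exact ⟨w, by simpa using hw⟩)
    have hr : G.Adj p r := by simpa using hr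
    obtain ⟨s, hs⟩ := S.tri.ex hr
    have hs' := (S.tri.adj3 hs).symm
    have hm := hmax s (by simpa using hs')
    have dp := S.dr.inner _ _ _ hs (hin _ _)
    have hpp := pp r s hr hs'
    have nr := gz r hr
    have ns := gz s hs'
    have qn : 0 < ((pos q).1 - (pos p).1) ^ 2 := by
      have := sub_ne_zero.2 (S.gen.1 q p hpq.symm)
      positivity
    rw [← sub_nonneg] at hm
    have id : (((pos r).1 - (pos p).1) * ((pos q).1 - (pos p).1) + ((pos r).2 - (pos p).2) * ((pos q).2 - (pos p).2)) / Dt (pos p) (pos r) (pos q) -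
       (((pos s).1 - (pos p).1) * ((pos q).1 - (pos p).1) + ((pos s).2 - (pos p).2) * ((pos q).2 - (pos p).2)) / Dt (pos p) (pos s) (pos q)
       = - ((((pos q).1 - (pos p).1) ^ 2 + ((pos q).2 - (pos p).2) ^ 2) * Dt (pos p) (pos r) (pos s)) / (Dt (pos p) (pos r) (pos q) * Dt (pos p) (pos s) (pos q)) := by
      rw [div_sub_div _ _ nr ns]
      congr 1
      unfold Dt; ring
    rw [id] at hm
    have : - ((((pos q).1 - (pos p).1) ^ 2 + ((pos q).2 - (pos p).2) ^ 2) * Dt (pos p) (pos r) (pos s)) / (Dt (pos p) (pos r) (pos q) * Dt (pos p) (pos s) (pos q)) < 0 := by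
      apply div_neg_of_neg_of_pos _ hpp
      have : 0 < (((pos q).1 - (pos p).1) ^ 2 + ((pos q).2 - (pos p).2) ^ 2) := by positivity
      have := mul_pos this dp
      linarith
    linarith

end St


open SimpleGraph
open Filter Topology

theorem sec {p q v w : ℝ × ℝ} (c : 0 < Dt p q v) (h : Cr q v p w) : 0 < Dt p w v ∧ 0 < Dt p q w := by
  obtain ⟨h1, h2⟩ := h
  have e1 : Dt q v p = Dt p q v := Dt_rot _ _ _
  have e2 : Dt p w q = - Dt p q w := by unfold Dt; ring
  have e3 : Dt p q w + Dt q v w + Dt p w v = Dt p q v := by unfold Dt; ring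
  rw [e1] at h1
  have h1 := neg_of_mul_neg_right h1 c.le
  rw [e2] at h2
  have h2 : 0 < Dt p q w * Dt p w v := by linarith
  rcases mul_pos_iff.1 h2 with ⟨a, b⟩ | ⟨a, b⟩
  · exact ⟨b, a⟩
  · linarith

theorem sec' {p q v w : ℝ × ℝ} (c : Dt p q v < 0) (h : Cr q v p w) : Dt p w v < 0 ∧ Dt p q w < 0 := by
  obtain ⟨h1, h2⟩ := h
  have e1 : Dt q v p = Dt p q v := Dt_rot _ _ _
  have e2 : Dt p w q = - Dt p q w := by unfold Dt; ring
  have e3 : Dt p q w + Dt q v w + Dt p w v = Dt p q v := by unfold Dt; ring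
  rw [e1] at h1
  have h1 := pos_of_mul_neg_right h1 c.le
  rw [e2] at h2
  have h2 : 0 < Dt p q w * Dt p w v := by linarith
  rcases mul_pos_iff.1 h2 with ⟨a, b⟩ | ⟨a, b⟩
  · linarith
  · exact ⟨b, a⟩

/-- u = affine in p,q,v -/
theorem Dt_pl (p q v a b : ℝ × ℝ) : Dt p q v * Dt p a b = Dt p a q * Dt p b v + Dt p q b * Dt p a v := by
  unfold Dt; ring

open Classical in
noncomputable def xs {V : Type} [Fintype V] (G : SimpleGraph V) (pos : V → ℝ × ℝ) (p q : V) : ℕ :=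
  (Finset.univ.filter fun e : V × V => G.Adj e.1 e.2 ∧ Cr (pos p) (pos q) (pos e.1) (pos e.2)).card

def Res {V : Type} [Fintype V] (G : SimpleGraph V) (x y z : V) (pos : V → ℝ × ℝ) (p q : V) : Prop :=
  ∃ (G' : SimpleGraph V) (F' : V → V → V → Prop), St G' F' x y z pos ∧ G'.Adj p q ∧
    ∀ u v, G.Adj u v → ¬ Cr (pos p) (pos q) (pos u) (pos v) → G'.Adj u v

namespace St
variable {V : Type} [Fintype V] {G : SimpleGraph V} {F : V → V → V → Prop} {x y z : V} {pos : V → ℝ × ℝ}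

theorem ecard (S : St G F x y z pos) {G' : SimpleGraph V} {F' : V → V → V → Prop} (S' : St G' F' x y z pos) :
    IsTri.ec G = IsTri.ec G' := by
  have h3 : 3 ≤ Fintype.card V := by
    classical
    have : ({x, y, z} : Finset V).card = 3 :=
      Finset.card_eq_three.2 ⟨x, y, z, (S.tri.adj S.h0).ne, (S.tri.adj3 S.h0).ne.symm, (S.tri.adj2 S.h0).ne, rfl⟩
    rw [← this]; exact Finset.card_le_univ _
  obtain ⟨n, hn⟩ := Nat.exists_eq_add_of_le' h3
  rw [IsTri.ec_eq n S.tri hn, IsTri.ec_eq n S'.tri hn]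

theorem reduce (S : St G F x y z pos) {p q a b : V} (hpq : p ≠ q) (hab : a ≠ b)
    (ih : ∀ (G' : SimpleGraph V) (F' : V → V → V → Prop), St G' F' x y z pos → ∀ p' q', p' ≠ q' →
      xs G' pos p' q' < xs G pos p q → Res G' x y z pos p' q')
    (hna : ¬ G.Adj a b) (hc : ¬ Cr (pos p) (pos q) (pos a) (pos b))
    (hsub : ∀ u v, G.Adj u v → Cr (pos a) (pos b) (pos u) (pos v) → Cr (pos p) (pos q) (pos u) (pos v))
    (hst : ∃ u v, G.Adj u v ∧ Cr (pos p) (pos q) (pos u) (pos v) ∧ ¬ Cr (pos a) (pos b) (pos u) (pos v)) : Res G x y z pos p q := by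
  classical
  obtain ⟨G1, F1, S1, a1, k1⟩ := ih G F S a b hab (by
    unfold xs
    apply Finset.card_lt_card
    rw [Finset.ssubset_iff_of_subset]
    · obtain ⟨u, v, h1, h2, h3⟩ := hst
      exact ⟨(u, v), by simpa using ⟨h1, h2⟩, by simp only [Finset.mem_filter, Finset.mem_univ, true_and]; exact fun h => h3 h.2⟩
    · intro e
      simp only [Finset.mem_filter, Finset.mem_univ, true_and]
      exact fun h => ⟨h.1, hsub _ _ h.1 h.2⟩)
  have cnt : ∀ H : SimpleGraph V, IsTri.ec H = ((xs H pos p q : ℕ) : ℤ) +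
      ((Finset.univ.filter fun e : V × V => H.Adj e.1 e.2 ∧ ¬ Cr (pos p) (pos q) (pos e.1) (pos e.2)).card : ℤ) := by
    intro H
    unfold xs IsTri.ec
    rw [← Fintype.sum_prod_type' (f := fun u v => if H.Adj u v then (1 : ℤ) else 0), Finset.card_filter, Finset.card_filter]
    push_cast
    rw [← Finset.sum_add_distrib]
    refine Finset.sum_congr rfl fun e _ => ?_
    by_cases h1 : H.Adj e.1 e.2 <;> by_cases h2 : Cr (pos p) (pos q) (pos e.1) (pos e.2) <;> simp [h1, h2]
  have lt : xs G1 pos p q < xs G pos p q := by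
    have e := S.ecard S1
    rw [cnt, cnt] at e
    have : (Finset.univ.filter fun e : V × V => G.Adj e.1 e.2 ∧ ¬ Cr (pos p) (pos q) (pos e.1) (pos e.2)).card <
       (Finset.univ.filter fun e : V × V => G1.Adj e.1 e.2 ∧ ¬ Cr (pos p) (pos q) (pos e.1) (pos e.2)).card := by
      apply Finset.card_lt_card
      rw [Finset.ssubset_iff_of_subset]
      · exact ⟨(a, b), by simpa using ⟨a1, hc⟩, by simp only [Finset.mem_filter, Finset.mem_univ, true_and]; exact fun h => hna h.1⟩
      · intro e
        simp only [Finset.mem_filter, Finset.mem_univ, true_and]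
        exact fun h => ⟨k1 _ _ h.1 (fun h' => h.2 (hsub _ _ h.1 h')), h.2⟩
    omega
  obtain ⟨G2, F2, S2, a2, k2⟩ := ih G1 F1 S1 p q hpq lt
  exact ⟨G2, F2, S2, a2, fun u v h h' => k2 _ _ (k1 _ _ h (fun h2 => h' (hsub _ _ h h2))) h'⟩

/-- the base of the first triangle toward q crosses pq -/
theorem tc (S : St G F x y z pos) {p q r s : V} (hpq : p ≠ q) (hna : ¬ G.Adj p q) (h : F p r s)
    (hR : ¬ Rot x y z p r s) (h1 : 0 < Dt (pos p) (pos r) (pos q)) (h2 : 0 < Dt (pos p) (pos q) (pos s)) : Dt (pos r) (pos s) (pos q) < 0 ∧ Cr (pos p) (pos q) (pos r) (pos s) := by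
  have nr : r ≠ q := by rintro rfl; exact hna (S.tri.adj h)
  have ns : s ≠ q := by rintro rfl; exact hna (S.tri.adj3 h).symm
  have h3 : Dt (pos r) (pos s) (pos q) < 0 := by
    rcases lt_or_gt_of_ne (S.gen.2 r s q (S.tri.adj2 h).ne ns nr.symm) with h3 | h3
    · exact h3
    · exact (S.tri.novert S.h0 S.dr h hR (S.tri.exnb S.hc q) ⟨h3, by rw [← Dt_rot]; exact h2, h1⟩).elim
  refine ⟨h3, ?_, ?_⟩
  · have : Dt (pos p) (pos q) (pos r) = - Dt (pos p) (pos r) (pos q) := by unfold Dt; ring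
    rw [this]; nlinarith
  · have := S.dr.inner _ _ _ h hR
    rw [Dt_rot]; nlinarith

theorem flipcase (S : St G F x y z pos) {p q r s : V} (hpq : p ≠ q) (hna : ¬ G.Adj p q) (h : F p r s)
    (hR : ¬ Rot x y z p r s) (h' : F q s r) (hR' : ¬ Rot x y z q s r)
    (h1 : 0 < Dt (pos p) (pos r) (pos q)) (h2 : 0 < Dt (pos p) (pos q) (pos s)) : Res G x y z pos p q := by
  have hc := (S.tc hpq hna h hR h1 h2).2
  have f1 : F r s p := S.tri.rot h
  have f2 : F s r q := S.tri.rot h'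
  refine ⟨IsTri.flipG G r s p q, flipF F r s p q, ⟨S.tri.flip' f1 f2 hpq hna, ?_, ?_, S.gen, S.ins⟩, ?_, ?_⟩
  · exact Or.inl ⟨S.h0, fun k => hR k.symm.rot', fun k => hR' k.symm.rot'⟩
  · refine ⟨S.dr.inj, S.dr.outer, ?_⟩
    rintro u v w (⟨k, -, -⟩ | k | k) hk
    · exact S.dr.inner _ _ _ k hk
    · rcases k with ⟨rfl, rfl, rfl⟩ | ⟨rfl, rfl, rfl⟩ | ⟨rfl, rfl, rfl⟩
      · exact h1
      · rw [Dt_rot]; exact h1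
      · rw [Dt_rot, Dt_rot]; exact h1
    · rcases k with ⟨rfl, rfl, rfl⟩ | ⟨rfl, rfl, rfl⟩ | ⟨rfl, rfl, rfl⟩
      · rw [Dt_rot]; exact h2
      · rw [Dt_rot, Dt_rot]; exact h2
      · exact h2
  · rw [IsTri.flipG_adj hpq]; simp
  · intro u v k k'
    rw [IsTri.flipG_adj hpq]
    refine Or.inl ⟨k, ?_, ?_⟩
    · rintro ⟨rfl, rfl⟩; exact k' hc
    · rintro ⟨rfl, rfl⟩; exact k' hc.swap'

theorem side (S : St G F x y z pos) {p q r s r2 s2 : V} (hpq : p ≠ q)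
    (ih : ∀ (G' : SimpleGraph V) (F' : V → V → V → Prop), St G' F' x y z pos → ∀ p' q', p' ≠ q' →
      xs G' pos p' q' < xs G pos p q → Res G' x y z pos p' q')
    (hna : ¬ G.Adj p q) (h : F p r s) (hR : ¬ Rot x y z p r s) (h1 : 0 < Dt (pos p) (pos r) (pos q)) (h2 : 0 < Dt (pos p) (pos q) (pos s))
    (h' : F q r2 s2) (hR' : ¬ Rot x y z q r2 s2) (h1' : 0 < Dt (pos q) (pos r2) (pos p)) (h2' : 0 < Dt (pos q) (pos p) (pos s2))
    (hne : s ≠ r2) : Res G x y z pos p q := by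
  classical
  have prs := S.dr.inner _ _ _ h hR
  have qrs := S.dr.inner _ _ _ h' hR'
  obtain ⟨tn, tx⟩ := S.tc hpq hna h hR h1 h2
  obtain ⟨tn', tx'⟩ := S.tc hpq.symm (fun k => hna k.symm) h' hR' h1' h2'
  have aps : G.Adj p s := (S.tri.adj3 h).symm
  obtain ⟨v, hv, hmax⟩ := Finset.exists_max_image
    (Finset.univ.filter fun v => 0 < Dt (pos p) (pos q) (pos v) ∧ 0 ≤ Dt (pos p) (pos v) (pos s) ∧ 0 ≤ Dt (pos v) (pos q) (pos s))
    (fun v => Dt (pos v) (pos q) (pos s) / Dt (pos p) (pos q) (pos v)) ⟨s, by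
      simp only [Finset.mem_filter, Finset.mem_univ, true_and, Dt_self, Dt_self', le_refl, and_true]; exact h2⟩
  simp only [Finset.mem_filter, Finset.mem_univ, true_and] at hv hmax
  obtain ⟨v0, v1, v2⟩ := hv
  have star : ∀ u, 0 < Dt (pos p) (pos q) (pos u) → 0 ≤ Dt (pos p) (pos u) (pos s) → 0 ≤ Dt (pos u) (pos q) (pos s) → Dt (pos q) (pos v) (pos u) ≤ 0 := by
    intro u u0 u1 u2
    have := hmax u ⟨u0, u1, u2⟩
    rw [div_le_div_iff₀ u0 v0] at this
    have e : Dt (pos q) (pos v) (pos u) * Dt (pos p) (pos q) (pos s) = Dt (pos u) (pos q) (pos s) * Dt (pos p) (pos q) (pos v) - Dt (pos v) (pos q) (pos s) * Dt (pos p) (pos q) (pos u) := by unfold Dt; ring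
    by_contra hc
    push Not at hc
    have := mul_pos hc h2
    linarith
  clear hmax
  have nvq : v ≠ q := by rintro rfl; rw [Dt_self'] at v0; exact lt_irrefl _ v0
  have nvp : v ≠ p := by rintro rfl; rw [Dt_self] at v0; exact lt_irrefl _ v0
  have prv : 0 < Dt (pos p) (pos r) (pos v) := by
    have e : Dt (pos p) (pos q) (pos s) * Dt (pos p) (pos r) (pos v) = Dt (pos p) (pos v) (pos s) * Dt (pos p) (pos r) (pos q) + Dt (pos p) (pos q) (pos v) * Dt (pos p) (pos r) (pos s) := by unfold Dt; ring
    have : 0 < Dt (pos p) (pos q) (pos s) * Dt (pos p) (pos r) (pos v) := by rw [e]; nlinarith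
    exact pos_of_mul_pos_right this h2.le
  have E1 : ∀ u w, G.Adj u w → 0 < Dt (pos q) (pos v) (pos u) → Cr (pos q) (pos v) (pos u) (pos w) → Cr (pos p) (pos q) (pos u) (pos w) := by
    intro u w huw hu hc
    have hw : Dt (pos q) (pos v) (pos w) < 0 := neg_of_mul_neg_right hc.1 hu.le
    by_cases hup : u = p
    · subst hup
      exfalso
      obtain ⟨c1, c2⟩ := sec v0 hc
      refine S.nosector h hR huw ?_ ?_
      · have e : Dt (pos u) (pos q) (pos v) * Dt (pos u) (pos r) (pos w) = Dt (pos u) (pos w) (pos v) * Dt (pos u) (pos r) (pos q) + Dt (pos u) (pos q) (pos w) * Dt (pos u) (pos r) (pos v) := by unfold Dt; ring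
        have : 0 < Dt (pos u) (pos q) (pos v) * Dt (pos u) (pos r) (pos w) := by rw [e]; positivity
        exact pos_of_mul_pos_right this v0.le
      · have e : Dt (pos u) (pos q) (pos v) * Dt (pos u) (pos w) (pos s) = Dt (pos u) (pos w) (pos v) * Dt (pos u) (pos q) (pos s) + Dt (pos u) (pos q) (pos w) * Dt (pos u) (pos v) (pos s) := by unfold Dt; ring
        have : 0 < Dt (pos u) (pos q) (pos v) * Dt (pos u) (pos w) (pos s) := by rw [e]; nlinarith
        exact pos_of_mul_pos_right this v0.le
    · have nuq : u ≠ q := by rintro rfl; rw [Dt_self] at hu; exact lt_irrefl _ hu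
      have nwp : w ≠ p := by rintro rfl; rw [Dt_rot] at hw; linarith
      refine exit1 (s := pos s) (v := pos v) (by positivity) (by positivity) (by positivity) hc (by positivity) ?_
        (S.gen.2 _ _ _ hpq nuq.symm hup) (S.gen.2 _ _ _ huw.ne nwp (Ne.symm hup)) (S.nc aps huw)
      rintro ⟨a, b, c⟩
      have := star u (pos_of_mul_pos_left a h2.le) (nonneg_of_mul_nonneg_left b h2) (nonneg_of_mul_nonneg_left c h2)
      linarith
  have E1' : ∀ u w, G.Adj u w → Cr (pos q) (pos v) (pos u) (pos w) → Cr (pos p) (pos q) (pos u) (pos w) := by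
    intro u w huw hc
    rcases mul_neg_iff.1 hc.1 with ⟨a, b⟩ | ⟨a, b⟩
    · exact E1 u w huw a hc
    · exact (E1 w u huw.symm b hc.swap').swap'
  by_cases hqv : G.Adj q v
  · -- v = r2
    have hvr : v = r2 := by
      by_contra hvr
      rcases lt_or_gt_of_ne (S.gen.2 q r2 v (S.tri.adj h').ne (Ne.symm hvr) nvq) with k | k
      · have e0 : Dt (pos q) (pos v) (pos r2) = - Dt (pos q) (pos r2) (pos v) := by unfold Dt; ring
        have k' : 0 < Dt (pos q) (pos v) (pos r2) := by linarith
        have er : Dt (pos p) (pos q) (pos r2) = Dt (pos q) (pos r2) (pos p) := by unfold Dt; ring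
        have ev : Dt (pos q) (pos v) (pos p) = Dt (pos p) (pos q) (pos v) := by unfold Dt; ring
        have c1 : 0 < Dt (pos r2) (pos q) (pos s) := by
          have e : Dt (pos r2) (pos q) (pos s) * Dt (pos p) (pos q) (pos v) = Dt (pos p) (pos q) (pos s) * Dt (pos q) (pos v) (pos r2) + Dt (pos v) (pos q) (pos s) * Dt (pos q) (pos r2) (pos p) := by unfold Dt; ring
          have : 0 < Dt (pos r2) (pos q) (pos s) * Dt (pos p) (pos q) (pos v) := by rw [e]; nlinarith
          exact pos_of_mul_pos_left this v0.le
        have c2 : Dt (pos p) (pos r2) (pos s) < 0 := by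
          by_contra hc
          push Not at hc
          have := star r2 (by rw [er]; exact h1') hc c1.le
          linarith
        refine S.nc (S.tri.adj h') aps ⟨?_, ?_⟩
        · have e : Dt (pos q) (pos r2) (pos s) = - Dt (pos r2) (pos q) (pos s) := by unfold Dt; ring
          rw [e]; nlinarith
        · have e : Dt (pos p) (pos s) (pos q) = - Dt (pos p) (pos q) (pos s) := by unfold Dt; ring
          have e' : Dt (pos p) (pos s) (pos r2) = - Dt (pos p) (pos r2) (pos s) := by unfold Dt; ring
          rw [e, e']; nlinarith
      · refine S.nosector h' hR' hqv k ?_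
        have e : Dt (pos q) (pos r2) (pos p) * Dt (pos q) (pos v) (pos s2) = Dt (pos p) (pos q) (pos v) * Dt (pos q) (pos r2) (pos s2) + Dt (pos q) (pos r2) (pos v) * Dt (pos q) (pos p) (pos s2) := by unfold Dt; ring
        have : 0 < Dt (pos q) (pos r2) (pos p) * Dt (pos q) (pos v) (pos s2) := by rw [e]; positivity
        exact pos_of_mul_pos_right this h1'.le
    subst hvr
    have pvs : 0 < Dt (pos p) (pos v) (pos s) := lt_of_le_of_ne v1 (S.gen.2 _ _ _ nvp.symm hne.symm aps.ne.symm).symm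
    have hpv : ¬ G.Adj p v := fun k => S.nosector h hR k prv pvs
    have nq : Dt (pos q) (pos p) (pos v) < 0 := by rw [Dt_swap]; linarith
    have G1 : ∀ u w, G.Adj u w → Dt (pos p) (pos v) (pos u) < 0 → Cr (pos p) (pos v) (pos u) (pos w) → Cr (pos p) (pos q) (pos u) (pos w) := by
      intro u w huw hu hc
      have hw : 0 < Dt (pos p) (pos v) (pos w) := pos_of_mul_neg_right hc.1 hu.le
      by_cases huq : u = q
      · subst huq
        exfalso
        obtain ⟨c1, c2⟩ := sec' nq hc
        refine S.nosector h' hR' huw ?_ ?_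
        · have e : Dt (pos u) (pos v) (pos w) = - Dt (pos u) (pos w) (pos v) := by unfold Dt; ring
          linarith
        · have e : Dt (pos p) (pos u) (pos v) * Dt (pos u) (pos w) (pos s2) = (-Dt (pos u) (pos w) (pos v)) * Dt (pos u) (pos p) (pos s2) + (-Dt (pos u) (pos p) (pos w)) * Dt (pos u) (pos v) (pos s2) := by unfold Dt; ring
          have : 0 < Dt (pos p) (pos u) (pos v) * Dt (pos u) (pos w) (pos s2) := by
            rw [e]
            have a1 := mul_pos (neg_pos.2 c1) h2'
            have a2 := mul_pos (neg_pos.2 c2) qrs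
            linarith
          exact pos_of_mul_pos_right this v0.le
      · have nup : u ≠ p := by rintro rfl; rw [Dt_self] at hu; exact lt_irrefl _ hu
        have nuv : u ≠ v := by rintro rfl; rw [Dt_self'] at hu; exact lt_irrefl _ hu
        have nwq : w ≠ q := by
          rintro rfl
          have e : Dt (pos p) (pos v) (pos w) = - Dt (pos p) (pos w) (pos v) := by unfold Dt; ring
          linarith
        refine Cr.swap (exit1 (s := pos v) (v := pos v) (by nlinarith) (by rw [Dt_self']; simp) (by rw [Dt_self]; simp) hc (by nlinarith) ?_
          (S.gen.2 _ _ _ hpq.symm nup.symm huq) (S.gen.2 _ _ _ huw.ne nwq (Ne.symm huq)) (S.nc hqv huw))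
        rintro ⟨a, b, c⟩
        have a' : 0 < Dt (pos p) (pos q) (pos u) := by
          rw [Dt_swap (p := pos p) (q := pos q) (r := pos u)] at a
          by_contra hcon
          nlinarith
        have b' : 0 ≤ Dt (pos u) (pos q) (pos v) := by
          rw [Dt_swap (p := pos u) (q := pos q) (r := pos v)] at b
          by_contra hcon
          nlinarith
        have c' : 0 ≤ Dt (pos p) (pos u) (pos v) := by
          rw [Dt_swap (p := pos p) (q := pos u) (r := pos v)] at c
          by_contra hcon
          nlinarith
        have d1 : 0 ≤ Dt (pos p) (pos u) (pos s) := by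
          have e : Dt (pos p) (pos q) (pos v) * Dt (pos p) (pos u) (pos s) = Dt (pos p) (pos u) (pos v) * Dt (pos p) (pos q) (pos s) + Dt (pos p) (pos q) (pos u) * Dt (pos p) (pos v) (pos s) := by unfold Dt; ring
          have : 0 ≤ Dt (pos p) (pos q) (pos v) * Dt (pos p) (pos u) (pos s) := by rw [e]; positivity
          exact nonneg_of_mul_nonneg_right this v0
        have d2 : 0 ≤ Dt (pos u) (pos q) (pos s) := by
          have e : Dt (pos p) (pos q) (pos v) * Dt (pos u) (pos q) (pos s) = Dt (pos u) (pos q) (pos v) * Dt (pos p) (pos q) (pos s) + Dt (pos p) (pos q) (pos u) * Dt (pos v) (pos q) (pos s) := by unfold Dt; ring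
          have : 0 ≤ Dt (pos p) (pos q) (pos v) * Dt (pos u) (pos q) (pos s) := by rw [e]; positivity
          exact nonneg_of_mul_nonneg_right this v0
        have := star u a' d1 d2
        have e : Dt (pos q) (pos v) (pos u) = Dt (pos u) (pos q) (pos v) := by unfold Dt; ring
        exact S.gen.2 q v u nvq.symm nuv.symm huq (by linarith)
    refine S.reduce hpq nvp.symm ih hpv ?_ ?_ ?_
    · intro k; have := k.1; rw [Dt_self] at this; simp at this
    · intro u w huw hc
      rcases mul_neg_iff.1 hc.1 with ⟨a, b⟩ | ⟨a, b⟩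
      · exact (G1 w u huw.symm b hc.swap').swap'
      · exact G1 u w huw a hc
    · refine ⟨v, s2, S.tri.adj2 h', tx'.swap, ?_⟩
      intro k; have := k.1; rw [Dt_self'] at this; simp at this
  · refine S.reduce hpq nvq.symm ih hqv ?_ E1' ?_
    · intro k; have := k.1; rw [Dt_self'] at this; simp at this
    · refine ⟨r, s, S.tri.adj2 h, tx, ?_⟩
      intro k
      by_cases hvs : v = s
      · subst hvs; have := k.1; rw [Dt_self'] at this; simp at this
      · have pvs : 0 < Dt (pos p) (pos v) (pos s) := lt_of_le_of_ne v1 (S.gen.2 _ _ _ nvp.symm hvs aps.ne.symm).symm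
        have : 0 < Dt (pos r) (pos s) (pos v) := pos_of_mul_neg_right k.2 tn.le
        exact S.tri.novert S.h0 S.dr h hR (S.tri.exnb S.hc v) ⟨this, by rw [← Dt_rot]; exact pvs, prv⟩

theorem insert : ∀ (n : ℕ) (G : SimpleGraph V) (F : V → V → V → Prop), St G F x y z pos → ∀ p q, p ≠ q →
    xs G pos p q ≤ n → Res G x y z pos p q := by
  intro n
  induction n using Nat.strong_induction_on with
  | _ n ih =>
    intro G F S p q hpq hn
    by_cases hna : G.Adj p q
    · exact ⟨G, F, S, hna, fun u v h _ => h⟩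
    obtain ⟨r, s, f1, r1, a1, b1⟩ := S.toward hpq hna
    obtain ⟨r2, s2, f2, r2', a2, b2⟩ := S.toward hpq.symm (fun k => hna k.symm)
    have ih' : ∀ (G' : SimpleGraph V) (F' : V → V → V → Prop), St G' F' x y z pos → ∀ p' q', p' ≠ q' →
      xs G' pos p' q' < xs G pos p q → Res G' x y z pos p' q' :=
      fun G' F' S' p' q' h' hlt => ih (xs G' pos p' q') (by omega) G' F' S' p' q' h' le_rfl
    by_cases e1 : s = r2
    · by_cases e2 : s2 = r
      · subst e1 e2
        exact S.flipcase hpq hna f1 r1 f2 r2' a1 b1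
      · have hx : xs G pos q p = xs G pos p q := by
          classical
          unfold xs
          congr 1
          ext e
          simp only [Finset.mem_filter, Finset.mem_univ, true_and]
          exact ⟨fun h => ⟨h.1, h.2.swap⟩, fun h => ⟨h.1, h.2.swap⟩⟩
        obtain ⟨G', F', S', k1, k2⟩ := S.side hpq.symm (by rw [hx]; exact ih') (fun k => hna k.symm) f2 r2' a2 b2 f1 r1 a1 b1 e2
        exact ⟨G', F', S', k1.symm, fun u v h h' => k2 u v h (fun k => h' k.swap)⟩
    · exact S.side hpq ih' hna f1 r1 a1 b1 f2 r2' a2 b2 e1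

end St


open SimpleGraph
open Filter Topology

theorem perturb {V : Type} [Fintype V] {G : SimpleGraph V} (hp : IsPlanar G) :
    ∃ pos : Option (Option (Option V)) → ℝ × ℝ, Gen pos ∧
      0 < Dt (pos none) (pos (some (some none))) (pos (some none)) ∧
      (∀ v, v ≠ none → v ≠ some none → v ≠ some (some none) →
        Ins (pos none) (pos (some (some none))) (pos (some none)) (pos v)) ∧
      ∀ u v r s, G.Adj u v → G.Adj r s →
        ¬ Cr (pos (some (some (some u)))) (pos (some (some (some v)))) (pos (some (some (some r)))) (pos (some (some (some s)))) := by
  classical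
  obtain ⟨po, inj, hpl⟩ := hp
  obtain ⟨R, hR⟩ : ∃ R : ℝ, 0 < R ∧ ∀ v, |(po v).1| < R ∧ |(po v).2| < R := by
    refine ⟨1 + ∑ v, (|(po v).1| + |(po v).2|), by positivity, fun v => ?_⟩
    have := Finset.single_le_sum (f := fun v => |(po v).1| + |(po v).2|) (fun v _ => by positivity) (Finset.mem_univ v)
    have a1 := abs_nonneg (po v).1
    have a2 := abs_nonneg (po v).2
    constructor <;> linarith
  obtain ⟨R0, hR⟩ := hR
  let b : Option (Option (Option V)) → ℝ × ℝ := fun w => match w with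
    | none => (-4 * R, -R)
    | some none => (0, 4 * R)
    | some (some none) => (4 * R, -R)
    | some (some (some v)) => po v
  let k : Option (Option (Option V)) → ℝ := fun w => ((Fintype.equivFin _ w : ℕ) : ℝ)
  have kinj : ∀ u v, u ≠ v → k u - k v ≠ 0 := by
    intro u v h h'
    apply h
    have : k u = k v := by linarith
    simp only [k, Nat.cast_inj, Fin.val_inj] at this
    exact (Fintype.equivFin _).injective this
  let P : ℝ → Option (Option (Option V)) → ℝ × ℝ := fun e w => ((b w).1 + e * k w, (b w).2 + e * (k w) ^ 2)
  have Pc : ∀ w, Continuous fun e => P e w := by intro w; simp only [P]; fun_prop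
  have P0 : ∀ w, P 0 w = b w := by intro w; simp [P]
  have pos_ev : ∀ u v w, 0 < Dt (b u) (b v) (b w) → ∀ᶠ e in 𝓝[>] (0 : ℝ), 0 < Dt (P e u) (P e v) (P e w) := by
    intro u v w h
    have hc : Continuous fun e => Dt (P e u) (P e v) (P e w) := by
      have := Pc u; have := Pc v; have := Pc w; unfold Dt; fun_prop
    have := hc.tendsto 0
    rw [P0, P0, P0] at this
    exact (this.eventually_const_lt h).filter_mono nhdsWithin_le_nhds
  have c1 : ∀ᶠ e in 𝓝[>] (0 : ℝ), ∀ u v, u ≠ v → (P e u).1 ≠ (P e v).1 := by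
    rw [eventually_all]; intro u
    rw [eventually_all]; intro v
    by_cases h : u = v
    · exact Eventually.of_forall fun e h' => (h' h).elim
    · filter_upwards [ev_quad (α := (b u).1 - (b v).1) (β := k u - k v) (γ := 0) (Or.inr (Or.inl (kinj u v h)))] with e he _ h'
      apply he
      simp only [P] at h'
      linear_combination h'
  have c2 : ∀ᶠ e in 𝓝[>] (0 : ℝ), ∀ u v w, u ≠ v → v ≠ w → w ≠ u → Dt (P e u) (P e v) (P e w) ≠ 0 := by
    rw [eventually_all]; intro u
    rw [eventually_all]; intro v
    rw [eventually_all]; intro w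
    by_cases h : u ≠ v ∧ v ≠ w ∧ w ≠ u
    · obtain ⟨h1, h2, h3⟩ := h
      filter_upwards [ev_quad (α := Dt (b u) (b v) (b w))
        (β := (k v - k u) * ((b w).2 - (b u).2) + ((b v).1 - (b u).1) * (k w ^ 2 - k u ^ 2)
          - (k v ^ 2 - k u ^ 2) * ((b w).1 - (b u).1) - ((b v).2 - (b u).2) * (k w - k u))
        (γ := (k u - k v) * (k v - k w) * (k w - k u)) (Or.inr (Or.inr
          (mul_ne_zero (mul_ne_zero (kinj _ _ h1) (kinj _ _ h2)) (kinj _ _ h3))))] with e he _ _ _ h'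
      apply he
      rw [← h']
      simp only [Dt, P]
      ring
    · exact Eventually.of_forall fun e a b c => (h ⟨a, b, c⟩).elim
  have c3 := pos_ev none (some (some none)) (some none) (by simp only [b, Dt]; nlinarith)
  have c4 : ∀ᶠ e in 𝓝[>] (0 : ℝ), ∀ v : V, Ins (P e none) (P e (some (some none))) (P e (some none)) (P e (some (some (some v)))) := by
    rw [eventually_all]; intro v
    obtain ⟨r1, r2⟩ := hR v
    rw [abs_lt] at r1 r2
    filter_upwards [pos_ev (some (some none)) (some none) (some (some (some v))) (by simp only [b, Dt]; nlinarith),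
      pos_ev (some none) none (some (some (some v))) (by simp only [b, Dt]; nlinarith),
      pos_ev none (some (some none)) (some (some (some v))) (by simp only [b, Dt]; nlinarith)] with e x1 x2 x3
    exact ⟨x1, x2, x3⟩
  have c5 : ∀ᶠ e in 𝓝[>] (0 : ℝ), ∀ u v r s, G.Adj u v → G.Adj r s →
      ¬ Cr (P e (some (some (some u)))) (P e (some (some (some v)))) (P e (some (some (some r)))) (P e (some (some (some s)))) := by
    rw [eventually_all]; intro u
    rw [eventually_all]; intro v
    rw [eventually_all]; intro r
    rw [eventually_all]; intro s
    by_cases hs : G.Adj u v ∧ G.Adj r s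
    swap
    · exact Eventually.of_forall fun e a b => (hs ⟨a, b⟩).elim
    obtain ⟨a1, a2⟩ := hs
    by_cases hsh : u = r ∨ u = s ∨ v = r ∨ v = s
    · refine Eventually.of_forall fun e _ _ hc => ?_
      have h1 := hc.1
      rcases hsh with rfl | rfl | rfl | rfl <;> simp [Dt_self, Dt_self'] at h1
    push Not at hsh
    obtain ⟨n1, n2, n3, n4⟩ := hsh
    have hdis : Disjoint (segment ℝ (po u) (po v)) (segment ℝ (po r) (po s)) := by
      rw [Set.disjoint_left]
      intro p p1 p2
      obtain ⟨q1, q2⟩ := hpl u v r s a1 a2 (by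
        intro h
        rcases Sym2.eq_iff.1 h with ⟨rfl, _⟩ | ⟨rfl, _⟩
        · exact n1 rfl
        · exact n2 rfl) p p1 p2
      rcases q1 with q1 | q1 <;> rcases q2 with q2 | q2
      · exact n1 (inj (q1.symm.trans q2))
      · exact n2 (inj (q1.symm.trans q2))
      · exact n3 (inj (q1.symm.trans q2))
      · exact n4 (inj (q1.symm.trans q2))
    have cseg : ∀ a b : ℝ × ℝ, IsCompact (segment ℝ a b) := by
      intro a b
      rw [segment_eq_image_lineMap]
      exact isCompact_Icc.image (by fun_prop)
    obtain ⟨f, c, d, f1, cd, f2⟩ := geometric_hahn_banach_compact_closed (convex_segment (po u) (po v)) (cseg _ _)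
      (convex_segment (po r) (po s)) (cseg _ _).isClosed hdis
    have lo : ∀ w, f (po w) < c → ∀ᶠ e in 𝓝[>] (0 : ℝ), f (P e (some (some (some w)))) < c := by
      intro w h
      have := (f.continuous.comp (Pc (some (some (some w))))).tendsto 0
      simp only [Function.comp, P0] at this
      exact (this.eventually_lt_const h).filter_mono nhdsWithin_le_nhds
    have hi : ∀ w, d < f (po w) → ∀ᶠ e in 𝓝[>] (0 : ℝ), d < f (P e (some (some (some w)))) := by
      intro w h
      have := (f.continuous.comp (Pc (some (some (some w))))).tendsto 0
      simp only [Function.comp, P0] at this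
      exact (this.eventually_const_lt h).filter_mono nhdsWithin_le_nhds
    filter_upwards [lo u (f1 _ (left_mem_segment ℝ _ _)), lo v (f1 _ (right_mem_segment ℝ _ _)),
      hi r (f2 _ (left_mem_segment ℝ _ _)), hi s (f2 _ (right_mem_segment ℝ _ _))] with e x1 x2 x3 x4 _ _ hc
    obtain ⟨α, β, q1, q2, q3, q4, e1, e2⟩ := hc.par
    have : (1 - α) • P e (some (some (some u))) + α • P e (some (some (some v))) =
        (1 - β) • P e (some (some (some r))) + β • P e (some (some (some s))) := by
      ext
      · simp only [Prod.fst_add, Prod.smul_fst, smul_eq_mul]; linarith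
      · simp only [Prod.snd_add, Prod.smul_snd, smul_eq_mul]; linarith
    have := congrArg f this
    simp only [map_add, map_smul, smul_eq_mul] at this
    nlinarith
  obtain ⟨e, h1, h2, h3, h4, h5⟩ := (c1.and (c2.and (c3.and (c4.and c5)))).exists
  refine ⟨P e, ⟨h1, h2⟩, h3, ?_, h5⟩
  intro v a b c
  match v with
  | none => exact (a rfl).elim
  | some none => exact (b rfl).elim
  | some (some none) => exact (c rfl).elim
  | some (some (some v)) => exact h4 v

theorem embed {V : Type} [Fintype V] {G : SimpleGraph V} (hV : 3 ≤ Fintype.card V) (hp : IsPlanar G) :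
    ∃ (G' : SimpleGraph V) (F' : V → V → V → Prop), IsTri G' F' ∧ G ≤ G' := by
  classical
  obtain ⟨pos, hg, ho, hI, hc⟩ := perturb hp
  obtain ⟨G0, F0, T0, f0, d0⟩ := IsTri.start (Fintype.card V) (V := Option (Option (Option V))) (by simp)
    (x := none) (y := some none) (z := some (some none)) hg (by simp) (by simp) (by simp) ho hI
  have key : ∀ l : Finset (V × V), (∀ e ∈ l, G.Adj e.1 e.2) → ∃ G1 F1, St G1 F1 none (some none) (some (some none)) pos ∧
      ∀ e ∈ l, G1.Adj (some (some (some e.1))) (some (some (some e.2))) := by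
    intro l
    induction l using Finset.induction_on with
    | empty => exact fun _ => ⟨G0, F0, ⟨T0, f0, d0, hg, hI⟩, by simp⟩
    | insert e l hel ih =>
      intro hl
      obtain ⟨G1, F1, S1, h1⟩ := ih (fun e' he' => hl e' (Finset.mem_insert_of_mem he'))
      have he := hl e (Finset.mem_insert_self _ _)
      obtain ⟨G2, F2, S2, a2, k2⟩ := St.insert _ G1 F1 S1 (some (some (some e.1))) (some (some (some e.2)))
        (by simpa using he.ne) le_rfl
      refine ⟨G2, F2, S2, ?_⟩
      intro e' he'
      rcases Finset.mem_insert.1 he' with rfl | he'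
      · exact a2
      · exact k2 _ _ (h1 e' he') (hc _ _ _ _ he (hl e' (Finset.mem_insert_of_mem he')))
  obtain ⟨G1, F1, S1, h1⟩ := key (Finset.univ.filter fun e => G.Adj e.1 e.2) (by simp)
  obtain ⟨G2, F2, T2, h2, -⟩ := IsTri.del (by simp; omega) _ S1.tri rfl
  obtain ⟨G3, F3, T3, h3, -⟩ := IsTri.del (by simp; omega) _ T2 rfl
  obtain ⟨G4, F4, T4, h4, -⟩ := IsTri.del hV _ T3 rfl
  exact ⟨G4, F4, T4, fun u v h => h4 _ _ (h3 _ _ (h2 _ _ (h1 (u, v) (by simpa using h))))⟩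


open SimpleGraph

theorem planar_comap {V W : Type} {G : SimpleGraph V} {H : SimpleGraph W} (f : V → W) (hf : Function.Injective f)
    (h : ∀ u v, G.Adj u v → H.Adj (f u) (f v)) (hp : IsPlanar H) : IsPlanar G := by
  obtain ⟨pos, inj, hp⟩ := hp
  refine ⟨pos ∘ f, inj.comp hf, fun u v x y h1 h2 hne p p1 p2 => ?_⟩
  refine hp _ _ _ _ (h _ _ h1) (h _ _ h2) (fun e => hne ?_) p p1 p2
  rcases Sym2.eq_iff.1 e with ⟨a, b⟩ | ⟨a, b⟩
  · rw [hf a, hf b]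
  · rw [hf a, hf b]; exact Sym2.eq_swap

theorem planar_mono {V : Type} {G H : SimpleGraph V} (h : G ≤ H) (hp : IsPlanar H) : IsPlanar G :=
  planar_comap id Function.injective_id (fun _ _ k => h k) hp

theorem IsTri.maximal {V : Type} [Fintype V] {G : SimpleGraph V} {F : V → V → V → Prop} (hV : 3 ≤ Fintype.card V)
    (T : IsTri G F) : IsMaximalPlanar G := by
  refine ⟨T.planar hV, fun u v huv hna hp => ?_⟩
  obtain ⟨G', F', T', hle⟩ := embed hV hp
  have e := IsTri.eq_of_le hV T T' (le_trans le_sup_left hle)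
  apply hna
  rw [e]
  apply hle
  simp [huv]

theorem tri_of_maximal {V : Type} [Fintype V] {G : SimpleGraph V} (hV : 3 ≤ Fintype.card V) (h : IsMaximalPlanar G) :
    ∃ F, IsTri G F := by
  obtain ⟨H, F, T, hle⟩ := embed hV h.1
  have : G = H := by
    refine le_antisymm hle fun u v huv => ?_
    by_contra hna
    refine h.2 u v huv.ne hna (planar_mono (H := H) (sup_le hle ?_) (T.planar hV))
    intro s t hst
    rw [SimpleGraph.fromEdgeSet_adj] at hst
    rcases Sym2.eq_iff.1 hst.1 with ⟨rfl, rfl⟩ | ⟨rfl, rfl⟩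
    · exact huv
    · exact huv.symm
  exact ⟨F, this ▸ T⟩

theorem kempe {V : Type} (G : SimpleGraph V) (c : V → Fin 4) (hc : ∀ u v, G.Adj u v → c u ≠ c v) (p q : Fin 4)
    (a : V) (ha : c a = p ∨ c a = q) : ∃ c' : V → Fin 4, (∀ u v, G.Adj u v → c' u ≠ c' v) ∧ c' a = Equiv.swap p q (c a) ∧
      ∀ s, ¬ Relation.ReflTransGen (fun s t => G.Adj s t ∧ (c s = p ∨ c s = q) ∧ (c t = p ∨ c t = q)) a s → c' s = c s := by
  classical
  set K := fun s => Relation.ReflTransGen (fun s t => G.Adj s t ∧ (c s = p ∨ c s = q) ∧ (c t = p ∨ c t = q)) a s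
  have Kc : ∀ s, K s → c s = p ∨ c s = q := by
    intro s h
    rcases Relation.ReflTransGen.cases_tail h with rfl | ⟨t, -, h⟩
    · exact ha
    · exact h.2.2
  have one : ∀ u v, G.Adj u v → K u → ¬ K v → Equiv.swap p q (c u) ≠ c v := by
    intro u v h hu hv e
    have h1 := Kc u hu
    apply hv
    refine Relation.ReflTransGen.tail hu ⟨h, h1, ?_⟩
    rw [← e]
    rcases h1 with h1 | h1 <;> rw [h1] <;> simp
  refine ⟨fun s => if K s then Equiv.swap p q (c s) else c s, ?_, ?_, ?_⟩
  · intro u v h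
    beta_reduce
    by_cases hu : K u <;> by_cases hv : K v
    · rw [if_pos hu, if_pos hv]; exact fun e => hc u v h ((Equiv.swap p q).injective e)
    · rw [if_pos hu, if_neg hv]; exact one u v h hu hv
    · rw [if_neg hu, if_pos hv]; exact (one v u h.symm hv hu).symm
    · rw [if_neg hu, if_neg hv]; exact hc u v h
  · exact if_pos Relation.ReflTransGen.refl
  · intro s hs; exact if_neg hs

theorem core {V : Type} [Fintype V] {EP : SimpleGraph V} (hEP : IsMinCounterexample EP)
    {F : V → V → V → Prop} (T : IsTri EP F) (hV : 5 ≤ Fintype.card V)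
    {a b N S : V} (h1 : F a b N) (h2 : F b a S)
    (htwo : ∀ w : V, EP.Adj a w → EP.Adj b w → w = N ∨ w = S) :
    IsMaximalPlanar (IsTri.flipG EP a b N S) ∧ (IsTri.flipG EP a b N S).Colorable 4 := by
  classical
  have hNS := T.opp_ne (by omega) h1 h2
  have nab := (T.adj h1).ne
  have d : ∀ u v, (EP.deleteEdges {s(a, b)}).Adj u v ↔ EP.Adj u v ∧ s(u, v) ≠ s(a, b) := by
    intro u v; rw [SimpleGraph.deleteEdges_adj]; simp
  -- colour of the contraction
  obtain ⟨c, hc, cab⟩ : ∃ c : V → Fin 4, (∀ u v, (EP.deleteEdges {s(a, b)}).Adj u v → c u ≠ c v) ∧ c a = c b := by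
    obtain ⟨G1, F1, T1, k1, k2⟩ := IsTri.contract (by omega) _ T h1 h2 htwo rfl
    have hcard : Fintype.card {v // v ≠ a} + 1 = Fintype.card V := by
      rw [Fintype.card_subtype_compl]; simp; omega
    have pl : IsPlanar (G1.comap (Subtype.val : {v // v ≠ a} → V)) :=
      planar_comap Subtype.val Subtype.val_injective (fun _ _ h => h) (T1.planar (by omega))
    obtain ⟨G2, F2, T2, hle⟩ := embed (by omega) pl
    have col : G2.Colorable 4 := by
      by_contra hcol
      have := hEP.2.2 _ G2 (T2.maximal (by omega)) hcol
      omega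
    obtain ⟨c0⟩ := col
    have c0v : ∀ u v (hu : u ≠ a) (hv : v ≠ a), G1.Adj u v → c0 ⟨u, hu⟩ ≠ c0 ⟨v, hv⟩ :=
      fun u v hu hv h => c0.valid (hle (show (G1.comap Subtype.val).Adj ⟨u, hu⟩ ⟨v, hv⟩ from h))
    have ha : ∀ v (hv : v ≠ a), EP.Adj a v → v ≠ b → c0 ⟨b, nab.symm⟩ ≠ c0 ⟨v, hv⟩ :=
      fun v hv h hb => c0v _ _ _ _ (k2 v hb h)
    refine ⟨fun v => if hv : v = a then c0 ⟨b, nab.symm⟩ else c0 ⟨v, hv⟩, ?_, ?_⟩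
    · intro u v huv
      rw [d] at huv
      obtain ⟨huv, hne⟩ := huv
      beta_reduce
      by_cases hu : u = a
      · have hv : v ≠ a := fun h => huv.ne (hu.trans h.symm)
        rw [dif_pos hu, dif_neg hv]
        subst hu
        exact ha v hv huv (by rintro rfl; exact hne rfl)
      · by_cases hv : v = a
        · rw [dif_neg hu, dif_pos hv]
          subst hv
          exact (ha u hu huv.symm (by rintro rfl; exact hne Sym2.eq_swap)).symm
        · rw [dif_neg hu, dif_neg hv]
          exact c0v _ _ _ _ (k1 u v hu hv huv)
    · beta_reduce
      rw [dif_pos rfl, dif_neg nab.symm]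
  have aN : (EP.deleteEdges {s(a, b)}).Adj a N := by
    rw [d]; refine ⟨(T.adj3 h1).symm, fun e => ?_⟩
    rcases Sym2.eq_iff.1 e with ⟨_, h⟩ | ⟨h, _⟩
    · exact (T.adj2 h1).ne h.symm
    · exact nab h
  have aS : (EP.deleteEdges {s(a, b)}).Adj a S := by
    rw [d]; refine ⟨T.adj2 h2, fun e => ?_⟩
    rcases Sym2.eq_iff.1 e with ⟨_, h⟩ | ⟨h, _⟩
    · exact (T.adj3 h2).ne h
    · exact nab h
  have nc : ∀ p q : Fin 4, p ≠ c a → q ≠ c a → p ≠ q → (c N = p ∨ c N = q) →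
      ¬ Relation.ReflTransGen (fun s t => EP.Adj s t ∧ (c s = p ∨ c s = q) ∧ (c t = p ∨ c t = q)) N S := by
    intro p q hp hq hpq hN hA
    obtain ⟨r, r1, r2, r3⟩ : ∃ r : Fin 4, r ≠ p ∧ r ≠ q ∧ r ≠ c a := by
      have : ∀ x y z : Fin 4, ∃ r : Fin 4, r ≠ x ∧ r ≠ y ∧ r ≠ z := by decide
      exact this _ _ _
    obtain ⟨c', v1, v2, v3⟩ := kempe (EP.deleteEdges {s(a, b)}) c hc (c a) r a (Or.inl rfl)
    have hb : c' b = c b := by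
      apply v3
      intro hB
      refine T.sep h1 h2 (fun s => c s = p ∨ c s = q) (fun s => c s = c a ∨ c s = r) ?_ hA hN
        (Relation.ReflTransGen.mono (fun s t h => ⟨((d _ _).1 h.1).1, h.2.1, h.2.2, ((d _ _).1 h.1).2⟩) _ _ hB)
      rintro s (e | e) (e' | e')
      · exact hp (e.symm.trans e')
      · exact r1 (e'.symm.trans e)
      · exact hq (e.symm.trans e')
      · exact r2 (e'.symm.trans e)
    rw [Equiv.swap_apply_left] at v2
    refine hEP.2.1 ⟨SimpleGraph.Coloring.mk c' fun {u v} huv => ?_⟩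
    by_cases e : s(u, v) = s(a, b)
    · rcases Sym2.eq_iff.1 e with ⟨rfl, rfl⟩ | ⟨rfl, rfl⟩
      · rw [v2, hb, ← cab]; exact r3
      · rw [v2, hb, ← cab]; exact r3.symm
    · exact v1 u v ((d _ _).2 ⟨huv, e⟩)
  have cN := (hc _ _ aN).symm
  have cS := (hc _ _ aS).symm
  have nNS : ¬ EP.Adj N S := by
    intro h
    have hne : c N ≠ c S := by
      apply hc; rw [d]; refine ⟨h, fun e => ?_⟩
      rcases Sym2.eq_iff.1 e with ⟨h', _⟩ | ⟨_, h'⟩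
      · exact (T.adj3 h1).ne h'
      · exact (T.adj2 h2).ne h'.symm
    exact nc (c N) (c S) cN cS hne (Or.inl rfl) (Relation.ReflTransGen.single ⟨h, Or.inl rfl, Or.inr rfl⟩)
  refine ⟨IsTri.maximal (by omega) (T.flip' h1 h2 hNS nNS), ?_⟩
  have fin : ∀ c' : V → Fin 4, (∀ u v, (EP.deleteEdges {s(a, b)}).Adj u v → c' u ≠ c' v) → c' N ≠ c' S →
      (IsTri.flipG EP a b N S).Colorable 4 := by
    intro c' hc' hne
    refine ⟨SimpleGraph.Coloring.mk c' fun {u v} huv => ?_⟩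
    rcases huv with huv | huv
    · exact hc' u v huv
    · rw [SimpleGraph.fromEdgeSet_adj] at huv
      rcases Sym2.eq_iff.1 huv.1 with ⟨rfl, rfl⟩ | ⟨rfl, rfl⟩
      · exact hne
      · exact hne.symm
  by_cases e : c N = c S
  · obtain ⟨q, q1, q2⟩ : ∃ q : Fin 4, q ≠ c a ∧ c N ≠ q := by
      have : ∀ x y : Fin 4, ∃ r : Fin 4, r ≠ x ∧ y ≠ r := by decide
      exact this _ _
    obtain ⟨c', v1, v2, v3⟩ := kempe (EP.deleteEdges {s(a, b)}) c hc (c N) q N (Or.inl rfl)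
    rw [Equiv.swap_apply_left] at v2
    refine fin c' v1 ?_
    rw [v2, v3 S, ← e]
    · exact q2.symm
    · intro hB
      exact nc (c N) q cN q1 q2 (Or.inl rfl) (Relation.ReflTransGen.mono (fun s t h => ⟨((d _ _).1 h.1).1, h.2⟩) _ _ hB)
  · exact fin c hc e

/-- Diagonal flip: deleting the edge `ab` of a minimum-order non-4-colorable maximal
planar graph and adding the diagonal `NS` of the resulting quadrilateral face yields
a 4-colorable maximal planar graph. -/
theorem stmt_14 {V : Type} [Fintype V] (EP : SimpleGraph V)
    (hEP : IsMinCounterexample EP)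
    (a b N S : V) (hab : EP.Adj a b)
    (hNS : N ≠ S)
    (hN : EP.Adj a N ∧ EP.Adj b N) (hS : EP.Adj a S ∧ EP.Adj b S)
    (htwo : ∀ w : V, EP.Adj a w → EP.Adj b w → w = N ∨ w = S) :
    IsMaximalPlanar ((EP.deleteEdges {s(a, b)}) ⊔ SimpleGraph.fromEdgeSet {s(N, S)}) ∧
    ((EP.deleteEdges {s(a, b)}) ⊔ SimpleGraph.fromEdgeSet {s(N, S)}).Colorable 4 := by
  have hV : 5 ≤ Fintype.card V := by
    by_contra h
    exact hEP.2.1 ((SimpleGraph.colorable_of_fintype EP).mono (by omega))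
  obtain ⟨F, T⟩ := tri_of_maximal (by omega) hEP.1
  obtain ⟨w, hw⟩ := T.ex hab
  obtain ⟨w', hw'⟩ := T.ex hab.symm
  have hne := T.opp_ne (by omega) hw hw'
  rcases htwo w (T.adj3 hw).symm (T.adj2 hw) with rfl | rfl <;>
    rcases htwo w' (T.adj2 hw') (T.adj3 hw').symm with rfl | rfl
  · exact (hne rfl).elim
  · exact core hEP T hV hw hw' htwo
  · have := core hEP T hV hw hw' (fun w a b => (htwo w a b).symm)
    unfold IsTri.flipG at this
    rw [Sym2.eq_swap] at this
    rwa [Sym2.eq_swap (a := a), Sym2.eq_swap (a := w')] at *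
  · exact (hne rfl).elim
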